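/- Let f(Z) = 3Z(1728 − Z) and g(Z) = 2Z(1728 − Z)², so that every specialization E(t) with t ≠ 0, 1728 has j-invariant equal to t. Then for every ε > 0 there is a constant C (depending only on ε) such that for all real T ≥ 1, x ≥ 2 and every sequence of integers 𝔄 = (a_p) indexed by the primes, one has Σ_{t ∈ F(T), Δ(t) ≠ 0} π_{E(t)}(𝔄; x) ≤ C (T x^{5/4+ε} + T² x^{3/4+ε}). -/

import Mathlib

open Polynomial Finset

attribute [local instance 10] Classical.propDecidable

noncomputable section

/-- The discriminant polynomial `Δ = -16(4f³+27g²)`. -/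
def Dpoly (f g : Polynomial ℤ) : Polynomial ℤ := -16 * (4 * f ^ 3 + 27 * g ^ 2)

/-- Nondegeneracy: `Δ ≠ 0` as a polynomial and the `j`-invariant
`j = -1728(4f)³/Δ` is not a constant rational function, i.e. `-1728(4f)³`
is not a rational multiple of `Δ`. -/
def Nondeg (f g : Polynomial ℤ) : Prop :=
  Dpoly f g ≠ 0 ∧
    ¬∃ c : ℚ, (-1728 : Polynomial ℚ) * (4 * f.map (Int.castRingHom ℚ)) ^ 3 =
      Polynomial.C c * (Dpoly f g).map (Int.castRingHom ℚ)

/-- The set `F(T) = {u/v ∈ ℚ : gcd(u,v) = 1, 1 ≤ u, v ≤ T}`. -/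
def FT (T : ℝ) : Finset ℚ :=
  ((Finset.Icc (1 : ℤ) ⌊T⌋ ×ˢ Finset.Icc (1 : ℤ) ⌊T⌋).filter
      fun w => Int.gcd w.1 w.2 = 1).image fun w => (w.1 : ℚ) / (w.2 : ℚ)

/-- Reduction of a rational number `t` modulo `p`, as `num·den⁻¹` in `ZMod p`. -/
def redQ (p : ℕ) (t : ℚ) : ZMod p := (t.num : ZMod p) * (t.den : ZMod p)⁻¹

/-- The number of `𝔽_p`-points of the curve `Y² = X³ + AX + B`
(affine points together with the point at infinity). -/
def numPoints (p : ℕ) (A B : ZMod p) : ℕ :=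
  1 + Nat.card {P : ZMod p × ZMod p // P.2 ^ 2 = P.1 ^ 3 + A * P.1 + B}

/-- The Frobenius trace `p + 1 - #E(𝔽_p)` of `Y² = X³ + AX + B` over `𝔽_p`. -/
def frobTrace (p : ℕ) (A B : ZMod p) : ℤ := (p : ℤ) + 1 - numPoints p A B

/-- `a_p(E(t))`: the Frobenius trace of the reduction modulo `p` of the curve
`E(t) : Y² = X³ + f(t)X + g(t)`. -/
def apE (f g : Polynomial ℤ) (p : ℕ) (t : ℚ) : ℤ :=
  frobTrace p ((f.map (Int.castRingHom (ZMod p))).eval (redQ p t))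
    ((g.map (Int.castRingHom (ZMod p))).eval (redQ p t))

/-- Good reduction of `E(t)` at `p`: the denominator of `t` is coprime to `p`
and `Δ(t) ≢ 0 (mod p)`. -/
def goodRed (f g : Polynomial ℤ) (p : ℕ) (t : ℚ) : Prop :=
  ¬(p ∣ t.den) ∧ ((Dpoly f g).map (Int.castRingHom (ZMod p))).eval (redQ p t) ≠ 0

/-- `π_{E(t)}(𝔄; x)`: the number of primes `p ≤ x` of good reduction for `E(t)`
with `a_p(E(t)) = a_p`. -/
def piSeq (f g : Polynomial ℤ) (a : ℕ → ℤ) (t : ℚ) (x : ℝ) : ℕ :=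
  ((Finset.Icc 1 ⌊x⌋₊).filter fun p =>
      p.Prime ∧ goodRed f g p t ∧ apE f g p t = a p).card

/-- `π_{E(t)}(K; x)` for `K = ℚ(√d)`: the number of primes `p ≤ x` of good
reduction for `E(t)` with `a_p(E(t)) ≠ 0` and `a_p(E(t))² - 4p = d·m²`. -/
def piK (f g : Polynomial ℤ) (d : ℤ) (t : ℚ) (x : ℝ) : ℕ :=
  ((Finset.Icc 1 ⌊x⌋₊).filter fun p =>
      p.Prime ∧ goodRed f g p t ∧ apE f g p t ≠ 0 ∧
        ∃ m : ℤ, 0 < m ∧ (apE f g p t) ^ 2 - 4 * (p : ℤ) = d * m ^ 2).card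

/-- The Frobenius angle `ψ_p(E(t)) ∈ [0, π]`, with `cos ψ_p = a_p/(2√p)`. -/
def psiE (f g : Polynomial ℤ) (p : ℕ) (t : ℚ) : ℝ :=
  Real.arccos ((apE f g p t : ℝ) / (2 * Real.sqrt p))

/-- `π_{E(t)}(α, β; x)`: the number of primes `p ≤ x` of good reduction for
`E(t)` with `ψ_p(E(t)) ∈ [α, β]`. -/
def piAngle (f g : Polynomial ℤ) (α β : ℝ) (t : ℚ) (x : ℝ) : ℕ :=
  ((Finset.Icc 1 ⌊x⌋₊).filter fun p =>
      p.Prime ∧ goodRed f g p t ∧ psiE f g p t ∈ Set.Icc α β).card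

/-- The Sato–Tate density `μ_ST(α, β) = (2/π) ∫_α^β sin²θ dθ`. -/
def muST (α β : ℝ) : ℝ := (2 / Real.pi) * ∫ θ in α..β, Real.sin θ ^ 2

/-- `π(x)`: the number of primes `p ≤ x`. -/
def primePi (x : ℝ) : ℕ := ((Finset.Icc 1 ⌊x⌋₊).filter Nat.Prime).card

/-- `e_p(w) = exp(2πi w/p)`. -/
def ep (p : ℕ) (w : ZMod p) : ℂ :=
  Complex.exp (2 * (Real.pi : ℂ) * Complex.I * (w.val : ℂ) / (p : ℂ))

/-- The polynomial `f(Z) = 3Z(1728 - Z)`. -/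
def fJ : Polynomial ℤ := 3 * X * (1728 - X)

/-- The polynomial `g(Z) = 2Z(1728 - Z)²`. -/
def gJ : Polynomial ℤ := 2 * X * (1728 - X) ^ 2

section

theorem FT_bounds {T : ℝ} {t : ℚ} (ht : t ∈ FT T) :
    0 < t ∧ 1 ≤ t.num ∧ (t.num : ℝ) ≤ T ∧ (t.den : ℝ) ≤ T := by
  unfold FT at ht
  simp only [mem_image, mem_filter, mem_product, mem_Icc, Prod.exists] at ht
  obtain ⟨u, v, ⟨⟨⟨hu1, hu2⟩, hv1, hv2⟩, hg⟩, rfl⟩ := ht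
  have hv0 : (0 : ℤ) < v := by linarith
  have h1 := Rat.num_div_eq_of_coprime hv0 hg
  have h2 := Rat.den_div_eq_of_coprime hv0 hg
  have hT0 := Int.floor_le T
  refine ⟨?_, ?_, ?_, ?_⟩
  · have : (0 : ℚ) < u := by exact_mod_cast (by linarith : (0 : ℤ) < u)
    have : (0 : ℚ) < v := by exact_mod_cast hv0
    positivity
  · rw [h1]; exact hu1
  · rw [h1]
    exact le_trans (by exact_mod_cast hu2) hT0
  · have : (((u / v : ℚ).den : ℤ) : ℝ) ≤ T := by
      rw [h2]
      exact le_trans (by exact_mod_cast hv2) hT0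
    exact_mod_cast this

theorem FT_card_le (T : ℝ) (hT : 1 ≤ T) : ((FT T).card : ℝ) ≤ T ^ 2 := by
  have h1 : (FT T).card ≤ ⌊T⌋.toNat * ⌊T⌋.toNat := by
    unfold FT
    refine card_image_le.trans ((card_filter_le _ _).trans ?_)
    simp
  have h2 : ((⌊T⌋.toNat : ℕ) : ℝ) ≤ T := by
    have h3 : (0 : ℤ) ≤ ⌊T⌋ := Int.floor_nonneg.mpr (by linarith)
    have : ((⌊T⌋.toNat : ℤ) : ℝ) ≤ T := by
      rw [Int.toNat_of_nonneg h3]; exact Int.floor_le T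
    exact_mod_cast this
  calc ((FT T).card : ℝ) ≤ (⌊T⌋.toNat : ℝ) * ⌊T⌋.toNat := by exact_mod_cast h1
    _ ≤ T * T := by gcongr
    _ = T ^ 2 := by ring

theorem prime_le_cross {p : ℕ} (hp : p.Prime) {t t' : ℚ} (ht : ¬ p ∣ t.den) (ht' : ¬ p ∣ t'.den)
    (h : redQ p t = redQ p t') (hne : t ≠ t') :
    (p : ℝ) ≤ |(t.num : ℝ) * t'.den - t'.num * t.den| := by
  have := Fact.mk hp
  have hd : (t.den : ZMod p) ≠ 0 := by rwa [Ne, ZMod.natCast_eq_zero_iff]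
  have hd' : (t'.den : ZMod p) ≠ 0 := by rwa [Ne, ZMod.natCast_eq_zero_iff]
  have h1 : (((t.num * t'.den - t'.num * t.den : ℤ)) : ZMod p) = 0 := by
    unfold redQ at h
    push_cast
    field_simp at h
    linear_combination h
  rw [ZMod.intCast_zmod_eq_zero_iff_dvd] at h1
  have h2 : t.num * t'.den - t'.num * t.den ≠ 0 := by
    intro h0
    apply hne
    rw [← Rat.num_div_den t, ← Rat.num_div_den t']
    have a1 : (t.den : ℚ) ≠ 0 := by exact_mod_cast t.den_nz
    have a2 : (t'.den : ℚ) ≠ 0 := by exact_mod_cast t'.den_nz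
    rw [div_eq_div_iff a1 a2]
    have : t.num * t'.den = t'.num * t.den := by linarith
    exact_mod_cast this
  have h3 := Int.le_of_dvd (abs_pos.mpr h2) ((dvd_abs _ _).mpr h1)
  exact_mod_cast h3

theorem floor_ne_of_one_le {a b : ℝ} (ha : 0 ≤ a) (hb : 0 ≤ b) (h : 1 ≤ |a - b|) :
    ⌊a⌋₊ ≠ ⌊b⌋₊ := by
  intro he
  have h1 := Nat.floor_le ha
  have h2 := Nat.floor_le hb
  have h3 := Nat.lt_floor_add_one a
  have h4 := Nat.lt_floor_add_one b
  rw [he] at h1 h3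
  have : |a - b| < 1 := by rw [abs_lt]; constructor <;> linarith
  linarith

theorem card_le_of_separated (S : Finset ℚ) (φ : ℚ → ℝ) (K : ℝ) (hK : 0 ≤ K)
    (h0 : ∀ t ∈ S, 0 ≤ φ t) (h1 : ∀ t ∈ S, φ t ≤ K)
    (h2 : ∀ t ∈ S, ∀ t' ∈ S, t ≠ t' → 1 ≤ |φ t - φ t'|) : (S.card : ℝ) ≤ K + 1 := by
  have : S.card ≤ (Finset.range (⌊K⌋₊ + 1)).card := by
    refine Finset.card_le_card_of_injOn (fun t => ⌊φ t⌋₊) ?_ ?_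
    · intro t ht
      simp only [coe_range, Set.mem_Iio]
      exact Nat.lt_succ_of_le (Nat.floor_le_floor (h1 t ht))
    · intro t ht t' ht' he
      by_contra hne
      exact floor_ne_of_one_le (h0 t ht) (h0 t' ht') (h2 t ht t' ht' hne) he
  rw [card_range] at this
  calc (S.card : ℝ) ≤ ((⌊K⌋₊ + 1 : ℕ) : ℝ) := by exact_mod_cast this
    _ ≤ K + 1 := by push_cast; linarith [Nat.floor_le hK]

theorem FT_residue_card_le (T : ℝ) (hT : 1 ≤ T) {p : ℕ} (hp : p.Prime) (s : ZMod p) :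
    (((FT T).filter fun t => ¬ p ∣ t.den ∧ redQ p t = s).card : ℝ) ≤ 2 * (1 + T ^ 2 / p) := by
  have hp0 : (0 : ℝ) < p := by exact_mod_cast hp.pos
  set S := (FT T).filter fun t => ¬ p ∣ t.den ∧ redQ p t = s with hS
  have key : ∀ t ∈ S, ∀ t' ∈ S, t ≠ t' →
      (p : ℝ) ≤ |(t.num : ℝ) * t'.den - t'.num * t.den| := by
    intro t ht t' ht' hne
    rw [hS, mem_filter] at ht ht'
    exact prime_le_cross hp ht.2.1 ht'.2.1 (ht.2.2.trans ht'.2.2.symm) hne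
  have hb : ∀ t ∈ S, (1 : ℝ) ≤ t.num ∧ (t.num : ℝ) ≤ T ∧ (1 : ℝ) ≤ t.den ∧ (t.den : ℝ) ≤ T := by
    intro t ht
    rw [hS, mem_filter] at ht
    obtain ⟨_, h1, h2, h3⟩ := FT_bounds ht.1
    exact ⟨by exact_mod_cast h1, h2, by exact_mod_cast t.pos, h3⟩
  have hK : 0 ≤ T ^ 2 / p := by positivity
  have hA : ((S.filter fun t => t.num ≤ t.den).card : ℝ) ≤ T ^ 2 / p + 1 := by
    refine card_le_of_separated _ (fun t => (t.num / t.den : ℝ) * (T ^ 2 / p)) _ hK ?_ ?_ ?_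
    · intro t ht
      obtain ⟨h1, h2, h3, h4⟩ := hb t (mem_filter.mp ht).1
      positivity
    · intro t ht
      obtain ⟨h1, h2, h3, h4⟩ := hb t (mem_filter.mp ht).1
      have h5 : (t.num : ℝ) ≤ t.den := by exact_mod_cast (mem_filter.mp ht).2
      have : (t.num : ℝ) / t.den ≤ 1 := by rw [div_le_one (by linarith)]; exact h5
      exact mul_le_of_le_one_left hK this
    · intro t ht t' ht' hne
      have hk := key t (mem_filter.mp ht).1 t' (mem_filter.mp ht').1 hne
      obtain ⟨h1, h2, h3, h4⟩ := hb t (mem_filter.mp ht).1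
      obtain ⟨h1', h2', h3', h4'⟩ := hb t' (mem_filter.mp ht').1
      have e : (t.num / t.den : ℝ) * (T ^ 2 / p) - (t'.num / t'.den : ℝ) * (T ^ 2 / p)
          = ((t.num : ℝ) * t'.den - t'.num * t.den) * (T ^ 2 / (p * (t.den * t'.den))) := by
        have : (t.den : ℝ) ≠ 0 := by positivity
        have : (t'.den : ℝ) ≠ 0 := by positivity
        field_simp
      have hpos : 0 < T ^ 2 / (p * (t.den * t'.den : ℝ)) := by positivity
      simp only [e, abs_mul, abs_of_pos hpos]
      have h5 : (t.den : ℝ) * t'.den ≤ T ^ 2 := by nlinarith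
      calc (1 : ℝ) ≤ p * (T ^ 2 / (p * (t.den * t'.den))) := by
            rw [← mul_div_assoc, mul_div_mul_left _ _ hp0.ne']
            rw [one_le_div (by positivity)]; exact h5
        _ ≤ _ := by gcongr
  have hB : ((S.filter fun t => ¬ t.num ≤ t.den).card : ℝ) ≤ T ^ 2 / p + 1 := by
    refine card_le_of_separated _ (fun t => (t.den / t.num : ℝ) * (T ^ 2 / p)) _ hK ?_ ?_ ?_
    · intro t ht
      obtain ⟨h1, h2, h3, h4⟩ := hb t (mem_filter.mp ht).1
      positivity
    · intro t ht
      obtain ⟨h1, h2, h3, h4⟩ := hb t (mem_filter.mp ht).1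
      have h5 : (t.den : ℝ) ≤ t.num := by
        have := (mem_filter.mp ht).2
        exact_mod_cast (not_le.mp this).le
      have : (t.den : ℝ) / t.num ≤ 1 := by rw [div_le_one (by linarith)]; exact h5
      exact mul_le_of_le_one_left hK this
    · intro t ht t' ht' hne
      have hk := key t (mem_filter.mp ht).1 t' (mem_filter.mp ht').1 hne
      obtain ⟨h1, h2, h3, h4⟩ := hb t (mem_filter.mp ht).1
      obtain ⟨h1', h2', h3', h4'⟩ := hb t' (mem_filter.mp ht').1
      have e : (t.den / t.num : ℝ) * (T ^ 2 / p) - (t'.den / t'.num : ℝ) * (T ^ 2 / p)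
          = -((t.num : ℝ) * t'.den - t'.num * t.den) * (T ^ 2 / (p * (t.num * t'.num))) := by
        have : (t.num : ℝ) ≠ 0 := by positivity
        have : (t'.num : ℝ) ≠ 0 := by positivity
        field_simp
        ring
      have hpos : 0 < T ^ 2 / (p * (t.num * t'.num : ℝ)) := by positivity
      simp only [e, abs_mul, abs_of_pos hpos, abs_neg]
      have h5 : (t.num : ℝ) * t'.num ≤ T ^ 2 := by nlinarith
      calc (1 : ℝ) ≤ p * (T ^ 2 / (p * (t.num * t'.num))) := by
            rw [← mul_div_assoc, mul_div_mul_left _ _ hp0.ne']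
            rw [one_le_div (by positivity)]; exact h5
        _ ≤ _ := by gcongr
  have hsum : (S.card : ℝ) = ((S.filter fun t => t.num ≤ t.den).card : ℝ)
      + ((S.filter fun t => ¬ t.num ≤ t.den).card : ℝ) := by
    rw [← card_filter_add_card_filter_not (s := S) (fun t => t.num ≤ t.den)]
    push_cast
    rfl
  rw [hsum]; linarith

/-- The bound `≪ p^(1/2+ε)` for the number of residues `s` modulo `p` whose curve has a given
Frobenius trace. -/
def ResidueBound : Prop :=
  ∀ ε : ℝ, 0 < ε → ∃ C : ℝ, 0 < C ∧ ∀ p : ℕ, p.Prime → ∀ a : ℤ, ∀ S : Finset (ZMod p),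
    (∀ s ∈ S, ((Dpoly fJ gJ).map (Int.castRingHom (ZMod p))).eval s ≠ 0 ∧
      frobTrace p ((fJ.map (Int.castRingHom (ZMod p))).eval s)
        ((gJ.map (Int.castRingHom (ZMod p))).eval s) = a) →
    (S.card : ℝ) ≤ C * (p : ℝ) ^ (1 / 2 + ε)

theorem sum_inv_sqrt_le (N : ℕ) : ∑ n ∈ Icc 1 N, (n : ℝ) ^ (-(1 / 2) : ℝ) ≤ 2 * √N := by
  induction N with
  | zero => simp
  | succ n ih =>
    rw [Finset.sum_Icc_succ_top (by omega)]
    have h1 : (0 : ℝ) < ((n + 1 : ℕ) : ℝ) := by positivity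
    have h2 : ((n + 1 : ℕ) : ℝ) ^ (-(1 / 2) : ℝ) = 1 / √((n + 1 : ℕ) : ℝ) := by
      rw [Real.rpow_neg h1.le, Real.sqrt_eq_rpow, one_div, one_div]
    rw [h2]
    set s := √((n + 1 : ℕ) : ℝ) with hs
    have hs0 : 0 < s := Real.sqrt_pos.mpr h1
    have hs2 : s ^ 2 = n + 1 := by rw [hs, Real.sq_sqrt h1.le]; push_cast; ring
    have ht2 : √(n : ℝ) ^ 2 = n := Real.sq_sqrt (by positivity)
    have ht0 : 0 ≤ √(n : ℝ) := Real.sqrt_nonneg _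
    have : 2 * √(n : ℝ) + 1 / s ≤ 2 * s := by
      rw [← sub_nonneg]
      have : 2 * s - (2 * √(n : ℝ) + 1 / s) = (2 * s ^ 2 - 2 * √(n : ℝ) * s - 1) / s := by
        field_simp
        ring
      rw [this]
      apply div_nonneg _ hs0.le
      nlinarith [sq_nonneg (s - √(n : ℝ))]
    linarith

theorem FT_trace_card_le {T A : ℝ} (hT : 1 ≤ T) (hA : 0 ≤ A) {p : ℕ} (hp : p.Prime) (a : ℤ)
    (hS : ∀ S : Finset (ZMod p),
      (∀ s ∈ S, ((Dpoly fJ gJ).map (Int.castRingHom (ZMod p))).eval s ≠ 0 ∧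
      frobTrace p ((fJ.map (Int.castRingHom (ZMod p))).eval s)
        ((gJ.map (Int.castRingHom (ZMod p))).eval s) = a) → (S.card : ℝ) ≤ A) :
    (((FT T).filter fun t => goodRed fJ gJ p t ∧ apE fJ gJ p t = a).card : ℝ) ≤
      T * √(2 * A) + 2 * A * T ^ 2 / p := by
  set Q := (FT T).filter fun t => goodRed fJ gJ p t ∧ apE fJ gJ p t = a with hQ
  have hp0 : (0 : ℝ) < p := by exact_mod_cast hp.pos
  have h1 : (Q.card : ℝ) ≤ T ^ 2 :=
    le_trans (by exact_mod_cast card_filter_le _ _) (FT_card_le T hT)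
  have h2 : (Q.card : ℝ) ≤ A * (2 * (1 + T ^ 2 / p)) := by
    set S := Q.image (redQ p) with hSdef
    have hSA : (S.card : ℝ) ≤ A := by
      apply hS
      intro s hs
      rw [hSdef, mem_image] at hs
      obtain ⟨t, ht, rfl⟩ := hs
      rw [hQ, mem_filter] at ht
      exact ⟨ht.2.1.2, ht.2.2⟩
    have h3 : Q.card = ∑ s ∈ S, (Q.filter fun t => redQ p t = s).card :=
      card_eq_sum_card_fiberwise fun t ht => mem_image_of_mem _ ht
    rw [h3]
    push_cast
    calc ∑ s ∈ S, ((Q.filter fun t => redQ p t = s).card : ℝ)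
        ≤ ∑ s ∈ S, 2 * (1 + T ^ 2 / p) := by
          apply sum_le_sum
          intro s _
          refine le_trans ?_ (FT_residue_card_le T hT hp s)
          norm_cast
          apply card_le_card
          intro t ht
          rw [mem_filter, hQ, mem_filter] at ht
          rw [mem_filter]
          exact ⟨ht.1.1, ht.1.2.1.1, ht.2⟩
      _ = S.card * (2 * (1 + T ^ 2 / p)) := by rw [sum_const, nsmul_eq_mul]
      _ ≤ _ := by gcongr
  have h5 : 0 ≤ 2 * A * T ^ 2 / p := by positivity
  have hs : √(2 * A) ^ 2 = 2 * A := Real.sq_sqrt (by positivity)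
  have hs0 : 0 ≤ √(2 * A) := Real.sqrt_nonneg _
  have h6 : A * (2 * (1 + T ^ 2 / p)) = 2 * A + 2 * A * T ^ 2 / p := by ring
  rcases le_total (√(2 * A)) T with h | h
  · nlinarith
  · nlinarith

theorem average_of_residueBound (hkey : ResidueBound) (ε : ℝ) (hε : 0 < ε) :
    ∃ C : ℝ, 0 < C ∧ ∀ T x : ℝ, 1 ≤ T → 2 ≤ x → ∀ a : ℕ → ℤ,
      (∑ t ∈ (FT T).filter fun t => aeval t (Dpoly fJ gJ) ≠ 0, (piSeq fJ gJ a t x : ℝ)) ≤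
        C * (T * x ^ (5 / 4 + ε) + T ^ 2 * x ^ (3 / 4 + ε)) := by
  obtain ⟨C, hC, hCb⟩ := hkey ε hε
  refine ⟨√(2 * C) + 4 * C, by positivity, fun T x hT hx a => ?_⟩
  have hx1 : 1 ≤ x := by linarith
  set P := (Icc 1 ⌊x⌋₊).filter Nat.Prime with hP
  have hPb : ∀ p ∈ P, p.Prime ∧ (1 : ℝ) ≤ p ∧ (p : ℝ) ≤ x := by
    intro p hp
    rw [hP, mem_filter, mem_Icc] at hp
    exact ⟨hp.2, by exact_mod_cast hp.1.1, (Nat.le_floor_iff (by linarith)).mp hp.1.2⟩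
  have h1 : (∑ t ∈ (FT T).filter fun t => aeval t (Dpoly fJ gJ) ≠ 0, (piSeq fJ gJ a t x : ℝ))
      ≤ ∑ p ∈ P, (((FT T).filter fun t => goodRed fJ gJ p t ∧ apE fJ gJ p t = a p).card : ℝ) := by
    calc _ ≤ ∑ t ∈ FT T, (piSeq fJ gJ a t x : ℝ) :=
          sum_le_sum_of_subset_of_nonneg (filter_subset _ _) fun _ _ _ => by positivity
      _ = _ := by
        norm_cast
        have : ∀ t, piSeq fJ gJ a t x
            = ∑ p ∈ P, if goodRed fJ gJ p t ∧ apE fJ gJ p t = a p then 1 else 0 := by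
          intro t
          rw [piSeq, ← card_filter, hP, filter_filter]
        simp_rw [this]
        rw [sum_comm]
        simp_rw [← card_filter]
  refine h1.trans ?_
  have h2 : ∀ p ∈ P, (((FT T).filter fun t => goodRed fJ gJ p t ∧ apE fJ gJ p t = a p).card : ℝ)
      ≤ T * √(2 * C) * x ^ (1 / 4 + ε) + 2 * C * T ^ 2 * x ^ ε * (p : ℝ) ^ (-(1 / 2) : ℝ) := by
    intro p hp
    obtain ⟨hpp, hp1, hpx⟩ := hPb p hp
    have hp0 : (0 : ℝ) < p := by linarith
    refine (FT_trace_card_le hT (by positivity) hpp (a p)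
      (fun S hS => hCb p hpp (a p) S hS)).trans ?_
    apply add_le_add
    · rw [mul_assoc]
      apply mul_le_mul_of_nonneg_left _ (by linarith)
      rw [← mul_assoc, Real.sqrt_mul (by positivity)]
      apply mul_le_mul_of_nonneg_left _ (Real.sqrt_nonneg _)
      rw [Real.sqrt_eq_rpow, ← Real.rpow_mul hp0.le]
      calc (p : ℝ) ^ ((1 / 2 + ε) * (1 / 2)) ≤ (p : ℝ) ^ (1 / 4 + ε) :=
            Real.rpow_le_rpow_of_exponent_le hp1 (by linarith)
        _ ≤ x ^ (1 / 4 + ε) := Real.rpow_le_rpow hp0.le hpx (by linarith)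
    · have e : (p : ℝ) ^ (1 / 2 + ε) / p = p ^ ε * (p : ℝ) ^ (-(1 / 2) : ℝ) := by
        rw [← Real.rpow_add hp0, ← Real.rpow_sub_one hp0.ne']
        congr 1; ring
      calc 2 * (C * (p : ℝ) ^ (1 / 2 + ε)) * T ^ 2 / p
          = 2 * C * T ^ 2 * ((p : ℝ) ^ (1 / 2 + ε) / p) := by ring
        _ = 2 * C * T ^ 2 * p ^ ε * (p : ℝ) ^ (-(1 / 2) : ℝ) := by rw [e]; ring
        _ ≤ _ := by gcongr
  refine (sum_le_sum h2).trans ?_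
  rw [sum_add_distrib, sum_const, nsmul_eq_mul, ← mul_sum]
  have hx0 : 0 < x := by linarith
  have h3 : (P.card : ℝ) ≤ x := by
    have : P.card ≤ ⌊x⌋₊ := (card_filter_le _ _).trans (by simp)
    exact le_trans (by exact_mod_cast this) (Nat.floor_le hx0.le)
  have h4 : ∑ p ∈ P, (p : ℝ) ^ (-(1 / 2) : ℝ) ≤ 2 * x ^ (1 / 2 : ℝ) := by
    calc _ ≤ ∑ n ∈ Icc 1 ⌊x⌋₊, (n : ℝ) ^ (-(1 / 2) : ℝ) :=
          sum_le_sum_of_subset_of_nonneg (filter_subset _ _) fun _ _ _ => by positivity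
      _ ≤ 2 * √(⌊x⌋₊ : ℝ) := sum_inv_sqrt_le _
      _ ≤ 2 * √x := by gcongr; exact Nat.floor_le hx0.le
      _ = _ := by rw [Real.sqrt_eq_rpow]
  have e1 : x * x ^ (1 / 4 + ε) = x ^ (5 / 4 + ε) := by
    rw [← Real.rpow_one_add' hx0.le (by positivity)]; congr 1; ring
  have e2 : x ^ ε * x ^ (1 / 2 : ℝ) ≤ x ^ (3 / 4 + ε) := by
    rw [← Real.rpow_add hx0]
    exact Real.rpow_le_rpow_of_exponent_le hx1 (by linarith)
  have hs : 0 ≤ √(2 * C) := Real.sqrt_nonneg _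
  have n1 : 0 ≤ T * x ^ (5 / 4 + ε) := by positivity
  have n2 : 0 ≤ T ^ 2 * x ^ (3 / 4 + ε) := by positivity
  calc (P.card : ℝ) * (T * √(2 * C) * x ^ (1 / 4 + ε))
        + 2 * C * T ^ 2 * x ^ ε * ∑ p ∈ P, (p : ℝ) ^ (-(1 / 2) : ℝ)
      ≤ x * (T * √(2 * C) * x ^ (1 / 4 + ε)) + 2 * C * T ^ 2 * x ^ ε * (2 * x ^ (1 / 2 : ℝ)) := by
        gcongr
    _ = √(2 * C) * (T * (x * x ^ (1 / 4 + ε))) + 4 * C * (T ^ 2 * (x ^ ε * x ^ (1 / 2 : ℝ))) := by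
        ring
    _ ≤ √(2 * C) * (T * x ^ (5 / 4 + ε)) + 4 * C * (T ^ 2 * x ^ (3 / 4 + ε)) := by
        rw [e1]; gcongr
    _ ≤ _ := by nlinarith

theorem exists_card_divisors_le (ε : ℝ) (hε : 0 < ε) :
    ∃ C : ℝ, 0 < C ∧ ∀ n : ℕ, n ≠ 0 → (n.divisors.card : ℝ) ≤ C * (n : ℝ) ^ ε := by
  have hl : 0 < Real.log 2 := Real.log_pos (by norm_num)
  set κ : ℝ := min 1 (ε * Real.log 2) with hκ
  have hκ0 : 0 < κ := lt_min one_pos (by positivity)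
  have hκ1 : κ ≤ 1 := min_le_left _ _
  set B : ℕ := ⌈(2 : ℝ) ^ (1 / ε)⌉₊ with hB
  set w : ℕ → ℝ := fun q => if q < B then κ⁻¹ else 1 with hw
  have hw1 : ∀ q, 1 ≤ w q := by
    intro q
    simp only [hw]
    split_ifs
    · exact (one_le_inv₀ hκ0).mpr hκ1
    · exact le_rfl
  have hloc : ∀ q e : ℕ, q.Prime → ((e : ℝ) + 1) ≤ w q * ((q : ℝ) ^ e) ^ ε := by
    intro q e hq
    have hq2 : (2 : ℝ) ≤ q := by exact_mod_cast hq.two_le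
    have hcomm : ((q : ℝ) ^ e) ^ ε = ((q : ℝ) ^ ε) ^ e := by
      rw [← Real.rpow_natCast, ← Real.rpow_natCast, ← Real.rpow_mul (by positivity),
        ← Real.rpow_mul (by positivity), mul_comm]
    simp only [hw]
    split_ifs with h
    · have h1 : 1 + (e : ℝ) * (ε * Real.log 2) ≤ ((q : ℝ) ^ e) ^ ε := by
        calc 1 + (e : ℝ) * (ε * Real.log 2) ≤ Real.exp ((e : ℝ) * (ε * Real.log 2)) := by
              linarith [Real.add_one_le_exp ((e : ℝ) * (ε * Real.log 2))]
          _ = ((2 : ℝ) ^ ε) ^ e := by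
              rw [Real.exp_nat_mul, Real.rpow_def_of_pos (by norm_num), mul_comm ε]
          _ ≤ ((q : ℝ) ^ ε) ^ e := by gcongr
          _ = _ := hcomm.symm
      have h2 : κ * (e + 1) ≤ 1 + (e : ℝ) * (ε * Real.log 2) := by
        have : κ ≤ ε * Real.log 2 := min_le_right _ _
        have : (e : ℝ) * κ ≤ e * (ε * Real.log 2) := by gcongr
        linarith
      rw [inv_mul_eq_div, le_div_iff₀ hκ0]
      linarith
    · have h3 : (2 : ℝ) ^ (1 / ε) ≤ q := by
        rw [not_lt, hB] at h
        exact Nat.ceil_le.mp h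
      have h4 : (2 : ℝ) ≤ (q : ℝ) ^ ε := by
        calc (2 : ℝ) = ((2 : ℝ) ^ (1 / ε)) ^ ε := by
              rw [← Real.rpow_mul (by norm_num), one_div_mul_cancel hε.ne', Real.rpow_one]
          _ ≤ _ := by gcongr
      rw [one_mul, hcomm]
      calc (e : ℝ) + 1 ≤ 2 ^ e := by exact_mod_cast Nat.lt_two_pow_self
        _ ≤ _ := by gcongr
  refine ⟨κ⁻¹ ^ B, by positivity, fun n hn => ?_⟩
  have hn' : ∏ q ∈ n.primeFactors, q ^ n.factorization q = n := Nat.prod_factorization_pow_eq_self hn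
  rw [Nat.card_divisors hn]
  push_cast
  calc ∏ q ∈ n.primeFactors, ((n.factorization q : ℝ) + 1)
      ≤ ∏ q ∈ n.primeFactors, w q * ((q : ℝ) ^ n.factorization q) ^ ε :=
        prod_le_prod (fun _ _ => by positivity)
          fun q hq => hloc q _ (Nat.prime_of_mem_primeFactors hq)
    _ = (∏ q ∈ n.primeFactors, w q) * (n : ℝ) ^ ε := by
        rw [prod_mul_distrib, Real.finsetProd_rpow _ _ fun _ _ => by positivity]
        congr 2
        exact_mod_cast hn'
    _ ≤ κ⁻¹ ^ B * (n : ℝ) ^ ε := by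
        gcongr
        have : ∏ q ∈ n.primeFactors, w q = ∏ q ∈ n.primeFactors.filter (· < B), κ⁻¹ := by
          rw [prod_filter]
        rw [this, prod_const]
        apply pow_le_pow_right₀ ((one_le_inv₀ hκ0).mpr hκ1)
        calc _ ≤ (range B).card := card_le_card fun q hq => by
              simpa using (mem_filter.mp hq).2
          _ = B := card_range B

/-- Integral matrices `(a b; c d)` of determinant `p` and trace `A` whose fixed point in the upper
half plane lies in the standard fundamental domain. -/
structure IsReducedQuad (p : ℕ) (A : ℤ) (q : ℤ × ℤ × ℤ × ℤ) : Prop where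
  det : q.1 * q.2.2.2 - q.2.1 * q.2.2.1 = p
  trace : q.1 + q.2.2.2 = A
  ne_zero : q.2.2.1 ≠ 0
  abs_le : |q.2.2.2 - q.1| ≤ |q.2.2.1|
  sq_le : q.2.2.1 ^ 2 ≤ -(q.2.1 * q.2.2.1)

theorem card_quad_fiber_le {p : ℕ} {A B : ℤ} {K : ℝ} (hp : 0 < p)
    (hK : ∀ n : ℕ, n ≠ 0 → n ≤ 2 * p → (n.divisors.card : ℝ) ≤ K)
    (Q : Finset (ℤ × ℤ × ℤ × ℤ)) (hQ : ∀ q ∈ Q, IsReducedQuad p A q ∧ q.2.2.2 - q.1 = B) :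
    (Q.card : ℝ) ≤ 2 * K := by
  rcases Q.eq_empty_or_nonempty with rfl | ⟨q0, hq0⟩
  · have := hK 1 one_ne_zero (by omega)
    simp at this ⊢
    linarith
  · set n : ℕ := (-(q0.2.1 * q0.2.2.1)).toNat with hn
    have hn4 : ∀ q ∈ Q, 4 * -(q.2.1 * q.2.2.1) = 4 * p - A ^ 2 + B ^ 2 := by
      intro q hq
      obtain ⟨h, hB⟩ := hQ q hq
      rw [← h.det, ← h.trace, ← hB]; ring
    have hpos : 0 < -(q0.2.1 * q0.2.2.1) :=
      lt_of_lt_of_le (by have := (hQ q0 hq0).1.ne_zero; positivity) (hQ q0 hq0).1.sq_le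
    have hnz : (n : ℤ) = -(q0.2.1 * q0.2.2.1) := Int.toNat_of_nonneg hpos.le
    have hall : ∀ q ∈ Q, -(q.2.1 * q.2.2.1) = n := by
      intro q hq
      have h1 := hn4 q hq
      have h2 := hn4 q0 hq0
      rw [hnz]; linarith
    have hle : n ≤ 2 * p := by
      obtain ⟨h, hB⟩ := hQ q0 hq0
      have h1 := hn4 q0 hq0
      have h2 := h.sq_le
      have h3 := sq_le_sq.mpr h.abs_le
      rw [hB] at h3
      have : (n : ℤ) ≤ 2 * p := by rw [hnz]; nlinarith [sq_nonneg A]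
      exact_mod_cast this
    have hn0 : n ≠ 0 := by
      rintro h0
      rw [h0] at hnz
      simp only [Nat.cast_zero] at hnz
      linarith
    have hcard : Q.card ≤ (n.divisors.image (fun k : ℕ => (k : ℤ)) ∪
        n.divisors.image (fun k : ℕ => -(k : ℤ))).card := by
      refine card_le_card_of_injOn (fun q => q.2.2.1) ?_ ?_
      · intro q hq
        have h1 : q.2.2.1 ∣ (n : ℤ) := by rw [← hall q hq]; exact (Dvd.intro_left _ rfl).neg_right
        have h2 : q.2.2.1.natAbs ∈ n.divisors := by
          rw [Nat.mem_divisors]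
          exact ⟨Int.natCast_dvd_natCast.mp (Int.natAbs_dvd.mpr h1), hn0⟩
        simp only [coe_union, coe_image, Set.mem_union, Set.mem_image, mem_coe]
        rcases Int.natAbs_eq q.2.2.1 with h | h
        · exact Or.inl ⟨_, h2, h.symm⟩
        · exact Or.inr ⟨_, h2, h.symm⟩
      · intro q hq q' hq' (hc : q.2.2.1 = q'.2.2.1)
        obtain ⟨h, hB⟩ := hQ q hq
        obtain ⟨h', hB'⟩ := hQ q' hq'
        have e1 : q.1 = q'.1 := by
          have := h.trace; have := h'.trace; linarith
        have e2 : q.2.2.2 = q'.2.2.2 := by linarith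
        have e3 : q.2.1 = q'.2.1 := by
          have h1 := hall q hq
          have h2 := hall q' hq'
          rw [hc] at h1
          exact mul_right_cancel₀ h'.ne_zero (by linarith)
        exact Prod.ext e1 (Prod.ext e3 (Prod.ext hc e2))
    have h3 : Q.card ≤ 2 * n.divisors.card := by
      refine hcard.trans ((card_union_le _ _).trans ?_)
      have := card_image_le (s := n.divisors) (f := fun k : ℕ => (k : ℤ))
      have := card_image_le (s := n.divisors) (f := fun k : ℕ => -(k : ℤ))
      omega
    calc (Q.card : ℝ) ≤ 2 * n.divisors.card := by exact_mod_cast h3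
      _ ≤ 2 * K := by gcongr; exact hK n hn0 hle

theorem exists_card_reducedQuad_le (ε : ℝ) (hε : 0 < ε) :
    ∃ C : ℝ, 0 < C ∧ ∀ p : ℕ, 0 < p → ∀ A : ℤ, ∀ Q : Finset (ℤ × ℤ × ℤ × ℤ),
      (∀ q ∈ Q, IsReducedQuad p A q) → (Q.card : ℝ) ≤ C * (p : ℝ) ^ (1 / 2 + ε) := by
  obtain ⟨C, hC, hCb⟩ := exists_card_divisors_le ε hε
  refine ⟨5 * (2 * (C * 2 ^ ε)), by positivity, fun p hp A Q hQ => ?_⟩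
  have hp1 : (1 : ℝ) ≤ p := by exact_mod_cast hp
  have hp0 : (0 : ℝ) < p := by positivity
  set K : ℝ := C * (2 * p : ℝ) ^ ε with hKdef
  have hK : ∀ n : ℕ, n ≠ 0 → n ≤ 2 * p → (n.divisors.card : ℝ) ≤ K := by
    intro n hn hle
    refine (hCb n hn).trans ?_
    rw [hKdef]
    gcongr
    exact_mod_cast hle
  have hK0 : 0 ≤ K := by positivity
  set R : ℤ := ⌊2 * √(p : ℝ)⌋ with hR
  have hs1 : 1 ≤ √(p : ℝ) := Real.one_le_sqrt.mpr hp1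
  have hR0 : 0 ≤ R := Int.floor_nonneg.mpr (by positivity)
  have hmap : ∀ q ∈ Q, q.2.2.2 - q.1 ∈ Icc (-R) R := by
    intro q hq
    have h := hQ q hq
    have h4 : 4 * -(q.2.1 * q.2.2.1) = 4 * p - A ^ 2 + (q.2.2.2 - q.1) ^ 2 := by
      rw [← h.det, ← h.trace]; ring
    have h3 := sq_le_sq.mpr h.abs_le
    have h5 := h.sq_le
    have h6 : (q.2.2.2 - q.1) ^ 2 ≤ 4 * p := by nlinarith [sq_nonneg A]
    have h7 : |((q.2.2.2 - q.1 : ℤ) : ℝ)| ≤ 2 * √(p : ℝ) := by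
      apply abs_le_of_sq_le_sq _ (by positivity)
      rw [mul_pow, Real.sq_sqrt hp0.le]
      calc ((q.2.2.2 - q.1 : ℤ) : ℝ) ^ 2 ≤ 4 * p := by exact_mod_cast h6
        _ = _ := by norm_num
    have h8 : |q.2.2.2 - q.1| ≤ R := by
      rw [hR, Int.le_floor]
      exact_mod_cast h7
    rw [mem_Icc]
    exact abs_le.mp h8
  rw [card_eq_sum_card_fiberwise hmap]
  push_cast
  calc ∑ B ∈ Icc (-R) R, ((Q.filter fun q => q.2.2.2 - q.1 = B).card : ℝ)
      ≤ ∑ B ∈ Icc (-R) R, 2 * K := by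
        refine sum_le_sum fun B _ =>
          card_quad_fiber_le (A := A) (B := B) hp hK _ fun q hq => ?_
        rw [mem_filter] at hq
        exact ⟨hQ q hq.1, hq.2⟩
    _ = ((R + 1 - -R).toNat : ℝ) * (2 * K) := by rw [sum_const, Int.card_Icc, nsmul_eq_mul]
    _ ≤ (5 * √(p : ℝ)) * (2 * K) := by
        gcongr
        have : (((R + 1 - -R).toNat : ℤ) : ℝ) ≤ 5 * √(p : ℝ) := by
          rw [Int.toNat_of_nonneg (by linarith)]
          push_cast
          have := Int.floor_le (2 * √(p : ℝ))
          linarith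
        exact_mod_cast this
    _ = _ := by
        rw [hKdef, Real.mul_rpow (by norm_num) hp0.le, Real.rpow_add hp0, Real.sqrt_eq_rpow]
        ring

/-- Every `j`-invariant in `𝔽_p ∖ {0, 1728}` is the reduction of the `j`-invariant of a CM point
fixed by an integral matrix of determinant `p`, whose trace is compatible with the Frobenius
trace. -/
def DeuringLift (p : ℕ) : Prop :=
  ∃ J : ℤ × ℤ × ℤ × ℤ → ZMod p, ∀ j : ZMod p, j ≠ 0 → j ≠ 1728 →
    ∃ q, IsReducedQuad p (q.1 + q.2.2.2) q ∧ J q = j ∧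
      (((q.1 + q.2.2.2 : ℤ) : ZMod p) = 0 ∨ ((q.1 + q.2.2.2 : ℤ) : ZMod p) ^ 12 =
        ((frobTrace p ((fJ.map (Int.castRingHom (ZMod p))).eval j)
          ((gJ.map (Int.castRingHom (ZMod p))).eval j) : ℤ) : ZMod p) ^ 12)

theorem IsReducedQuad.abs_trace_lt {p : ℕ} {A : ℤ} {q : ℤ × ℤ × ℤ × ℤ} (h : IsReducedQuad p A q)
    (hp : 5 ≤ p) : |A| < p := by
  have h4 : 4 * -(q.2.1 * q.2.2.1) = 4 * p - A ^ 2 + (q.2.2.2 - q.1) ^ 2 := by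
    rw [← h.det, ← h.trace]; ring
  have h3 := sq_le_sq.mpr h.abs_le
  have h5 := h.sq_le
  have h6 : 0 < q.2.2.1 ^ 2 := by have := h.ne_zero; positivity
  have h7 : A ^ 2 < 4 * p := by linarith
  have hp' : (5 : ℤ) ≤ p := by exact_mod_cast hp
  apply abs_lt_of_sq_lt_sq _ (by positivity)
  nlinarith

theorem card_traces_le {p : ℕ} [Fact p.Prime] (a : ℤ) (R : Finset ℤ)
    (hR : ∀ A ∈ R, |A| < p ∧ ((A : ZMod p) = 0 ∨ (A : ZMod p) ^ 12 = (a : ZMod p) ^ 12)) :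
    R.card ≤ 26 := by
  set P : (ZMod p)[X] := X * (X ^ 12 - Polynomial.C ((a : ZMod p) ^ 12)) with hP
  have hm : (X ^ 12 - Polynomial.C ((a : ZMod p) ^ 12)).Monic :=
    monic_X_pow_sub_C _ (by norm_num)
  have hP0 : P ≠ 0 := (monic_X.mul hm).ne_zero
  have hdeg : P.natDegree = 13 := by
    rw [hP, monic_X.natDegree_mul hm, natDegree_X, natDegree_X_pow_sub_C]
  have hroots : P.roots.toFinset.card ≤ 13 :=
    (Multiset.toFinset_card_le _).trans ((card_roots' P).trans hdeg.le)
  have : R.card ≤ (P.roots.toFinset ×ˢ (univ : Finset Bool)).card := by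
    refine card_le_card_of_injOn (fun A => ((A : ZMod p), decide (0 ≤ A))) ?_ ?_
    · intro A hA
      obtain ⟨_, h⟩ := hR A hA
      simp only [coe_product, Set.mem_prod, mem_coe, Multiset.mem_toFinset, mem_univ, and_true]
      rw [mem_roots hP0, IsRoot, hP]
      simp only [eval_mul, eval_X, eval_sub, eval_pow, eval_C]
      rcases h with h | h
      · rw [h, zero_mul]
      · rw [h, sub_self, mul_zero]
    · intro A hA A' hA' h
      simp only [Prod.mk.injEq, decide_eq_decide] at h
      obtain ⟨h1, h2⟩ := h
      rw [ZMod.intCast_eq_intCast_iff_dvd_sub] at h1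
      have h3 := abs_lt.mp (hR A hA).1
      have h4 := abs_lt.mp (hR A' hA').1
      have h5 : A' - A = 0 := by
        apply Int.eq_zero_of_abs_lt_dvd h1
        rw [abs_lt]
        by_cases h0 : 0 ≤ A
        · have := h2.mp h0
          constructor <;> linarith
        · have h0' : ¬ 0 ≤ A' := fun h => h0 (h2.mpr h)
          constructor <;> linarith
      linarith
  rw [card_product] at this
  simp only [card_univ, Fintype.card_bool] at this
  omega

theorem residueBound_of_deuringLift (h : ∀ p : ℕ, p.Prime → 5 ≤ p → DeuringLift p) :
    ResidueBound := by
  intro ε hε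
  obtain ⟨C, hC, hCb⟩ := exists_card_reducedQuad_le ε hε
  refine ⟨26 * C + 5, by positivity, fun p hp a S hS => ?_⟩
  have := Fact.mk hp
  have hp1 : (1 : ℝ) ≤ p := by exact_mod_cast hp.one_le
  have hpow : 1 ≤ (p : ℝ) ^ (1 / 2 + ε) := Real.one_le_rpow hp1 (by positivity)
  rcases lt_or_ge p 5 with hlt | hge
  · have h1 : S.card ≤ p := by
      simpa [ZMod.card] using card_le_univ S
    have h2 : (S.card : ℝ) ≤ 5 := by exact_mod_cast (by omega : S.card ≤ 5)
    nlinarith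
  obtain ⟨J, hJ⟩ := h p hp hge
  have hS' : ∀ s : S, ∃ q, IsReducedQuad p (q.1 + q.2.2.2) q ∧ J q = s ∧
      (((q.1 + q.2.2.2 : ℤ) : ZMod p) = 0 ∨
        ((q.1 + q.2.2.2 : ℤ) : ZMod p) ^ 12 = (a : ZMod p) ^ 12) := by
    rintro ⟨s, hs⟩
    obtain ⟨h1, h2⟩ := hS s hs
    have hD : ((Dpoly fJ gJ).map (Int.castRingHom (ZMod p))).eval s
        = -16 * (4 * (3 * s * (1728 - s)) ^ 3 + 27 * (2 * s * (1728 - s) ^ 2) ^ 2) := by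
      simp [Dpoly, fJ, gJ]
    rw [hD] at h1
    have := hJ s (by rintro rfl; apply h1; ring) (by rintro rfl; apply h1; ring)
    rwa [h2] at this
  choose q hq1 hq2 hq3 using hS'
  set Q := (univ : Finset S).image q with hQ
  have hinj : Function.Injective q := by
    intro s s' hss
    apply Subtype.ext
    rw [← hq2 s, ← hq2 s', hss]
  have hcard : S.card = Q.card := by
    rw [hQ, card_image_of_injective _ hinj, card_univ, Fintype.card_coe]
  set R := Q.image (fun q => q.1 + q.2.2.2) with hRdef
  have hmemQ : ∀ x ∈ Q, ∃ s, q s = x := fun x hx => by simpa [hQ] using hx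
  have hR : R.card ≤ 26 := by
    apply card_traces_le (p := p) a
    intro A hA
    rw [hRdef, mem_image] at hA
    obtain ⟨x, hx, rfl⟩ := hA
    obtain ⟨s, rfl⟩ := hmemQ x hx
    exact ⟨(hq1 s).abs_trace_lt hge, hq3 s⟩
  rw [hcard, card_eq_sum_card_fiberwise (t := R) (f := fun q => q.1 + q.2.2.2)
    fun x hx => mem_image_of_mem _ hx]
  push_cast
  calc ∑ A ∈ R, ((Q.filter fun q => q.1 + q.2.2.2 = A).card : ℝ)
      ≤ ∑ A ∈ R, C * (p : ℝ) ^ (1 / 2 + ε) := by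
        refine sum_le_sum fun A _ => hCb p hp.pos A _ fun x hx => ?_
        rw [mem_filter] at hx
        obtain ⟨s, rfl⟩ := hmemQ x hx.1
        have := hq1 s
        rwa [hx.2] at this
    _ = R.card * (C * (p : ℝ) ^ (1 / 2 + ε)) := by rw [sum_const, nsmul_eq_mul]
    _ ≤ 26 * (C * (p : ℝ) ^ (1 / 2 + ε)) := by gcongr; exact_mod_cast hR
    _ ≤ _ := by nlinarith

theorem sum_pow_zmod {p : ℕ} [Fact p.Prime] (i : ℕ) (hi : i < 2 * (p - 1)) :
    ∑ x : ZMod p, x ^ i = if i = p - 1 then -1 else 0 := by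
  have hp1 : 0 < p - 1 := Nat.sub_pos_of_lt (Fact.out : p.Prime).one_lt
  by_cases h0 : i = 0
  · subst h0
    rw [if_neg (by omega)]
    simp
  · have h1 : ∑ x : ZMod p, x ^ i = ∑ x : (ZMod p)ˣ, (x ^ i : ZMod p) := by
      rw [← sum_sdiff (subset_univ {(0 : ZMod p)})]
      rw [sum_singleton, zero_pow h0, add_zero]
      symm
      refine sum_bij (fun u _ => (u : ZMod p)) ?_ ?_ ?_ ?_
      · intro u _; simp
      · intro u _ v _ h; exact Units.ext h
      · intro x hx
        have hx0 : x ≠ 0 := by simpa using hx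
        exact ⟨Units.mk0 x hx0, mem_univ _, rfl⟩
      · intro u _; rfl
    rw [h1, FiniteField.sum_pow_units, ZMod.card]
    congr 1
    apply propext
    constructor
    · rintro ⟨c, hc⟩
      have : c < 2 := by
        by_contra hc2
        have : 2 * (p - 1) ≤ (p - 1) * c := by nlinarith
        omega
      interval_cases c
      · omega
      · omega
    · rintro rfl; exact dvd_rfl

/-- The Hasse invariant of `Y² = X³ + AX + B` is the Frobenius trace modulo `p`. -/
theorem coeff_cubic_pow_eq_frobTrace {p : ℕ} [Fact p.Prime] (hp : 3 ≤ p) (A B : ZMod p) :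
    ((X ^ 3 + Polynomial.C A * X + Polynomial.C B : (ZMod p)[X]) ^ ((p - 1) / 2)).coeff (p - 1)
      = (frobTrace p A B : ZMod p) := by
  set F : (ZMod p)[X] := X ^ 3 + Polynomial.C A * X + Polynomial.C B with hF
  have hpp : p.Prime := Fact.out
  have hodd : p % 2 = 1 := (hpp.eq_two_or_odd).resolve_left (by omega)
  have hdegF : F.natDegree ≤ 3 := by rw [hF]; compute_degree
  have hdeg : (F ^ ((p - 1) / 2)).natDegree < 2 * (p - 1) := by
    refine lt_of_le_of_lt (natDegree_pow_le.trans (Nat.mul_le_mul_left _ hdegF)) ?_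
    omega
  have hsum : ∑ x : ZMod p, (F.eval x) ^ ((p - 1) / 2)
      = -(F ^ ((p - 1) / 2)).coeff (p - 1) := by
    simp_rw [← eval_pow, eval_eq_sum_range' hdeg]
    rw [sum_comm]
    simp_rw [← mul_sum]
    rw [sum_eq_single_of_mem (p - 1) (by rw [mem_range]; omega)]
    · rw [sum_pow_zmod _ (by omega), if_pos rfl]; ring
    · intro i hi hne
      rw [sum_pow_zmod _ (by simpa using hi), if_neg hne, mul_zero]
  have hchar : ringChar (ZMod p) ≠ 2 := by rw [ZMod.ringChar_zmod_n]; omega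
  have hcard : (Nat.card {P : ZMod p × ZMod p // P.2 ^ 2 = P.1 ^ 3 + A * P.1 + B} : ℤ)
      = ∑ x : ZMod p, (quadraticChar (ZMod p) (F.eval x) + 1) := by
    have h1 : ∀ x : ZMod p, F.eval x = x ^ 3 + A * x + B := by intro x; simp [hF]
    simp_rw [← quadraticChar_card_sqrts hchar]
    rw [Nat.card_eq_fintype_card, Fintype.card_subtype]
    rw [card_eq_sum_card_fiberwise (f := fun P : ZMod p × ZMod p => P.1) (t := univ)
      fun _ _ => mem_univ _]
    push_cast
    refine sum_congr rfl fun x _ => ?_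
    congr 1
    refine card_bij (fun P _ => P.2) ?_ ?_ ?_
    · rintro ⟨a, b⟩ h
      simp only [mem_filter, mem_univ, true_and] at h
      obtain ⟨h, rfl⟩ := h
      simp [h1, h]
    · rintro ⟨a, b⟩ h ⟨a', b'⟩ h' e
      simp only [mem_filter] at h h'
      exact Prod.ext (h.2.trans h'.2.symm) e
    · intro y hy
      refine ⟨(x, y), ?_, rfl⟩
      simpa [h1] using hy
  have hfrob : frobTrace p A B = -∑ x : ZMod p, quadraticChar (ZMod p) (F.eval x) := by
    rw [frobTrace, numPoints]
    push_cast
    rw [hcard, sum_add_distrib]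
    simp only [sum_const, card_univ, ZMod.card, nsmul_eq_mul, mul_one]
    ring
  rw [hfrob]
  push_cast
  have hq : ∀ x : ZMod p, ((quadraticChar (ZMod p) (F.eval x) : ℤ) : ZMod p)
      = (F.eval x) ^ ((p - 1) / 2) := by
    intro x
    rw [quadraticChar_eq_pow_of_char_ne_two' hchar, ZMod.card]
    congr 1; omega
  simp_rw [hq, hsum, neg_neg]

section HasseODE

variable {A : Type*} [CommRing A]

/-- The cubic `X³ - 3 e₄ X + 2 e₆`. -/
def cubic (e4 e6 : A) : A[X] := X ^ 3 - 3 * Polynomial.C e4 * X + 2 * Polynomial.C e6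

/-- The Hasse invariant of `Y² = X³ - 3 e₄ X + 2 e₆`. -/
def hasse (p : ℕ) (e4 e6 : A) : A := (cubic e4 e6 ^ ((p - 1) / 2)).coeff (p - 1)

/-- Apply a derivation to the coefficients of a polynomial. -/
def coeffDer (d : Derivation ℤ A A) : Derivation ℤ A[X] A[X] :=
  letI : Differential A := ⟨d⟩
  Differential.mapCoeffs

theorem coeff_coeffDer (d : Derivation ℤ A A) (P : A[X]) (n : ℕ) :
    (coeffDer d P).coeff n = d (P.coeff n) := rfl

theorem coeffDer_derivative (d : Derivation ℤ A A) (P : A[X]) :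
    coeffDer d (derivative P) = derivative (coeffDer d P) := by
  ext n
  simp [coeff_coeffDer, coeff_derivative, Derivation.leibniz]
  ring

theorem hasse_second_derivative {p : ℕ} [CharP A p] (hp : 3 ≤ p) (hodd : p % 2 = 1)
    (d : Derivation ℤ A A) {e2 e4 e6 : A} (h4 : 3 * d e4 = e2 * e4 - e6)
    (h6 : 2 * d e6 = e2 * e6 - e4 ^ 2) (h2 : 12 * d e2 = e2 ^ 2 - e4) :
    144 * d (d (hasse p e4 e6)) = 0 := by
  set F : A[X] := cubic e4 e6 with hF
  set m := (p - 1) / 2 with hm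
  set N := F ^ m with hN
  set D := coeffDer d with hD
  have hp0 : (p : A[X]) = 0 := CharP.cast_eq_zero _ p
  have hm2 : (2 * m : A[X]) = -1 := by
    have : 2 * m + 1 = p := by omega
    have : ((2 * m + 1 : ℕ) : A[X]) = 0 := by rw [this, hp0]
    push_cast at this
    linear_combination this
  obtain ⟨M, hM⟩ : ∃ M, M = F ^ (m - 1) := ⟨_, rfl⟩
  have hNM : N = M * F := by rw [hN, hM, ← pow_succ]; congr 1; omega
  have hdX : D X = 0 := by ext n; simp [hD, coeff_coeffDer, coeff_X, apply_ite d]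
  have hdC : ∀ a, D (C a) = C (d a) := by
    intro a; ext n; simp [hD, coeff_coeffDer, coeff_C, apply_ite d]
  have k3 : D 3 = 0 := D.map_natCast 3
  have k2 : D 2 = 0 := D.map_natCast 2
  have c2 : C (2 : A) = 2 := map_ofNat C 2
  have c3 : C (3 : A) = 3 := map_ofNat C 3
  have c12 : C (12 : A) = 12 := map_ofNat C 12
  have l3 : derivative (3 : A[X]) = 0 := derivative_natCast (n := 3)
  have l2 : derivative (2 : A[X]) = 0 := derivative_natCast (n := 2)
  have hF' : derivative F = 3 * X ^ 2 - 3 * C e4 := by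
    rw [hF, cubic]
    simp only [derivative_add, derivative_sub, derivative_X_pow, derivative_mul, derivative_X,
      derivative_C, l3, l2]
    simp [c3]
  have hDF : D F = -3 * C (d e4) * X + 2 * C (d e6) := by
    rw [hF, cubic]
    simp only [map_add, map_sub, Derivation.leibniz, Derivation.leibniz_pow, hdX, hdC, k3, k2,
      smul_eq_mul]
    ring
  have C4 : 3 * C (d e4) = C e2 * C e4 - C e6 := by
    have := congrArg C h4
    simpa [c3] using this
  have C6 : 2 * C (d e6) = C e2 * C e6 - C e4 ^ 2 := by
    have := congrArg C h6
    simpa [c2] using this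
  have C2 : 12 * C (d e2) = C e2 ^ 2 - C e4 := by
    have := congrArg C h2
    simpa [c12] using this
  have hN' : derivative N = m * M * derivative F := by
    rw [hN, derivative_pow, hM]; simp
  have hDN : D N = m * M * D F := by
    rw [hN, Derivation.leibniz_pow, hM]; simp [mul_assoc]
  have hFeq : F = X ^ 3 - 3 * C e4 * X + 2 * C e6 := rfl
  set v : A[X] := C e2 * X + X ^ 2 - 2 * C e4 with hv
  have hv' : derivative v = C e2 + 2 * X := by
    rw [hv]
    simp only [derivative_add, derivative_sub, derivative_X_pow, derivative_mul, derivative_X,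
      derivative_C, l2]
    simp [c2]
  have s1 : 12 * D N = -2 * derivative (v * N) + (X - C e2) * N := by
    rw [derivative_mul, hv', hDN, hN', hDF, hF', hNM, hFeq, hv]
    linear_combination (-12 * m * M * X) * C4 + 12 * m * M * C6 +
      (6 * C e2 * C e6 - 6 * C e4 ^ 2 - 6 * X * C e2 * C e4 + 6 * X * C e6) * M * hm2 +
        (X ^ 2 + X * C e2 - 2 * C e4) * M * (3 * X ^ 2 - 3 * C e4) * hm2
  have s2 : N * derivative F = 2 * derivative (F * N) := by
    rw [derivative_mul, hN', hNM]
    linear_combination (- M * F * derivative F) * hm2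
  have k12 : D 12 = 0 := D.map_natCast 12
  have kk : D (-2) = 0 := by rw [map_neg, k2, neg_zero]
  have l12 : derivative (12 : A[X]) = 0 := derivative_natCast (n := 12)
  have s3 : 144 * D (D N) = derivative (-24 * D (v * N) - 2 * ((X - C e2) * v * N) + 2 * (F * N)) := by
    have e1 : 12 * D (12 * D N) = 12 * D (-2 * derivative (v * N) + (X - C e2) * N) := by rw [s1]
    rw [Derivation.leibniz, k12, map_add, Derivation.leibniz D (-2), kk, Derivation.leibniz D (X - C e2),
      map_sub, hdX, hdC, coeffDer_derivative] at e1
    simp only [smul_eq_mul, mul_zero, add_zero] at e1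
    have l24 : derivative (-24 : A[X]) = 0 := by
      rw [derivative_neg, neg_eq_zero]; exact derivative_natCast (n := 24)
    have s5 : derivative ((X - C e2) * v * N) = v * N + (X - C e2) * derivative (v * N) := by
      rw [mul_assoc, derivative_mul]; simp
    rw [derivative_add, derivative_sub, derivative_mul (f := -24), derivative_mul (f := 2),
      derivative_mul (f := 2), l24, l2, s5]
    rw [hF'] at s2
    rw [hv] at *
    linear_combination e1 + (X - C e2) * s1 + s2 - N * C2
  have s4 : 144 * (D (D N)).coeff (p - 1) = 0 := by
    have : (144 * D (D N)).coeff (p - 1) = 144 * (D (D N)).coeff (p - 1) := by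
      have : (144 : A[X]) = C 144 := (map_ofNat C 144).symm
      rw [this, coeff_C_mul]
    rw [← this, s3, coeff_derivative]
    have : ((p - 1 : ℕ) : A) + 1 = 0 := by
      have h : ((p - 1 + 1 : ℕ) : A) = 0 := by
        rw [Nat.sub_add_cancel (by omega)]; exact CharP.cast_eq_zero A p
      exact_mod_cast h
    rw [this, mul_zero]
  exact s4

theorem hasse_second_additive_derivative {p : ℕ} [CharP A p] (hp : 3 ≤ p) (hodd : p % 2 = 1)
    (d : A →+ A) (hd : ∀ a b, d (a * b) = a * d b + b * d a) {e2 e4 e6 : A}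
    (h4 : 3 * d e4 = e2 * e4 - e6) (h6 : 2 * d e6 = e2 * e6 - e4 ^ 2)
    (h2 : 12 * d e2 = e2 ^ 2 - e4) : 144 * d (d (hasse p e4 e6)) = 0 :=
  hasse_second_derivative hp hodd (Derivation.mk' d.toIntLinearMap hd) h4 h6 h2

end HasseODE

section HasseSeries

theorem hasse_map {A B : Type*} [CommRing A] [CommRing B] (f : A →+* B) (p : ℕ) (x y : A) :
    f (hasse p x y) = hasse p (f x) (f y) := by
  have : (cubic x y).map f = cubic (f x) (f y) := by simp [cubic]
  rw [hasse, hasse, ← this, ← Polynomial.map_pow, coeff_map]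

/-- The derivation `q d/dq` on power series. -/
def qDer (R : Type*) [CommRing R] : PowerSeries R →+ PowerSeries R where
  toFun f := PowerSeries.X * PowerSeries.derivative R f
  map_zero' := by simp
  map_add' f g := by rw [map_add, mul_add]

theorem qDer_mul {R : Type*} [CommRing R] (f g : PowerSeries R) :
    qDer R (f * g) = f * qDer R g + g * qDer R f := by
  change PowerSeries.X * PowerSeries.derivative R (f * g) = f * (PowerSeries.X * _) +
    g * (PowerSeries.X * _)
  rw [Derivation.leibniz, smul_eq_mul, smul_eq_mul]
  ring

theorem coeff_qDer {R : Type*} [CommRing R] (f : PowerSeries R) (n : ℕ) :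
    PowerSeries.coeff n (qDer R f) = n * PowerSeries.coeff n f := by
  have : qDer R f = PowerSeries.X * PowerSeries.derivative R f := rfl
  rw [this]
  cases n with
  | zero => simp
  | succ n =>
    rw [PowerSeries.coeff_succ_X_mul, PowerSeries.coeff_derivative]
    push_cast
    ring

variable {K : Type*} [Field K] {p : ℕ} [Fact p.Prime] [CharP K p]

theorem hasse_one_one (hp : 3 ≤ p) : hasse p (1 : K) 1 = 3 ^ ((p - 1) / 2) := by
  have hpp : p.Prime := Fact.out
  have hodd : p % 2 = 1 := (hpp.eq_two_or_odd).resolve_left (by omega)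
  set m := (p - 1) / 2 with hm
  have hm2 : p - 1 = 2 * m := by omega
  have h1 : cubic (1 : K) 1 = (X - 1) ^ 2 * (X + 2) := by
    simp only [cubic, map_one]
    ring
  have h2 : ((X : K[X]) - 1) ^ (p - 1) = ∑ i ∈ range p, X ^ i := by
    have : CharP K[X] p := inferInstance
    have h3 : ((X : K[X]) - 1) ^ (p - 1) * (X - 1) = (∑ i ∈ range p, X ^ i) * (X - 1) := by
      rw [geom_sum_mul, ← pow_succ, Nat.sub_add_cancel (by omega), sub_pow_char, one_pow]
    exact mul_right_cancel₀ (X_sub_C_ne_zero (1 : K)) (by simpa using h3)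
  rw [hasse, h1, mul_pow, ← pow_mul, ← hm2, h2, sum_mul, finsetSum_coeff]
  set P : K[X] := (X + 2) ^ m with hP
  have hd : P.natDegree < p := by
    refine lt_of_le_of_lt natDegree_pow_le ?_
    have : ((X : K[X]) + 2).natDegree ≤ 1 := by compute_degree
    calc m * ((X : K[X]) + 2).natDegree ≤ m * 1 := by gcongr
      _ < p := by omega
  have h4 : ∑ i ∈ range p, ((X : K[X]) ^ i * P).coeff (p - 1) = ∑ i ∈ range p, P.coeff i := by
    rw [← sum_range_reflect]
    refine sum_congr rfl fun i hi => ?_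
    have : i < p := by simpa using hi
    rw [coeff_X_pow_mul', if_pos (by omega)]
    congr 1; omega
  rw [h4]
  have h5 := eval_eq_sum_range' hd (1 : K)
  simp only [one_pow, mul_one] at h5
  rw [← h5, hP]
  simp only [eval_pow, eval_add, eval_X, eval_ofNat]
  norm_num

theorem exists_hasse_pow_eq (hp : 5 ≤ p) {e2 e4 e6 : PowerSeries K}
    (h4 : 3 * qDer K e4 = e2 * e4 - e6) (h6 : 2 * qDer K e6 = e2 * e6 - e4 ^ 2)
    (h2 : 12 * qDer K e2 = e2 ^ 2 - e4) (c4 : PowerSeries.constantCoeff e4 = 1)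
    (c6 : PowerSeries.constantCoeff e6 = 1) :
    ∃ r : PowerSeries K, hasse p e4 e6 ^ 12 = 1 + PowerSeries.X ^ p * r := by
  have hpp : p.Prime := Fact.out
  have hodd : p % 2 = 1 := (hpp.eq_two_or_odd).resolve_left (by omega)
  have h3p : 3 ≤ p := le_trans (by norm_num) hp
  have : CharP (PowerSeries K) p :=
    charP_of_injective_algebraMap (FaithfulSMul.algebraMap_injective K (PowerSeries K)) p
  have hd := hasse_second_additive_derivative (A := PowerSeries K) h3p hodd (qDer K) qDer_mul (e2 := e2)
    (e4 := e4) (e6 := e6) h4 h6 h2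
  set φ := hasse p e4 e6 with hφ
  have hne : ∀ n : ℕ, n.Coprime p → (n : K) ≠ 0 := by
    intro n hn h0
    rw [CharP.cast_eq_zero_iff K p] at h0
    exact hpp.one_lt.ne' (Nat.dvd_one.mp (hn ▸ Nat.dvd_gcd h0 dvd_rfl))
  have hcop : ∀ n : ℕ, 0 < n → n < p → n.Coprime p := fun n h0 hlt =>
    (Nat.coprime_of_lt_prime h0.ne' hlt hpp).symm
  have h144 : (144 : K) ≠ 0 := by
    have h2 : Nat.Coprime 2 p := hcop 2 (by norm_num) (by omega)
    have h3 : Nat.Coprime 3 p := hcop 3 (by norm_num) (by omega)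
    have := hne (2 ^ 4 * 3 ^ 2) ((h2.pow_left 4).mul_left (h3.pow_left 2))
    norm_num at this
    exact this
  have hcoef : ∀ n : ℕ, 0 < n → n < p → PowerSeries.coeff n φ = 0 := by
    intro n h0 hlt
    have h := congrArg (PowerSeries.coeff n) hd
    have e : (144 : PowerSeries K) = PowerSeries.C (144 : K) := (map_ofNat PowerSeries.C 144).symm
    rw [e, PowerSeries.coeff_C_mul, coeff_qDer, coeff_qDer, map_zero] at h
    have hn := hne n (hcop n h0 hlt)
    simpa [h144, hn] using h
  set c := PowerSeries.constantCoeff φ with hc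
  have hc12 : c ^ 12 = 1 := by
    rw [hc, hφ, hasse_map, c4, c6, hasse_one_one (by omega), ← pow_mul]
    have : (p - 1) / 2 * 12 = (p - 1) * 6 := by omega
    rw [this, pow_mul]
    have h3 : ((3 : ZMod p)) ^ (p - 1) = 1 := by
      apply ZMod.pow_card_sub_one_eq_one
      have h3 : Nat.Coprime 3 p := hcop 3 (by norm_num) (by omega)
      intro h0
      have h0' : ((3 : ℕ) : ZMod p) = 0 := by exact_mod_cast h0
      rw [ZMod.natCast_eq_zero_iff] at h0'
      exact hpp.one_lt.ne' (Nat.dvd_one.mp (h3 ▸ Nat.dvd_gcd h0' dvd_rfl))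
    have h3' := congrArg (ZMod.castHom (dvd_refl p) K) h3
    rw [map_pow, map_ofNat, map_one] at h3'
    rw [h3', one_pow]
  have hdvd : PowerSeries.X ^ p ∣ φ - PowerSeries.C c := by
    rw [PowerSeries.X_pow_dvd_iff]
    intro n hn
    rcases Nat.eq_zero_or_pos n with rfl | h0
    · simp [hc]
    · rw [map_sub, hcoef n h0 hn, PowerSeries.coeff_C, if_neg h0.ne', sub_zero]
  have h12 : PowerSeries.X ^ p ∣ φ ^ 12 - PowerSeries.C c ^ 12 :=
    hdvd.trans (sub_dvd_pow_sub_pow _ _ 12)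
  rw [← map_pow, hc12, map_one] at h12
  obtain ⟨r, hr⟩ := h12
  exact ⟨r, by linear_combination hr⟩

end HasseSeries

section Isobaric

variable {K : Type*} [Field K]

/-- Weights of the variables `e₄`, `e₆`. -/
def wt23 : Fin 2 → ℕ := ![2, 3]

/-- A polynomial in `X` over `K[e₄, e₆]` that is isobaric of weight `w`. -/
def Isobaric (w : ℕ) (P : (MvPolynomial (Fin 2) K)[X]) : Prop :=
  ∀ n d, (P.coeff n).coeff d ≠ 0 → Finsupp.weight wt23 d + n = w

theorem Isobaric.mul {w v : ℕ} {P Q : (MvPolynomial (Fin 2) K)[X]} (hP : Isobaric w P)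
    (hQ : Isobaric v Q) : Isobaric (w + v) (P * Q) := by
  intro n d h
  rw [Polynomial.coeff_mul, MvPolynomial.coeff_sum] at h
  obtain ⟨⟨i, j⟩, hij, h⟩ := exists_ne_zero_of_sum_ne_zero h
  rw [MvPolynomial.coeff_mul] at h
  obtain ⟨⟨a, b⟩, hab, h⟩ := exists_ne_zero_of_sum_ne_zero h
  rw [HasAntidiagonal.mem_antidiagonal] at hij hab
  simp only at hij hab h
  have h1 := hP i a (left_ne_zero_of_mul h)
  have h2 := hQ j b (right_ne_zero_of_mul h)
  rw [← hab, ← hij, map_add]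
  omega

theorem Isobaric.pow {w : ℕ} {P : (MvPolynomial (Fin 2) K)[X]} (hP : Isobaric w P) (k : ℕ) :
    Isobaric (k * w) (P ^ k) := by
  induction k with
  | zero =>
    intro n d h
    rw [pow_zero, Polynomial.coeff_one] at h
    split_ifs at h with hn
    · rw [MvPolynomial.coeff_one] at h
      split_ifs at h with hd
      · subst hd; simp [hn]
      · exact absurd rfl h
    · simp at h
  | succ k ih =>
    rw [pow_succ, Nat.succ_mul]
    exact ih.mul hP

theorem isobaric_cubic :
    Isobaric 3 (cubic (MvPolynomial.X 0 : MvPolynomial (Fin 2) K) (MvPolynomial.X 1)) := by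
  intro n d h
  have h3 : (3 : (MvPolynomial (Fin 2) K)[X]) = C (MvPolynomial.C 3) := by
    rw [map_ofNat MvPolynomial.C 3, map_ofNat C 3]
  have h2 : (2 : (MvPolynomial (Fin 2) K)[X]) = C (MvPolynomial.C 2) := by
    rw [map_ofNat MvPolynomial.C 2, map_ofNat C 2]
  simp only [cubic, h3, h2, ← C_mul] at h
  rw [coeff_add, coeff_sub, coeff_X_pow, coeff_C_mul_X, coeff_C] at h
  rcases n with _ | _ | _ | _ | n
  · simp [MvPolynomial.coeff_C_mul, MvPolynomial.coeff_X] at h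
    rw [← h.1]; simp [wt23, Finsupp.weight_apply]
  · simp [MvPolynomial.coeff_C_mul, MvPolynomial.coeff_X] at h
    rw [← h.1]; simp [wt23, Finsupp.weight_apply]
  · simp at h
  · simp [MvPolynomial.coeff_one] at h
    rw [← h]; simp
  · simp at h

/-- The twelfth power of the Hasse invariant is a binary form in `e₄³` and `e₆²`. -/
theorem exists_hasse_form (p : ℕ) (hodd : p % 2 = 1) :
    ∃ c : ℕ → K, ∀ (B : Type*) [CommRing B] [Algebra K B] (x y : B),
      hasse p x y ^ 12
        = ∑ i ∈ range p, algebraMap K B (c i) * (x ^ 3) ^ i * (y ^ 2) ^ (p - 1 - i) := by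
  set m := (p - 1) / 2 with hm
  set Φ : MvPolynomial (Fin 2) K := hasse p (MvPolynomial.X 0) (MvPolynomial.X 1) with hΦ
  have hw : MvPolynomial.IsWeightedHomogeneous wt23 Φ m := by
    intro d hd
    have := (isobaric_cubic (K := K)).pow m (p - 1) d hd
    omega
  have hw12 := hw.pow 12
  set Ψ := Φ ^ 12 with hΨ
  have hmono : ∀ d, Ψ.coeff d ≠ 0 → ∃ i, i ≤ p - 1 ∧ d 0 = 3 * i ∧ d 1 = 2 * (p - 1 - i) := by
    intro d hd
    have h := hw12 hd
    have h1 : Finsupp.weight wt23 d = 2 * d 0 + 3 * d 1 := by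
      rw [Finsupp.weight_apply, Finsupp.sum_fintype _ _ (by simp)]
      simp [wt23, Fin.sum_univ_two, mul_comm]
    rw [h1] at h
    simp only [smul_eq_mul] at h
    refine ⟨d 0 / 3, ?_, ?_, ?_⟩ <;> omega
  let δ : ℕ → (Fin 2 →₀ ℕ) := fun i =>
    Finsupp.equivFunOnFinite.symm ![3 * i, 2 * (p - 1 - i)]
  refine ⟨fun i => Ψ.coeff (δ i), fun B _ _ x y => ?_⟩
  have hev : MvPolynomial.aeval ![x, y] Ψ = hasse p x y ^ 12 := by
    rw [hΨ, map_pow, hΦ]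
    congr 1
    have := hasse_map (MvPolynomial.aeval ![x, y] : MvPolynomial (Fin 2) K →ₐ[K] B).toRingHom p
      (MvPolynomial.X 0) (MvPolynomial.X 1)
    simpa using this
  rw [← hev, MvPolynomial.aeval_def, MvPolynomial.eval₂_eq']
  have hinj : Set.InjOn δ (range p : Set ℕ) := by
    intro i _ j _ h
    have := DFunLike.congr_fun h 0
    simp only [δ, Finsupp.equivFunOnFinite_symm_apply_apply, Matrix.cons_val_zero] at this
    omega
  have hsub : Ψ.support ⊆ (range p).image δ := by
    intro d hd
    rw [MvPolynomial.mem_support_iff] at hd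
    obtain ⟨i, h0, h1, h2⟩ := hmono d hd
    rw [mem_image]
    refine ⟨i, by rw [mem_range]; omega, ?_⟩
    ext k
    fin_cases k
    · simp [δ, h1]
    · simp [δ, h2]
  rw [sum_subset hsub, sum_image hinj]
  · refine sum_congr rfl fun i _ => ?_
    rw [Fin.prod_univ_two, mul_assoc]
    simp [δ, pow_mul]
  · intro d _ hd
    rw [MvPolynomial.notMem_support_iff.mp hd]; simp

end Isobaric

/-- The ring of complex power series converging on the open unit disc. -/
def convSubring : Subring (PowerSeries ℂ) where
  carrier := {P | ∀ z : ℂ, ‖z‖ < 1 → Summable fun m ↦ ‖P.coeff m * z ^ m‖}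
  mul_mem' := by
    intro P Q hP hQ z hz
    refine (summable_norm_sum_mul_antidiagonal_of_summable_norm (hP z hz) (hQ z hz)).congr
      fun n ↦ ?_
    rw [PowerSeries.coeff_mul, sum_mul]
    congr 1
    refine sum_congr rfl fun x hx ↦ ?_
    rw [← HasAntidiagonal.mem_antidiagonal.1 hx, pow_add]
    ring
  one_mem' := by
    intro z hz
    refine summable_of_ne_finset_zero (s := {0}) fun m hm ↦ ?_
    simp [PowerSeries.coeff_one, show m ≠ 0 by simpa using hm]
  add_mem' := by
    intro P Q hP hQ z hz
    refine ((hP z hz).add (hQ z hz)).of_nonneg_of_le (fun _ ↦ norm_nonneg _) fun m ↦ ?_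
    rw [map_add, add_mul]
    exact norm_add_le _ _
  zero_mem' := by intro z hz; simp [summable_zero]
  neg_mem' := by
    intro P hP z hz
    simpa using hP z hz

theorem C_mem_convSubring (a : ℂ) : PowerSeries.C a ∈ convSubring := by
  intro z hz
  refine summable_of_ne_finset_zero (s := {0}) fun m hm ↦ ?_
  simp [PowerSeries.coeff_C, show m ≠ 0 by simpa using hm]

/-- The value at `z` of a power series. -/
def evalSeries (z : ℂ) (P : PowerSeries ℂ) : ℂ := ∑' m, P.coeff m * z ^ m

theorem hasSum_evalSeries {P : PowerSeries ℂ} (hP : P ∈ convSubring) {z : ℂ} (hz : ‖z‖ < 1) :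
    HasSum (fun m ↦ P.coeff m * z ^ m) (evalSeries z P) :=
  (hP z hz).of_norm.hasSum

theorem mem_convSubring_of_summable {P : PowerSeries ℂ}
    (h : ∀ z : ℂ, ‖z‖ < 1 → z ≠ 0 → Summable fun m ↦ P.coeff m * z ^ m) : P ∈ convSubring := by
  intro z hz
  rcases eq_or_ne z 0 with rfl | h0
  · refine summable_of_ne_finset_zero (s := {0}) fun m hm ↦ ?_
    simp [show m ≠ 0 by simpa using hm]
  · exact (h z hz h0).norm

theorem evalSeries_C (z a : ℂ) : evalSeries z (PowerSeries.C a) = a := by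
  rw [evalSeries, tsum_eq_single 0 fun m hm ↦ by simp [PowerSeries.coeff_C, hm]]
  simp

/-- Evaluation at a point of the open unit disc, as a ring homomorphism. -/
def evalHom (z : ℂ) (hz : ‖z‖ < 1) : convSubring →+* ℂ where
  toFun P := evalSeries z P
  map_one' := by simpa using evalSeries_C z 1
  map_zero' := by simpa using evalSeries_C z 0
  map_add' P Q := by
    refine HasSum.unique (hasSum_evalSeries (P + Q).2 hz) ?_
    refine ((hasSum_evalSeries P.2 hz).add (hasSum_evalSeries Q.2 hz)).congr_fun fun m ↦ ?_
    simp [add_mul]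
  map_mul' P Q := by
    simp only [evalSeries]
    rw [tsum_mul_tsum_eq_tsum_sum_antidiagonal_of_summable_norm (P.2 z hz) (Q.2 z hz)]
    refine tsum_congr fun n ↦ ?_
    rw [Subring.coe_mul, PowerSeries.coeff_mul, sum_mul]
    refine sum_congr rfl fun x hx ↦ ?_
    rw [← HasAntidiagonal.mem_antidiagonal.1 hx, pow_add]
    ring

theorem evalHom_apply (z : ℂ) (hz : ‖z‖ < 1) (P : convSubring) :
    evalHom z hz P = evalSeries z (P : PowerSeries ℂ) := rfl

theorem expand_mem_convSubring {P : PowerSeries ℂ} (hP : P ∈ convSubring) {n : ℕ} (hn : n ≠ 0) :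
    P.expand n hn ∈ convSubring ∧
      ∀ z : ℂ, ‖z‖ < 1 → evalSeries z (P.expand n hn) = evalSeries (z ^ n) P := by
  have key (z : ℂ) (hz : ‖z‖ < 1) :
      HasSum (fun m ↦ (P.expand n hn).coeff m * z ^ m) (evalSeries (z ^ n) P) := by
    have hz' : ‖z ^ n‖ < 1 := by
      rw [norm_pow]; exact pow_lt_one₀ (norm_nonneg _) hz hn
    have hinj : Function.Injective fun m : ℕ ↦ n * m := fun a b h ↦
      Nat.eq_of_mul_eq_mul_left (Nat.pos_of_ne_zero hn) h
    have h0 : ∀ x ∉ Set.range fun m : ℕ ↦ n * m, (P.expand n hn).coeff x * z ^ x = 0 := by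
      intro x hx
      rw [PowerSeries.coeff_expand_of_not_dvd, zero_mul]
      rintro ⟨y, rfl⟩
      exact hx ⟨y, rfl⟩
    rw [← hinj.hasSum_iff h0]
    refine (hasSum_evalSeries hP hz').congr_fun fun m ↦ ?_
    simp only [Function.comp_apply]
    rw [PowerSeries.coeff_expand_mul, pow_mul]
  exact ⟨mem_convSubring_of_summable fun z hz _ ↦ (key z hz).summable,
    fun z hz ↦ (key z hz).tsum_eq⟩

theorem rescale_mem_convSubring {P : PowerSeries ℂ} (hP : P ∈ convSubring) {a : ℂ}
    (ha : ‖a‖ = 1) : PowerSeries.rescale a P ∈ convSubring ∧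
      ∀ z : ℂ, evalSeries z (PowerSeries.rescale a P) = evalSeries (a * z) P := by
  refine ⟨fun z hz ↦ ?_, fun z ↦ ?_⟩
  · refine (hP z hz).congr fun m ↦ ?_
    simp [PowerSeries.coeff_rescale, ha]
  · refine tsum_congr fun m ↦ ?_
    rw [PowerSeries.coeff_rescale, mul_pow]; ring

theorem differentiableOn_evalSeries_ball {P : PowerSeries ℂ} (hP : P ∈ convSubring) {r : ℝ}
    (hr0 : 0 ≤ r) (hr : r < 1) : DifferentiableOn ℂ (fun z ↦ evalSeries z P) (Metric.ball 0 r) ∧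
    ∀ z ∈ Metric.ball (0 : ℂ) r, HasSum (fun m ↦ P.coeff m * (m * z ^ (m - 1)))
      (deriv (fun z ↦ evalSeries z P) z) := by
  have hu := hP r (by simpa [abs_of_nonneg hr0] using hr)
  have hd : ∀ m, DifferentiableOn ℂ (fun z : ℂ ↦ P.coeff m * z ^ m) (Metric.ball 0 r) :=
    fun m ↦ by fun_prop
  have hle : ∀ (m : ℕ) (w : ℂ), w ∈ Metric.ball (0 : ℂ) r →
      ‖P.coeff m * w ^ m‖ ≤ ‖P.coeff m * (r : ℂ) ^ m‖ := by
    intro m w hw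
    rw [mem_ball_zero_iff] at hw
    rw [norm_mul, norm_mul, norm_pow, norm_pow, Complex.norm_real, Real.norm_of_nonneg hr0]
    gcongr
  refine ⟨Complex.differentiableOn_tsum_of_summable_norm hu hd Metric.isOpen_ball hle,
    fun z hz ↦ ?_⟩
  have := Complex.hasSum_deriv_of_summable_norm hu hd Metric.isOpen_ball hle hz
  refine this.congr_fun fun m ↦ ?_
  simp

theorem differentiableAt_evalSeries {P : PowerSeries ℂ} (hP : P ∈ convSubring) {z : ℂ}
    (hz : ‖z‖ < 1) : DifferentiableAt ℂ (fun z ↦ evalSeries z P) z := by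
  obtain ⟨r, hr, hr1⟩ := exists_between hz
  exact (differentiableOn_evalSeries_ball hP ((norm_nonneg z).trans hr.le) hr1).1.differentiableAt
    (Metric.isOpen_ball.mem_nhds (by simpa using hr))

theorem qDer_mem_convSubring {P : PowerSeries ℂ} (hP : P ∈ convSubring) :
    qDer ℂ P ∈ convSubring ∧ ∀ z : ℂ, ‖z‖ < 1 →
      evalSeries z (qDer ℂ P) = z * deriv (fun z ↦ evalSeries z P) z := by
  have key (z : ℂ) (hz : ‖z‖ < 1) : HasSum (fun m ↦ (qDer ℂ P).coeff m * z ^ m)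
      (z * deriv (fun z ↦ evalSeries z P) z) := by
    obtain ⟨r, hr, hr1⟩ := exists_between hz
    have := ((differentiableOn_evalSeries_ball hP ((norm_nonneg z).trans hr.le) hr1).2 z
      (by simpa using hr)).mul_left z
    refine this.congr_fun fun m ↦ ?_
    rw [coeff_qDer]
    rcases m with _ | m
    · simp
    · rw [Nat.add_sub_cancel, pow_succ]; ring
  exact ⟨mem_convSubring_of_summable fun z hz _ ↦ (key z hz).summable,
    fun z hz ↦ (key z hz).tsum_eq⟩

theorem eq_of_evalSeries_eq {P Q : PowerSeries ℂ} (hP : P ∈ convSubring) (hQ : Q ∈ convSubring)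
    (h : ∀ z : ℂ, ‖z‖ < 1 → z ≠ 0 → evalSeries z P = evalSeries z Q) : P = Q := by
  rw [← sub_eq_zero]
  by_contra hne
  set R := P - Q with hR
  have hRm : R ∈ convSubring := convSubring.sub_mem hP hQ
  have hR0 : ∀ z : ℂ, ‖z‖ < 1 → z ≠ 0 → evalSeries z R = 0 := by
    intro z hz h0
    have := map_sub (evalHom z hz) ⟨P, hP⟩ ⟨Q, hQ⟩
    rw [evalHom_apply, evalHom_apply, evalHom_apply, h z hz h0, sub_self] at this
    exact this
  obtain ⟨S, hS⟩ := PowerSeries.X_pow_order_dvd (φ := R)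
  set n := R.order.toNat with hn
  have hS0 : S.coeff 0 ≠ 0 := by
    have h1 := PowerSeries.coeff_order hne
    rw [← hn] at h1
    have : R.coeff n = S.coeff 0 := by
      rw [hS]
      simpa using PowerSeries.coeff_X_pow_mul S n 0
    rwa [this] at h1
  have hsum (z : ℂ) (hz : ‖z‖ < 1) (h0 : z ≠ 0) : HasSum (fun m ↦ S.coeff m * z ^ m) 0 := by
    have h1 := hasSum_evalSeries hRm hz
    rw [hR0 z hz h0] at h1
    have hinj : Function.Injective fun m : ℕ ↦ m + n := add_left_injective n
    rw [← hinj.hasSum_iff] at h1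
    · have h2 := h1.mul_left (z ^ n)⁻¹
      rw [mul_zero] at h2
      refine h2.congr_fun fun m ↦ ?_
      simp only [Function.comp_apply]
      rw [hS, PowerSeries.coeff_X_pow_mul, pow_add]
      field_simp
    · intro x hx
      have : x < n := by
        by_contra hle
        exact hx ⟨x - n, Nat.sub_add_cancel (not_lt.1 hle)⟩
      rw [hS, PowerSeries.coeff_X_pow_mul', if_neg (by omega), zero_mul]
  have hSm : S ∈ convSubring := mem_convSubring_of_summable fun z hz h0 ↦ (hsum z hz h0).summable
  have hc := (differentiableAt_evalSeries hSm (z := 0) (by simp)).continuousAt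
  have hlim : Filter.Tendsto (fun z ↦ evalSeries z S) (nhdsWithin 0 {0}ᶜ)
      (nhds (evalSeries 0 S)) := hc.tendsto.mono_left nhdsWithin_le_nhds
  have hlim0 : Filter.Tendsto (fun z ↦ evalSeries z S) (nhdsWithin 0 {0}ᶜ) (nhds 0) := by
    refine tendsto_const_nhds.congr' ?_
    filter_upwards [self_mem_nhdsWithin,
      nhdsWithin_le_nhds (Metric.ball_mem_nhds (0 : ℂ) one_pos)] with z h0 hz
    exact ((hsum z (by simpa using hz) h0).tsum_eq).symm
  have h2 : evalSeries 0 S = 0 := tendsto_nhds_unique hlim hlim0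
  apply hS0
  rw [← h2, evalSeries, tsum_eq_single 0 fun m hm ↦ by simp [hm]]
  simp

open UpperHalfPlane ModularFormClass MatrixGroups EisensteinSeries
open scoped ModularForm Manifold

theorem norm_qParam_lt {h : ℝ} (hh : 0 < h) (τ : ℍ) :
    ‖Function.Periodic.qParam h (τ : ℂ)‖ < 1 :=
  Function.Periodic.norm_qParam_lt_one hh τ.im_pos

theorem exists_eq_qParam {h : ℝ} (hh : 0 < h) {z : ℂ} (hz : ‖z‖ < 1) (h0 : z ≠ 0) :
    ∃ τ : ℍ, Function.Periodic.qParam h (τ : ℂ) = z :=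
  ⟨⟨_, Function.Periodic.im_invQParam_pos_of_norm_lt_one hh hz h0⟩,
    Function.Periodic.qParam_right_inv hh.ne' h0⟩

/-- A convergent series is determined by the function it represents on the upper half plane. -/
theorem eq_of_evalSeries_qParam_eq {h : ℝ} (hh : 0 < h) {P Q : PowerSeries ℂ}
    (hP : P ∈ convSubring) (hQ : Q ∈ convSubring)
    (heq : ∀ τ : ℍ, evalSeries (Function.Periodic.qParam h (τ : ℂ)) P
      = evalSeries (Function.Periodic.qParam h (τ : ℂ)) Q) : P = Q :=
  eq_of_evalSeries_eq hP hQ fun z hz h0 ↦ by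
    obtain ⟨τ, rfl⟩ := exists_eq_qParam hh hz h0
    exact heq τ

/-- A convergent series in `exp (2πiτ/h)` with the modular symmetries is a modular form. -/
theorem exists_modularForm_of_isBounded (k : ℤ) {F : ℍ → ℂ}
    (hF : DifferentiableOn ℂ (F ∘ ofComplex) {z | 0 < z.im}) (hbd : IsBoundedAtImInfty F)
    (hT : ∀ τ τ' : ℍ, (τ' : ℂ) = τ + 1 → F τ' = F τ)
    (hS : ∀ τ τ' : ℍ, (τ' : ℂ) * τ = -1 → F τ' = (τ : ℂ) ^ k * F τ) :
    ∃ f : ModularForm 𝒮ℒ k, ∀ τ, f τ = F τ := by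
  have hS' : F ∣[k] ModularGroup.S = F := by
    ext τ
    rw [ModularForm.SL_slash_apply, hS τ (ModularGroup.S • τ)]
    · rw [ModularGroup.denom_S, mul_comm, ← mul_assoc, ← zpow_add₀ (ne_zero τ)]
      simp
    · rw [modular_S_smul]
      simp [ne_zero τ]
  have hT' : F ∣[k] ModularGroup.T = F := by
    ext τ
    rw [ModularForm.SL_slash_apply, hT τ (ModularGroup.T • τ)]
    · rw [ModularGroup.denom_apply]
      simp [ModularGroup.T]
    · rw [modular_T_smul]
      simp [add_comm]
  have hinv := SlashInvariantForm.slash_action_generators_SL2Z hS' hT'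
  refine ⟨{ toFun := F, slash_action_eq' := ?_, holo' := ?_, bdd_at_cusps' := ?_ }, fun _ ↦ rfl⟩
  · rintro _ ⟨γ, rfl⟩
    exact hinv γ
  · rwa [UpperHalfPlane.mdifferentiable_iff]
  · intro c hc
    rw [Subgroup.IsArithmetic.isCusp_iff_isCusp_SL2Z] at hc
    rw [OnePoint.isBoundedAt_iff_forall_SL2Z hc]
    intro γ _
    rw [hinv γ]
    exact hbd

theorem exists_modularForm (k : ℤ) {h : ℝ} (hh : 0 < h) {P : PowerSeries ℂ}
    (hP : P ∈ convSubring) {F : ℍ → ℂ}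
    (hF : ∀ τ : ℍ, F τ = evalSeries (Function.Periodic.qParam h (τ : ℂ)) P)
    (hT : ∀ τ τ' : ℍ, (τ' : ℂ) = τ + 1 → F τ' = F τ)
    (hS : ∀ τ τ' : ℍ, (τ' : ℂ) * τ = -1 → F τ' = (τ : ℂ) ^ k * F τ) :
    ∃ f : ModularForm 𝒮ℒ k, ∀ τ, f τ = F τ := by
  have hbd : IsBoundedAtImInfty F := isBoundedAtImInfty_of_hasSum_qExpansion (c := fun m ↦ P.coeff m) hh
    fun τ ↦ by
      rw [hF]
      simpa using hasSum_evalSeries hP (norm_qParam_lt hh τ)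
  refine exists_modularForm_of_isBounded k ?_ hbd hT hS
  intro z hz
  have h1 : DifferentiableAt ℂ (fun w ↦ evalSeries (Function.Periodic.qParam h w) P) z := by
    have h2 := differentiableAt_evalSeries hP (norm_qParam_lt hh ⟨z, hz⟩)
    have h3 : DifferentiableAt ℂ (Function.Periodic.qParam h) z :=
      (Function.Periodic.differentiable_qParam).differentiableAt
    exact h2.comp z h3
  refine (h1.differentiableWithinAt).congr (fun w hw ↦ ?_) ?_
  · have := hF ⟨w, hw⟩
    simpa [ofComplex_apply_of_im_pos hw] using this
  · have := hF ⟨z, hz⟩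
    simpa [ofComplex_apply_of_im_pos hz] using this

theorem qExpansion_mem_convSubring {k : ℤ} (f : ModularForm 𝒮ℒ k) :
    qExpansion 1 f ∈ convSubring := by
  refine mem_convSubring_of_summable fun z hz h0 ↦ ?_
  obtain ⟨τ, rfl⟩ := exists_eq_qParam one_pos hz h0
  exact (ModularForm.hasSum_qExpansion f one_pos one_mem_strictPeriods_SL τ).summable

theorem evalSeries_qExpansion {k : ℤ} (f : ModularForm 𝒮ℒ k) (τ : ℍ) :
    f τ = evalSeries (Function.Periodic.qParam 1 (τ : ℂ)) (qExpansion 1 f) :=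
  (ModularForm.hasSum_qExpansion f one_pos one_mem_strictPeriods_SL τ).tsum_eq.symm

theorem qExpansion_eq_of_evalSeries {k : ℤ} (f : ModularForm 𝒮ℒ k) {P : PowerSeries ℂ}
    (hP : P ∈ convSubring)
    (h : ∀ τ : ℍ, f τ = evalSeries (Function.Periodic.qParam 1 (τ : ℂ)) P) :
    qExpansion 1 f = P :=
  eq_of_evalSeries_qParam_eq one_pos (qExpansion_mem_convSubring f) hP fun τ ↦ by
    rw [← evalSeries_qExpansion, h]

theorem modularForm_apply_smul {k : ℤ} (f : ModularForm 𝒮ℒ k) (a b c d : ℤ)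
    (hdet : a * d - b * c = 1) (τ τ' : ℍ) (h : (τ' : ℂ) * (c * τ + d) = a * τ + b) :
    f τ' = ((c : ℂ) * τ + d) ^ k * f τ := by
  let γ : SL(2, ℤ) := ⟨!![a, b; c, d], by rw [Matrix.det_fin_two_of]; exact hdet⟩
  have hden : denom γ τ = (c : ℂ) * τ + d := by
    rw [ModularGroup.denom_apply]
    simp [γ]
  have hne : (c : ℂ) * τ + d ≠ 0 := hden ▸ denom_ne_zero γ τ
  have hτ : τ' = γ • τ := by
    ext
    rw [UpperHalfPlane.coe_specialLinearGroup_apply]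
    simp only [γ]
    rw [eq_div_iff (by simpa using hne)]
    simpa using h
  rw [hτ, ← hden]
  exact SlashInvariantForm.slash_action_eqn'' (Γ := 𝒮ℒ) f (γ := (γ : GL (Fin 2) ℝ))
    (MonoidHom.mem_range.2 ⟨γ, rfl⟩) τ

open ModularForm (E₄ E₆)

/-- The integral `q`-series `1 + c ∑ σ_k(n) qⁿ`. -/
def eisSeries (c : ℤ) (k : ℕ) : PowerSeries ℤ :=
  PowerSeries.mk fun m ↦ if m = 0 then 1 else c * (ArithmeticFunction.sigma k m : ℤ)

/-- The ring map from integral to complex power series. -/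
abbrev toC : PowerSeries ℤ →+* PowerSeries ℂ := PowerSeries.map (Int.castRingHom ℂ)

theorem toC_eisSeries_four : toC (eisSeries 240 3) = qExpansion 1 E₄ := by
  ext m
  rw [E_qExpansion_coeff _ ⟨2, rfl⟩, PowerSeries.coeff_map, eisSeries, PowerSeries.coeff_mk]
  split_ifs
  · simp
  · have : _root_.bernoulli 4 = -1 / 30 := by decide +kernel
    rw [this]; push_cast; norm_num

theorem toC_eisSeries_six : toC (eisSeries (-504) 5) = qExpansion 1 E₆ := by
  ext m
  rw [E_qExpansion_coeff _ ⟨3, rfl⟩, PowerSeries.coeff_map, eisSeries, PowerSeries.coeff_mk]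
  split_ifs
  · simp
  · have : _root_.bernoulli 6 = 1 / 42 := by decide +kernel
    rw [this]; push_cast; norm_num

theorem twelve_dvd_sigma (m : ℕ) :
    (12 : ℤ) ∣ 5 * (ArithmeticFunction.sigma 3 m : ℤ) + 7 * (ArithmeticFunction.sigma 5 m : ℤ) := by
  rw [ArithmeticFunction.sigma_apply, ArithmeticFunction.sigma_apply]
  push_cast
  rw [mul_sum, mul_sum, ← sum_add_distrib]
  refine dvd_sum fun d _ ↦ ?_
  refine (ZMod.intCast_zmod_eq_zero_iff_dvd _ 12).1 ?_
  push_cast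
  generalize (d : ZMod 12) = x
  revert x
  decide

/-- The integral `q`-expansion of the discriminant form. -/
theorem exists_discriminant_series : ∃ D U : PowerSeries ℤ,
    1728 * D = eisSeries 240 3 ^ 3 - eisSeries (-504) 5 ^ 2 ∧ D = PowerSeries.X * U ∧
      PowerSeries.constantCoeff U = 1 := by
  set a : PowerSeries ℤ := PowerSeries.mk fun m ↦ if m = 0 then 0 else
    (ArithmeticFunction.sigma 3 m : ℤ) with ha
  set b : PowerSeries ℤ := PowerSeries.mk fun m ↦ if m = 0 then 0 else
    (ArithmeticFunction.sigma 5 m : ℤ) with hb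
  have h4 : eisSeries 240 3 = 1 + 240 * a := by
    ext m
    rw [show (240 : PowerSeries ℤ) = PowerSeries.C 240 from (map_ofNat PowerSeries.C 240).symm,
      map_add, PowerSeries.coeff_C_mul, ha, eisSeries, PowerSeries.coeff_mk, PowerSeries.coeff_mk,
      PowerSeries.coeff_one]
    split_ifs <;> simp
  have h6 : eisSeries (-504) 5 = 1 - 504 * b := by
    ext m
    rw [show (504 : PowerSeries ℤ) = PowerSeries.C 504 from (map_ofNat PowerSeries.C 504).symm,
      map_sub, PowerSeries.coeff_C_mul, hb, eisSeries, PowerSeries.coeff_mk, PowerSeries.coeff_mk,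
      PowerSeries.coeff_one]
    split_ifs <;> simp
  obtain ⟨c, hc⟩ : ∃ c : PowerSeries ℤ, 5 * a + 7 * b = 12 * c := by
    refine ⟨PowerSeries.mk fun m ↦ (5 * a + 7 * b).coeff m / 12, ?_⟩
    ext m
    rw [show (12 : PowerSeries ℤ) = PowerSeries.C 12 from (map_ofNat PowerSeries.C 12).symm,
      PowerSeries.coeff_C_mul, PowerSeries.coeff_mk]
    refine (Int.mul_ediv_cancel' ?_).symm
    rw [show (5 : PowerSeries ℤ) = PowerSeries.C 5 from (map_ofNat PowerSeries.C 5).symm,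
      show (7 : PowerSeries ℤ) = PowerSeries.C 7 from (map_ofNat PowerSeries.C 7).symm, map_add,
      PowerSeries.coeff_C_mul, PowerSeries.coeff_C_mul, ha, hb, PowerSeries.coeff_mk,
      PowerSeries.coeff_mk]
    split_ifs
    · simp
    · exact twelve_dvd_sigma m
  set D : PowerSeries ℤ := c + 100 * a ^ 2 + 8000 * a ^ 3 - 147 * b ^ 2 with hD
  have hmain : 1728 * D = eisSeries 240 3 ^ 3 - eisSeries (-504) 5 ^ 2 := by
    rw [h4, h6, hD]
    linear_combination (-144) * hc
  have ha0 : PowerSeries.constantCoeff a = 0 := by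
    rw [← PowerSeries.coeff_zero_eq_constantCoeff_apply, ha]; simp
  have hb0 : PowerSeries.constantCoeff b = 0 := by
    rw [← PowerSeries.coeff_zero_eq_constantCoeff_apply, hb]; simp
  obtain ⟨a', ha'⟩ := PowerSeries.X_dvd_iff.2 ha0
  obtain ⟨b', hb'⟩ := PowerSeries.X_dvd_iff.2 hb0
  have hD0 : PowerSeries.constantCoeff D = 0 := by
    have := congrArg PowerSeries.constantCoeff hmain
    rw [h4, h6] at this
    rw [map_mul, map_ofNat] at this
    simpa [ha0, hb0] using this
  obtain ⟨U, hU⟩ := PowerSeries.X_dvd_iff.2 hD0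
  refine ⟨D, U, hmain, hU, ?_⟩
  have ha1 : PowerSeries.constantCoeff a' = 1 := by
    have h : a.coeff 1 = 1 := by rw [ha]; simp
    rw [ha', show (1 : ℕ) = 0 + 1 from rfl, PowerSeries.coeff_succ_X_mul] at h
    simpa using h
  have hb1 : PowerSeries.constantCoeff b' = 1 := by
    have h : b.coeff 1 = 1 := by rw [hb]; simp
    rw [hb', show (1 : ℕ) = 0 + 1 from rfl, PowerSeries.coeff_succ_X_mul] at h
    simpa using h
  have hc1 : 5 * a' + 7 * b' = 12 * (U - PowerSeries.X * (100 * a' ^ 2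
      + 8000 * PowerSeries.X * a' ^ 3 - 147 * b' ^ 2)) := by
    refine mul_left_cancel₀ (PowerSeries.X_ne_zero (R := ℤ)) ?_
    have : c = PowerSeries.X * U - (100 * a ^ 2 + 8000 * a ^ 3 - 147 * b ^ 2) := by
      rw [← hU, hD]; ring
    rw [this, ha', hb'] at hc
    linear_combination hc
  have := congrArg PowerSeries.constantCoeff hc1
  rw [map_mul, map_add, map_mul, map_mul, map_ofNat, map_ofNat, map_ofNat, ha1, hb1, map_sub,
    map_mul, PowerSeries.constantCoeff_X] at this
  omega

/-- The integral `q`-expansion of the discriminant form. -/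
def discSeries : PowerSeries ℤ := exists_discriminant_series.choose

theorem discSeries_spec : 1728 * discSeries = eisSeries 240 3 ^ 3 - eisSeries (-504) 5 ^ 2 :=
  exists_discriminant_series.choose_spec.choose_spec.1

theorem exists_discSeries_eq_X_mul :
    ∃ U V : PowerSeries ℤ, discSeries = PowerSeries.X * U ∧ U * V = 1 ∧
      PowerSeries.constantCoeff U = 1 := by
  obtain ⟨h1, h2⟩ := exists_discriminant_series.choose_spec.choose_spec.2
  exact ⟨_, PowerSeries.invOfUnit _ 1, h1, PowerSeries.mul_invOfUnit _ _ (by simpa using h2), h2⟩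

theorem toC_eisSeries_four_mem : toC (eisSeries 240 3) ∈ convSubring :=
  toC_eisSeries_four ▸ qExpansion_mem_convSubring _

theorem toC_eisSeries_six_mem : toC (eisSeries (-504) 5) ∈ convSubring :=
  toC_eisSeries_six ▸ qExpansion_mem_convSubring _

theorem toC_discSeries : toC discSeries
    = PowerSeries.C (1 / 1728) * (toC (eisSeries 240 3) ^ 3 - toC (eisSeries (-504) 5) ^ 2) := by
  rw [← map_pow, ← map_pow, ← map_sub, ← discSeries_spec, map_mul, map_ofNat, ← mul_assoc,
    ← map_ofNat PowerSeries.C 1728, ← map_mul]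
  norm_num

theorem toC_discSeries_mem : toC discSeries ∈ convSubring := by
  rw [toC_discSeries]
  exact mul_mem (C_mem_convSubring _) (sub_mem (pow_mem toC_eisSeries_four_mem _)
    (pow_mem toC_eisSeries_six_mem _))

theorem E₄_eq_evalSeries (τ : ℍ) :
    E₄ τ = evalSeries (Function.Periodic.qParam 1 (τ : ℂ)) (toC (eisSeries 240 3)) := by
  rw [toC_eisSeries_four, evalSeries_qExpansion]

theorem E₆_eq_evalSeries (τ : ℍ) :
    E₆ τ = evalSeries (Function.Periodic.qParam 1 (τ : ℂ)) (toC (eisSeries (-504) 5)) := by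
  rw [toC_eisSeries_six, evalSeries_qExpansion]

theorem discriminant_eq_evalSeries (τ : ℍ) :
    ModularForm.discriminant τ
      = evalSeries (Function.Periodic.qParam 1 (τ : ℂ)) (toC discSeries) := by
  have hz := norm_qParam_lt one_pos τ
  have h := evalHom_apply _ hz (⟨_, C_mem_convSubring (1 / 1728)⟩ *
    (⟨_, toC_eisSeries_four_mem⟩ ^ 3 - ⟨_, toC_eisSeries_six_mem⟩ ^ 2))
  rw [map_mul, map_sub, map_pow, map_pow, evalHom_apply, evalHom_apply, evalHom_apply,
    ← E₄_eq_evalSeries, ← E₆_eq_evalSeries, evalSeries_C] at h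
  rw [toC_discSeries]
  refine Eq.trans ?_ h
  rw [ModularForm.discriminant_eq_E₄_cube_sub_E₆_sq]
  ring

theorem E₄_pow_three_apply_smul (a b c d : ℤ) (hdet : a * d - b * c = 1) (τ τ' : ℍ)
    (h : (τ' : ℂ) * (c * τ + d) = a * τ + b) :
    E₄ τ' ^ 3 = ((c : ℂ) * τ + d) ^ 12 * E₄ τ ^ 3 := by
  rw [modularForm_apply_smul E₄ a b c d hdet τ τ' h, mul_pow]
  norm_cast
  ring

theorem discriminant_apply_smul (a b c d : ℤ) (hdet : a * d - b * c = 1) (τ τ' : ℍ)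
    (h : (τ' : ℂ) * (c * τ + d) = a * τ + b) :
    ModularForm.discriminant τ' = ((c : ℂ) * τ + d) ^ 12 * ModularForm.discriminant τ := by
  rw [ModularForm.discriminant_eq_E₄_cube_sub_E₆_sq, ModularForm.discriminant_eq_E₄_cube_sub_E₆_sq,
    E₄_pow_three_apply_smul a b c d hdet τ τ' h, modularForm_apply_smul E₆ a b c d hdet τ τ' h]
  norm_cast
  ring

/-- The complex power series with coefficients in a subring. -/
def coeffSubring (R : Subring ℂ) : Subring (PowerSeries ℂ) := (PowerSeries.map R.subtype).range

theorem mem_coeffSubring {R : Subring ℂ} {P : PowerSeries ℂ} :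
    P ∈ coeffSubring R ↔ ∀ m, P.coeff m ∈ R := by
  refine ⟨?_, fun h ↦ ⟨PowerSeries.mk fun m ↦ ⟨P.coeff m, h m⟩, ?_⟩⟩
  · rintro ⟨P, rfl⟩ m
    simp
  · ext m
    simp

theorem toC_mem_coeffSubring (R : Subring ℂ) (P : PowerSeries ℤ) : toC P ∈ coeffSubring R :=
  mem_coeffSubring.2 fun m ↦ by simp

theorem C_mem_coeffSubring {R : Subring ℂ} {a : ℂ} (ha : a ∈ R) :
    PowerSeries.C a ∈ coeffSubring R :=
  mem_coeffSubring.2 fun m ↦ by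
    rw [PowerSeries.coeff_C]
    split_ifs
    exacts [ha, R.zero_mem]

theorem qExpansion_discriminant : qExpansion 1 ModularForm.discriminant = toC discSeries := by
  obtain ⟨f, hf⟩ : ∃ f : ModularForm 𝒮ℒ 12, ∀ τ, f τ = ModularForm.discriminant τ := by
    refine exists_modularForm 12 one_pos toC_discSeries_mem discriminant_eq_evalSeries ?_ ?_
    · intro τ τ' h
      simpa using discriminant_apply_smul 1 1 0 1 (by ring) τ τ' (by simpa using h)
    · intro τ τ' h
      simpa using discriminant_apply_smul 0 (-1) 1 0 (by ring) τ τ' (by simpa using h)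
  rw [← show (f : ℍ → ℂ) = ModularForm.discriminant from funext hf]
  exact qExpansion_eq_of_evalSeries f toC_discSeries_mem fun τ ↦ by
    rw [hf, discriminant_eq_evalSeries]

/-- A level one form of weight `12 k` with `q`-expansion over `R` is a polynomial over `R` in
`E₄ ^ 3` and `Δ`. -/
theorem exists_form_coeffs (R : Subring ℂ) (k : ℕ) : ∀ (n : ℤ), n = 12 * k →
    ∀ f : ModularForm 𝒮ℒ n, qExpansion 1 f ∈ coeffSubring R →
    ∃ a : ℕ → ℂ, (∀ i, a i ∈ R) ∧ ∀ τ, f τ = ∑ i ∈ range (k + 1),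
      a i * (E₄ τ ^ 3) ^ i * ModularForm.discriminant τ ^ (k - i) := by
  induction k with
  | zero =>
    intro n hn f hf
    obtain rfl : n = 0 := by simpa using hn
    obtain ⟨c, hc⟩ := levelOne_weight_zero_const f
    have hq : qExpansion 1 f = PowerSeries.C c :=
      qExpansion_eq_of_evalSeries f (C_mem_convSubring c) fun τ ↦ by
        rw [evalSeries_C, hc]; rfl
    have hcR : c ∈ R := by simpa [hq] using mem_coeffSubring.1 hf 0
    exact ⟨fun _ ↦ c, fun _ ↦ hcR, fun τ ↦ by rw [hc]; simp⟩
  | succ k ih =>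
    intro n hn f hf
    set c := (qExpansion 1 f).coeff 0 with hc
    set Q : PowerSeries ℂ := qExpansion 1 f - PowerSeries.C c * toC (eisSeries 240 3) ^ (3 * (k + 1))
      with hQ
    have hQm : Q ∈ convSubring := sub_mem (qExpansion_mem_convSubring f)
      (mul_mem (C_mem_convSubring _) (pow_mem toC_eisSeries_four_mem _))
    have hQR : Q ∈ coeffSubring R := sub_mem hf (mul_mem
      (C_mem_coeffSubring (mem_coeffSubring.1 hf 0)) (pow_mem (toC_mem_coeffSubring _ _) _))
    have hQe (τ : ℍ) : f τ - c * E₄ τ ^ (3 * (k + 1))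
        = evalSeries (Function.Periodic.qParam 1 (τ : ℂ)) Q := by
      have hz := norm_qParam_lt one_pos τ
      have h := evalHom_apply _ hz (⟨_, qExpansion_mem_convSubring f⟩ -
        ⟨_, C_mem_convSubring c⟩ * ⟨_, toC_eisSeries_four_mem⟩ ^ (3 * (k + 1)))
      rw [map_sub, map_mul, map_pow, evalHom_apply, evalHom_apply, evalHom_apply,
        ← E₄_eq_evalSeries, ← evalSeries_qExpansion, evalSeries_C] at h
      exact h
    obtain ⟨g, hg⟩ : ∃ g : ModularForm 𝒮ℒ n, ∀ τ, g τ = f τ - c * E₄ τ ^ (3 * (k + 1)) := by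
      have key (a b c' d : ℤ) (hdet : a * d - b * c' = 1) (τ τ' : ℍ)
          (h : (τ' : ℂ) * (c' * τ + d) = a * τ + b) :
          f τ' - c * E₄ τ' ^ (3 * (k + 1)) = ((c' : ℂ) * τ + d) ^ n *
            (f τ - c * E₄ τ ^ (3 * (k + 1))) := by
        rw [modularForm_apply_smul f a b c' d hdet τ τ' h, pow_mul, pow_mul,
          E₄_pow_three_apply_smul a b c' d hdet τ τ' h]
        have : ((c' : ℂ) * τ + d) ^ n = (((c' : ℂ) * τ + d) ^ 12) ^ (k + 1) := by
          rw [hn, ← pow_mul, ← zpow_natCast]; push_cast; rfl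
        rw [this, mul_pow]
        generalize (((c' : ℂ) * τ + d) ^ 12) ^ (k + 1) = w
        ring
      refine exists_modularForm n one_pos hQm hQe ?_ ?_
      · intro τ τ' h
        simpa using key 1 1 0 1 (by ring) τ τ' (by simpa using h)
      · intro τ τ' h
        simpa using key 0 (-1) 1 0 (by ring) τ τ' (by simpa using h)
    have hgQ : qExpansion 1 g = Q := qExpansion_eq_of_evalSeries g hQm fun τ ↦ by rw [hg, hQe]
    have h40 : PowerSeries.constantCoeff (toC (eisSeries 240 3)) = 1 := by
      rw [← PowerSeries.coeff_zero_eq_constantCoeff_apply]; simp [eisSeries]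
    have hQ0 : Q.coeff 0 = 0 := by
      rw [PowerSeries.coeff_zero_eq_constantCoeff_apply, hQ, map_sub, map_mul, map_pow, h40, one_pow,
        PowerSeries.constantCoeff_C, hc, PowerSeries.coeff_zero_eq_constantCoeff_apply]
      ring
    have hcusp : (qExpansion 1 g).coeff 0 = 0 := by rw [hgQ, hQ0]
    set h := CuspForm.discriminantEquiv (g.toCuspForm hcusp) with hh
    have hmul := ModularForm.qExpansion_eq_qExpansion_discriminant_mul g hcusp
    rw [hgQ, qExpansion_discriminant, ← hh] at hmul
    obtain ⟨U, V, hU, hUV, -⟩ := exists_discSeries_eq_X_mul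
    obtain ⟨Q', hQ'⟩ := PowerSeries.X_dvd_iff.2
      ((PowerSeries.coeff_zero_eq_constantCoeff_apply Q).symm.trans hQ0)
    have hQ'R : Q' ∈ coeffSubring R := mem_coeffSubring.2 fun m ↦ by
      have := mem_coeffSubring.1 hQR (m + 1)
      rwa [hQ', PowerSeries.coeff_succ_X_mul] at this
    have hqh : qExpansion 1 h = toC V * Q' := by
      have h1 : Q' = toC U * qExpansion 1 h := by
        refine mul_left_cancel₀ (PowerSeries.X_ne_zero (R := ℂ)) ?_
        rw [← hQ', hmul, hU, map_mul, PowerSeries.map_X, mul_assoc]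
      rw [h1, ← mul_assoc, ← map_mul, mul_comm V, hUV, map_one, one_mul]
    obtain ⟨a, haR, ha⟩ := ih (n - 12) (by rw [hn]; push_cast; ring) h
      (hqh ▸ mul_mem (toC_mem_coeffSubring _ _) hQ'R)
    refine ⟨fun i ↦ if i = k + 1 then c else a i, fun i ↦ ?_, fun τ ↦ ?_⟩
    · dsimp only
      split_ifs
      exacts [mem_coeffSubring.1 hf 0, haR i]
    · have h1 := hg τ
      have h2 := ModularForm.discriminant_mul_discriminantEquiv_apply (g.toCuspForm hcusp) τ
      rw [← hh, ha τ, ModularForm.toCuspForm_apply, h1, mul_sum] at h2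
      rw [sum_range_succ]
      dsimp only
      rw [if_pos rfl, Nat.sub_self, pow_zero, mul_one, ← pow_mul,
        ← sub_eq_iff_eq_add, ← h2]
      refine sum_congr rfl fun i hi ↦ ?_
      have hi' := mem_range.1 hi
      rw [if_neg (by omega), show k + 1 - i = (k - i) + 1 by omega, pow_succ]
      ring

theorem evalSeries_prod {z : ℂ} (hz : ‖z‖ < 1) {ι : Type*} (s : Finset ι)
    {P : ι → PowerSeries ℂ} (hP : ∀ i, P i ∈ convSubring) :
    evalSeries z (∏ i ∈ s, P i) = ∏ i ∈ s, evalSeries z (P i) := by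
  have h := map_prod (evalHom z hz) (fun i ↦ (⟨P i, hP i⟩ : convSubring)) s
  simpa only [evalHom_apply, SubmonoidClass.coe_finsetProd] using h

/-- The integral series of `E₄ ^ 3`. -/
abbrev cubeSeries : PowerSeries ℤ := eisSeries 240 3 ^ 3

theorem toC_cubeSeries_mem : toC cubeSeries ∈ convSubring := by
  rw [map_pow]; exact pow_mem toC_eisSeries_four_mem _

theorem E₄_pow_three_eq_evalSeries (τ : ℍ) :
    E₄ τ ^ 3 = evalSeries (Function.Periodic.qParam 1 (τ : ℂ)) (toC cubeSeries) := by
  have h := evalHom_apply _ (norm_qParam_lt one_pos τ) (⟨_, toC_eisSeries_four_mem⟩ ^ 3)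
  rw [map_pow, evalHom_apply, ← E₄_eq_evalSeries] at h
  rw [h, map_pow]; rfl

/-- Multiplication of points of the upper half plane by `p`, and translates divided by `p`. -/
def heckePt (p : ℕ) [hp : Fact p.Prime] (γ : Option (ZMod p)) (τ : ℍ) : ℍ :=
  match γ with
  | none => ⟨p * τ, by
      have : (0 : ℝ) < p := by exact_mod_cast hp.out.pos
      simpa using mul_pos this τ.im_pos⟩
  | some b => ⟨(τ + b.val) / p, by
      have : (0 : ℝ) < p := by exact_mod_cast hp.out.pos
      rw [Complex.div_natCast_im, Complex.add_im, Complex.natCast_im, add_zero]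
      exact div_pos τ.im_pos this⟩

variable {p : ℕ} [hp : Fact p.Prime]

theorem coe_heckePt_none (τ : ℍ) : (heckePt p none τ : ℂ) = p * τ := rfl

theorem coe_heckePt_some (b : ZMod p) (τ : ℍ) : (heckePt p (some b) τ : ℂ) = (τ + b.val) / p := rfl

/-- The normalised translate of a function of weight `12` by a Hecke representative. -/
def heckeFun (p : ℕ) [Fact p.Prime] (F : ℍ → ℂ) (γ : Option (ZMod p)) (τ : ℍ) : ℂ :=
  (match γ with | none => (p : ℂ) ^ 12 | some _ => 1) * F (heckePt p γ τ)

/-- The action of `τ ↦ τ + 1` on Hecke representatives. -/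
def heckeT (p : ℕ) : Equiv.Perm (Option (ZMod p)) := Equiv.optionCongr (Equiv.addRight 1)

/-- The action of `τ ↦ -1 / τ` on Hecke representatives. -/
def heckeSFun (p : ℕ) [Fact p.Prime] : Option (ZMod p) → Option (ZMod p)
  | none => some 0
  | some b => if b = 0 then none else some (-b⁻¹)

/-- The action of `τ ↦ -1 / τ` on Hecke representatives, as a permutation. -/
def heckeS (p : ℕ) [Fact p.Prime] : Equiv.Perm (Option (ZMod p)) :=
  Function.Involutive.toPerm (heckeSFun p) fun γ ↦ by
    rcases γ with _ | b
    · simp [heckeSFun]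
    · by_cases hb : b = 0
      · simp [heckeSFun, hb]
      · simp [heckeSFun, hb, inv_neg]

/-- Invariance of weight `12` under the modular group. -/
def IsWeightTwelve (F : ℍ → ℂ) : Prop :=
  ∀ a b c d : ℤ, a * d - b * c = 1 → ∀ τ τ' : ℍ, (τ' : ℂ) * (c * τ + d) = a * τ + b →
    F τ' = ((c : ℂ) * τ + d) ^ 12 * F τ

theorem p_ne_zero_complex : (p : ℂ) ≠ 0 := by exact_mod_cast hp.out.ne_zero

theorem heckeFun_T {F : ℍ → ℂ} (hF : IsWeightTwelve F) (γ : Option (ZMod p)) (τ τ' : ℍ)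
    (h : (τ' : ℂ) = τ + 1) : heckeFun p F γ τ' = heckeFun p F (heckeT p γ) τ := by
  have hp0 := p_ne_zero_complex (p := p)
  rcases γ with _ | b
  · simp only [heckeFun, heckeT, Equiv.optionCongr_apply, Option.map_none]
    rw [hF 1 p 0 1 (by ring) (heckePt p none τ) (heckePt p none τ') (by
      rw [coe_heckePt_none, coe_heckePt_none, h]; push_cast; ring)]
    simp
  · simp only [heckeFun, heckeT, Equiv.optionCongr_apply, Option.map_some, Equiv.coe_addRight,
      one_mul]
    obtain ⟨m, hm⟩ : (p : ℤ) ∣ (b.val : ℤ) + 1 - ((b + 1).val : ℤ) := by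
      rw [← ZMod.intCast_zmod_eq_zero_iff_dvd]
      simp
    have hm' : (b.val : ℂ) + 1 - ((b + 1).val : ℂ) = p * m := by exact_mod_cast hm
    rw [hF 1 m 0 1 (by ring) (heckePt p (some (b + 1)) τ) (heckePt p (some b) τ') (by
      rw [coe_heckePt_some, coe_heckePt_some, h]
      push_cast
      field_simp
      linear_combination (p : ℂ) * hm')]
    simp

theorem heckeFun_S {F : ℍ → ℂ} (hF : IsWeightTwelve F) (γ : Option (ZMod p)) (τ τ' : ℍ)
    (h : (τ' : ℂ) * τ = -1) : heckeFun p F γ τ' = (τ : ℂ) ^ 12 * heckeFun p F (heckeS p γ) τ := by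
  have hp0 := p_ne_zero_complex (p := p)
  have hτ := ne_zero τ
  rcases γ with _ | b
  · change (p : ℂ) ^ 12 * F _ = _ * (1 * F (heckePt p (some 0) τ))
    rw [hF 0 (-1) 1 0 (by ring) (heckePt p (some 0) τ) (heckePt p none τ') (by
      rw [coe_heckePt_none, coe_heckePt_some]
      push_cast
      field_simp
      simp only [ZMod.val_zero, Nat.cast_zero, add_zero]
      linear_combination (p : ℂ) * h), coe_heckePt_some]
    simp only [ZMod.val_zero, Nat.cast_zero, add_zero, Int.cast_one, one_mul, Int.cast_zero]
    field_simp
  · by_cases hb : b = 0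
    · subst hb
      have hS : heckeS p (some 0) = none := by
        change heckeSFun p (some 0) = none
        simp [heckeSFun]
      rw [hS]
      change 1 * F _ = _ * ((p : ℂ) ^ 12 * F (heckePt p none τ))
      rw [hF 0 (-1) 1 0 (by ring) (heckePt p none τ) (heckePt p (some 0) τ') (by
        rw [coe_heckePt_none, coe_heckePt_some]
        push_cast
        field_simp
        simp only [ZMod.val_zero, Nat.cast_zero, add_zero]
        linear_combination (p : ℂ) * h), coe_heckePt_none]
      simp only [Int.cast_one, one_mul, Int.cast_zero, add_zero]
      ring
    · have hS : heckeS p (some b) = some (-b⁻¹) := by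
        change heckeSFun p (some b) = some (-b⁻¹)
        simp [heckeSFun, hb]
      rw [hS]
      change 1 * F _ = _ * (1 * F (heckePt p (some (-b⁻¹)) τ))
      set b' := -b⁻¹ with hb'
      obtain ⟨m, hm⟩ : (p : ℤ) ∣ (b.val : ℤ) * (b'.val : ℤ) + 1 := by
        rw [← ZMod.intCast_zmod_eq_zero_iff_dvd]
        simp [hb', hb]
      have hm' : (b.val : ℂ) * (b'.val : ℂ) + 1 = p * m := by exact_mod_cast hm
      rw [hF b.val (-m) p (-b'.val) (by linear_combination -hm) (heckePt p (some b') τ)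
        (heckePt p (some b) τ') (by
          rw [coe_heckePt_some, coe_heckePt_some]
          push_cast
          field_simp
          linear_combination h - hm'), coe_heckePt_some]
      rw [one_mul, one_mul]
      congr 2
      push_cast
      field_simp
      ring

theorem isWeightTwelve_E₄_pow_three : IsWeightTwelve fun τ ↦ E₄ τ ^ 3 :=
  fun a b c d hdet τ τ' h ↦ E₄_pow_three_apply_smul a b c d hdet τ τ' h

theorem isWeightTwelve_discriminant : IsWeightTwelve ModularForm.discriminant :=
  fun a b c d hdet τ τ' h ↦ discriminant_apply_smul a b c d hdet τ τ' h

/-- The primitive `p`-th root of unity. -/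
def rootUnity (p : ℕ) : ℂ := Complex.exp (2 * Real.pi * Complex.I / p)

theorem norm_rootUnity (p : ℕ) : ‖rootUnity p‖ = 1 := by
  rw [rootUnity, show 2 * (Real.pi : ℂ) * Complex.I / p = ((2 * Real.pi / p : ℝ) : ℂ) * Complex.I by
    push_cast; ring]
  exact Complex.norm_exp_ofReal_mul_I _

theorem rootUnity_pow : rootUnity p ^ p = 1 := by
  rw [rootUnity, ← Complex.exp_nat_mul, mul_div_cancel₀ _ p_ne_zero_complex, Complex.exp_two_pi_mul_I]

theorem qParam_one_heckePt_none (τ : ℍ) : Function.Periodic.qParam 1 (heckePt p none τ : ℂ)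
    = Function.Periodic.qParam p (τ : ℂ) ^ (p ^ 2) := by
  have hp0 := p_ne_zero_complex (p := p)
  rw [Function.Periodic.qParam, Function.Periodic.qParam, ← Complex.exp_nat_mul, coe_heckePt_none]
  congr 1
  push_cast
  field_simp

theorem qParam_one_heckePt_some (b : ZMod p) (τ : ℍ) :
    Function.Periodic.qParam 1 (heckePt p (some b) τ : ℂ)
      = rootUnity p ^ b.val * Function.Periodic.qParam p (τ : ℂ) := by
  have hp0 := p_ne_zero_complex (p := p)
  rw [Function.Periodic.qParam, Function.Periodic.qParam, rootUnity, ← Complex.exp_nat_mul,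
    ← Complex.exp_add, coe_heckePt_some]
  congr 1
  push_cast
  field_simp
  ring

theorem qParam_one_eq_pow (τ : ℍ) : Function.Periodic.qParam 1 (τ : ℂ)
    = Function.Periodic.qParam p (τ : ℂ) ^ p := by
  have hp0 := p_ne_zero_complex (p := p)
  rw [Function.Periodic.qParam, Function.Periodic.qParam, ← Complex.exp_nat_mul]
  congr 1
  push_cast
  field_simp

/-- The series over a ring with a chosen root of unity of the translates of a series. -/
def heckeSeries {R : Type*} [CommRing R] (ζ : R) (P : PowerSeries R) (γ : Option (ZMod p)) :
    PowerSeries R :=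
  match γ with
  | none => P.expand (p ^ 2) (pow_ne_zero 2 hp.out.ne_zero)
  | some b => PowerSeries.rescale (ζ ^ b.val) P

theorem map_heckeSeries {R S : Type*} [CommRing R] [CommRing S] (φ : R →+* S) (ζ : R)
    (P : PowerSeries R) (γ : Option (ZMod p)) :
    PowerSeries.map φ (heckeSeries ζ P γ) = heckeSeries (φ ζ) (PowerSeries.map φ P) γ := by
  rcases γ with _ | b
  · simp [heckeSeries, PowerSeries.map_expand]
  · ext m
    simp [heckeSeries, PowerSeries.coeff_rescale]

theorem heckeSeries_mem {P : PowerSeries ℂ} (hP : P ∈ convSubring) (γ : Option (ZMod p)) :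
    heckeSeries (rootUnity p) P γ ∈ convSubring := by
  rcases γ with _ | b
  · exact (expand_mem_convSubring hP _).1
  · exact (rescale_mem_convSubring hP (by rw [norm_pow, norm_rootUnity, one_pow])).1

theorem evalSeries_heckeSeries {P : PowerSeries ℂ} (hP : P ∈ convSubring) {F : ℍ → ℂ}
    (hF : ∀ τ : ℍ, F τ = evalSeries (Function.Periodic.qParam 1 (τ : ℂ)) P)
    (γ : Option (ZMod p)) (τ : ℍ) :
    evalSeries (Function.Periodic.qParam p (τ : ℂ)) (heckeSeries (rootUnity p) P γ)
      = F (heckePt p γ τ) := by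
  have hp' : (0 : ℝ) < p := by exact_mod_cast hp.out.pos
  rw [hF]
  rcases γ with _ | b
  · rw [qParam_one_heckePt_none]
    exact (expand_mem_convSubring hP _).2 _ (norm_qParam_lt hp' τ)
  · rw [qParam_one_heckePt_some]
    exact (rescale_mem_convSubring hP (by rw [norm_pow, norm_rootUnity, one_pow])).2 _

theorem evalSeries_expand {P : PowerSeries ℂ} (hP : P ∈ convSubring) {F : ℍ → ℂ}
    (hF : ∀ τ : ℍ, F τ = evalSeries (Function.Periodic.qParam 1 (τ : ℂ)) P) (τ : ℍ) :
    evalSeries (Function.Periodic.qParam p (τ : ℂ)) (P.expand p hp.out.ne_zero) = F τ := by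
  have hp' : (0 : ℝ) < p := by exact_mod_cast hp.out.pos
  rw [hF, qParam_one_eq_pow (p := p)]
  exact (expand_mem_convSubring hP _).2 _ (norm_qParam_lt hp' τ)

/-- The image of an integral power series over a ring. -/
abbrev toR (R : Type*) [CommRing R] : PowerSeries ℤ →+* PowerSeries R :=
  PowerSeries.map (Int.castRingHom R)

theorem map_toR {R S : Type*} [CommRing R] [CommRing S] (φ : R →+* S) (P : PowerSeries ℤ) :
    PowerSeries.map φ (toR R P) = toR S P := by
  ext m
  simp

/-- The homogeneous expression `∑ aᵢ xⁱ yᵏ⁻ⁱ`. -/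
def homSum {R : Type*} [CommRing R] (k : ℕ) (a : ℕ → R) (x y : PowerSeries R) : PowerSeries R :=
  ∑ i ∈ range (k + 1), PowerSeries.C (a i) * x ^ i * y ^ (k - i)

theorem map_homSum {R S : Type*} [CommRing R] [CommRing S] (φ : R →+* S) (k : ℕ) (a : ℕ → R)
    (x y : PowerSeries R) : PowerSeries.map φ (homSum k a x y)
      = homSum k (fun i ↦ φ (a i)) (PowerSeries.map φ x) (PowerSeries.map φ y) := by
  simp [homSum, map_sum]

theorem homSum_mem {k : ℕ} {a : ℕ → ℂ} {x y : PowerSeries ℂ} (hx : x ∈ convSubring)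
    (hy : y ∈ convSubring) : homSum k a x y ∈ convSubring :=
  sum_mem fun _ _ ↦ mul_mem (mul_mem (C_mem_convSubring _) (pow_mem hx _)) (pow_mem hy _)

theorem evalSeries_homSum {z : ℂ} (hz : ‖z‖ < 1) {k : ℕ} {a : ℕ → ℂ} {x y : PowerSeries ℂ}
    (hx : x ∈ convSubring) (hy : y ∈ convSubring) : evalSeries z (homSum k a x y)
      = ∑ i ∈ range (k + 1), a i * evalSeries z x ^ i * evalSeries z y ^ (k - i) := by
  have h := evalHom_apply z hz (∑ i ∈ range (k + 1),
    ⟨_, C_mem_convSubring (a i)⟩ * ⟨_, hx⟩ ^ i * ⟨_, hy⟩ ^ (k - i))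
  simp only [map_sum, map_mul, map_pow, evalHom_apply, evalSeries_C] at h
  rw [h]
  congr 1
  simp [homSum]

theorem expand_injective {R : Type*} [CommRing R] {n : ℕ} (hn : n ≠ 0) :
    Function.Injective (PowerSeries.expand (R := R) n hn) := fun P Q h ↦ by
  ext m
  rw [← PowerSeries.coeff_expand_mul n hn P m, h, PowerSeries.coeff_expand_mul]

theorem expand_toR_eq_pow {k : Type*} [CommRing k] [CharP k p] (P : PowerSeries ℤ) :
    (toR k P).expand p hp.out.ne_zero = toR k P ^ p := by
  have h := MvPowerSeries.map_frobenius_expand p hp.out.ne_zero (f := toR k P)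
  refine Eq.trans ?_ h
  ext m
  have h2 : PowerSeries.expand p hp.out.ne_zero (toR k P)
      = toR k (PowerSeries.expand p hp.out.ne_zero P) := (PowerSeries.map_expand ..).symm
  change _ = PowerSeries.coeff m (PowerSeries.map (frobenius k p)
    (PowerSeries.expand p hp.out.ne_zero (toR k P)))
  rw [h2, PowerSeries.coeff_map, PowerSeries.coeff_map, PowerSeries.coeff_map, eq_intCast,
    map_intCast]

theorem exists_coeffs_of_family (R : Subring ℂ) (m : ℕ) (M : Option (ZMod p) → ℍ → ℂ)
    (hT : ∀ γ (τ τ' : ℍ), (τ' : ℂ) = τ + 1 → M γ τ' = M (heckeT p γ) τ)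
    (hS : ∀ γ (τ τ' : ℍ), (τ' : ℂ) * τ = -1 → M γ τ' = ((τ : ℂ) ^ 12) ^ m * M (heckeS p γ) τ)
    (c : ℂ) (L : Option (ZMod p) → PowerSeries R)
    (hL : ∀ γ, PowerSeries.map R.subtype (L γ) ∈ convSubring)
    (heq : ∀ τ : ℍ, c * ∏ γ, M γ τ
      = ∏ γ, evalSeries (Function.Periodic.qParam p (τ : ℂ)) (PowerSeries.map R.subtype (L γ))) :
    ∃ a : ℕ → R, (∀ τ : ℍ, c * ∏ γ, M γ τ = ∑ i ∈ range (m * (p + 1) + 1),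
        (a i : ℂ) * (E₄ τ ^ 3) ^ i * ModularForm.discriminant τ ^ (m * (p + 1) - i)) ∧
      ∏ γ, L γ = (homSum (m * (p + 1)) a (toR R cubeSeries) (toR R discSeries)).expand p
        hp.out.ne_zero := by
  have hp' : (0 : ℝ) < p := by exact_mod_cast hp.out.pos
  set k := m * (p + 1) with hk
  have hLm : ∏ γ, PowerSeries.map R.subtype (L γ) ∈ convSubring := prod_mem fun γ _ ↦ hL γ
  have hLe (τ : ℍ) : c * ∏ γ, M γ τ = evalSeries (Function.Periodic.qParam p (τ : ℂ))
      (∏ γ, PowerSeries.map R.subtype (L γ)) := by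
    rw [heq, evalSeries_prod (norm_qParam_lt hp' τ) _ hL]
  obtain ⟨f, hf⟩ := exists_modularForm ((12 * k : ℕ) : ℤ) hp' hLm hLe
    (fun τ τ' h ↦ by
      rw [prod_congr rfl fun γ _ ↦ hT γ τ τ' h, Equiv.prod_comp (heckeT p) fun γ ↦ M γ τ])
    (fun τ τ' h ↦ by
      rw [prod_congr rfl fun γ _ ↦ hS γ τ τ' h, prod_mul_distrib,
        Equiv.prod_comp (heckeS p) fun γ ↦ M γ τ, prod_const, card_univ, Fintype.card_option,
        ZMod.card, zpow_natCast, ← pow_mul, ← pow_mul, hk]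
      exact mul_left_comm ..)
  have hqf : (qExpansion 1 f).expand p hp.out.ne_zero = ∏ γ, PowerSeries.map R.subtype (L γ) := by
    refine eq_of_evalSeries_qParam_eq hp' (expand_mem_convSubring (qExpansion_mem_convSubring f) _).1
      hLm fun τ ↦ ?_
    rw [evalSeries_expand (qExpansion_mem_convSubring f) (evalSeries_qExpansion f), hf, hLe]
  have hR : qExpansion 1 f ∈ coeffSubring R := mem_coeffSubring.2 fun n ↦ by
    rw [← PowerSeries.coeff_expand_mul p hp.out.ne_zero, hqf, ← map_prod, PowerSeries.coeff_map]
    exact Subtype.coe_prop _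
  obtain ⟨a, haR, ha⟩ := exists_form_coeffs R k _ (by push_cast; ring) f hR
  refine ⟨fun i ↦ ⟨a i, haR i⟩, fun τ ↦ by rw [← hf, ha], ?_⟩
  have hinj : Function.Injective (PowerSeries.map R.subtype) := fun P Q h ↦ by
    ext n
    simpa using congrArg (PowerSeries.coeff n) h
  apply hinj
  rw [PowerSeries.map_expand, map_homSum, map_prod, ← hqf, map_toR, map_toR]
  congr 1
  refine qExpansion_eq_of_evalSeries f (homSum_mem toC_cubeSeries_mem toC_discSeries_mem) fun τ ↦ ?_
  rw [evalSeries_homSum (norm_qParam_lt one_pos τ) toC_cubeSeries_mem toC_discSeries_mem, ha,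
    E₄_pow_three_eq_evalSeries, discriminant_eq_evalSeries]
  rfl

theorem evalSeries_sub {z : ℂ} (hz : ‖z‖ < 1) {P Q : PowerSeries ℂ} (hP : P ∈ convSubring)
    (hQ : Q ∈ convSubring) : evalSeries z (P - Q) = evalSeries z P - evalSeries z Q := by
  have h := map_sub (evalHom z hz) ⟨P, hP⟩ ⟨Q, hQ⟩
  rwa [evalHom_apply, evalHom_apply, evalHom_apply] at h

theorem evalSeries_mul {z : ℂ} (hz : ‖z‖ < 1) {P Q : PowerSeries ℂ} (hP : P ∈ convSubring)
    (hQ : Q ∈ convSubring) : evalSeries z (P * Q) = evalSeries z P * evalSeries z Q := by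
  have h := map_mul (evalHom z hz) ⟨P, hP⟩ ⟨Q, hQ⟩
  rwa [evalHom_apply, evalHom_apply, evalHom_apply] at h

theorem homSum_eq_zero {k : Type*} [CommRing k] [NoZeroDivisors k] (n : ℕ) (a : ℕ → k)
    {x y : PowerSeries k} (hx : PowerSeries.constantCoeff x = 1) (hy : ∃ u, y = PowerSeries.X * u ∧
      PowerSeries.constantCoeff u = 1)
    (h : PowerSeries.X ^ (n + 1) ∣ homSum n a x y) : ∀ i ≤ n, a i = 0 := by
  obtain ⟨u, rfl, hu⟩ := hy
  have key : ∀ m ≤ n, a (n - m) = 0 := by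
    intro m
    induction m using Nat.strong_induction_on with
    | _ m ih =>
      intro hm
      have hsum : homSum n a x (PowerSeries.X * u)
          = ∑ m ∈ range (n + 1), PowerSeries.C (a (n - m)) * x ^ (n - m) * u ^ m
            * PowerSeries.X ^ m := by
        rw [homSum, ← sum_range_reflect]
        refine sum_congr rfl fun i hi ↦ ?_
        have : n - (n - i) = i := by have := mem_range.1 hi; omega
        rw [Nat.add_sub_cancel, this, mul_pow]
        ring
      have h0 := PowerSeries.X_pow_dvd_iff.1 h m (by omega)
      rw [hsum, map_sum, sum_eq_single m] at h0
      · rw [PowerSeries.coeff_mul_X_pow', if_pos le_rfl, Nat.sub_self,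
          PowerSeries.coeff_zero_eq_constantCoeff_apply] at h0
        simpa [hx, hu] using h0
      · intro i hi hne
        rw [PowerSeries.coeff_mul_X_pow']
        split_ifs with hle
        · rw [ih i (by omega) (by omega)]
          simp
        · rfl
      · intro h'
        exact absurd (mem_range.2 (by omega)) h'
  intro i hi
  have := key (n - i) (by omega)
  rwa [show n - (n - i) = i by omega] at this

theorem mul_pow_mul_eval₂ {A B : Type*} [CommRing A] [CommRing B] (φ : A →+* B) (n : ℕ) (a : ℕ → A)
    (j y : B) : ∑ i ∈ range (n + 1), φ (a i) * (j * y) ^ i * y ^ (n - i)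
      = y ^ n * (∑ i ∈ range (n + 1), Polynomial.C (a i) * X ^ i).eval₂ φ j := by
  rw [eval₂_finsetSum, mul_sum]
  refine sum_congr rfl fun i hi ↦ ?_
  obtain ⟨m, rfl⟩ := Nat.exists_eq_add_of_le (Nat.le_of_lt_succ (mem_range.1 hi))
  rw [eval₂_mul, eval₂_C, eval₂_X_pow, Nat.add_sub_cancel_left]
  ring

/-- A homogeneous form in `x` and `y` which is close to a given homogenised polynomial equals it. -/
theorem sum_eq_of_homSum {k : Type*} [Field k] (n : ℕ) (a : ℕ → k)
    {x y : PowerSeries k} (hx : PowerSeries.constantCoeff x = 1) (hy : ∃ u, y = PowerSeries.X * u ∧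
      PowerSeries.constantCoeff u = 1) (G : Polynomial k) (hG : G.natDegree ≤ n)
    (S : PowerSeries k) (hS : ∀ j : FractionRing (PowerSeries k),
      algebraMap _ _ x = j * algebraMap _ _ y → algebraMap _ _ S = algebraMap _ _ y ^ n *
        G.eval₂ ((algebraMap (PowerSeries k) (FractionRing (PowerSeries k))).comp PowerSeries.C) j)
    (h : PowerSeries.X ^ (n + 1) ∣ homSum n a x y - S) (z : k) :
    ∑ i ∈ range (n + 1), a i * z ^ i = G.eval z := by
  have hy0 : y ≠ 0 := by
    rintro rfl
    obtain ⟨u, hu, hu1⟩ := hy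
    rcases mul_eq_zero.1 hu.symm with h | h
    · exact PowerSeries.X_ne_zero h
    · simp [h] at hu1
  have hSG : S = homSum n G.coeff x y := by
    apply IsFractionRing.injective (PowerSeries k) (FractionRing (PowerSeries k))
    set ι := algebraMap (PowerSeries k) (FractionRing (PowerSeries k)) with hι
    have hιy : ι y ≠ 0 := fun h0 ↦ hy0 (IsFractionRing.injective (PowerSeries k)
      (FractionRing (PowerSeries k)) (by rw [← hι, h0, map_zero]))
    have hxy : ι x = (ι x / ι y) * ι y := (div_mul_cancel₀ _ hιy).symm
    rw [hS _ hxy, homSum, map_sum]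
    simp only [map_mul, map_pow]
    conv_rhs => rw [hxy]
    have h := mul_pow_mul_eval₂ (ι.comp PowerSeries.C) n G.coeff (ι x / ι y) (ι y)
    rw [← Polynomial.as_sum_range_C_mul_X_pow' (p := G) (n := n + 1) (by omega)] at h
    exact h.symm
  have h0 := homSum_eq_zero n (fun i ↦ a i - G.coeff i) hx hy (by
    rw [hSG] at h
    convert h using 1
    simp only [homSum, map_sub, sub_mul, sum_sub_distrib])
  rw [Polynomial.eval_eq_sum_range' (n := n + 1) (by omega)]
  exact sum_congr rfl fun i hi ↦ by
    rw [sub_eq_zero.1 (h0 i (Nat.le_of_lt_succ (mem_range.1 hi)))]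

theorem heckeSeries_one_none {k : Type*} [CommRing k] [CharP k p] (P : PowerSeries ℤ) :
    heckeSeries (p := p) 1 (toR k P) none = toR k P ^ p ^ 2 := by
  have h : heckeSeries (p := p) 1 (toR k P) none
      = (toR k P).expand (p * p) (mul_ne_zero hp.out.ne_zero hp.out.ne_zero) := by
    simp only [heckeSeries, sq]
  rw [h, PowerSeries.expand_mul (p := p) (q := p) hp.out.ne_zero hp.out.ne_zero,
    expand_toR_eq_pow, map_pow, expand_toR_eq_pow, ← pow_mul, sq]

theorem heckeSeries_one_some {k : Type*} [CommRing k] (P : PowerSeries k) (b : ZMod p) :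
    heckeSeries 1 P (some b) = P := by
  simp [heckeSeries]

theorem map_rootUnity_eq_one {k : Type*} [Field k] [CharP k p] {R : Subring ℂ}
    (hζ : rootUnity p ∈ R) (φ : R →+* k) : φ ⟨rootUnity p, hζ⟩ = 1 := by
  have h : (φ ⟨rootUnity p, hζ⟩ - 1) ^ p = 0 := by
    rw [sub_pow_char, one_pow, ← map_pow, sub_eq_zero, ← map_one φ]
    congr 1
    exact Subtype.ext rootUnity_pow
  exact sub_eq_zero.1 (eq_zero_of_pow_eq_zero h)

theorem constantCoeff_toR_cubeSeries {k : Type*} [CommRing k] :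
    PowerSeries.constantCoeff (toR k cubeSeries) = 1 := by
  rw [← PowerSeries.coeff_zero_eq_constantCoeff_apply, PowerSeries.coeff_map,
    PowerSeries.coeff_zero_eq_constantCoeff_apply, map_pow]
  simp [eisSeries, ← PowerSeries.coeff_zero_eq_constantCoeff_apply]

theorem toR_discSeries_eq {k : Type*} [CommRing k] : ∃ u, toR k discSeries = PowerSeries.X * u ∧
    PowerSeries.constantCoeff u = 1 := by
  obtain ⟨U, -, h, -, hU⟩ := exists_discSeries_eq_X_mul
  refine ⟨toR k U, by rw [h, map_mul, PowerSeries.map_X], ?_⟩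
  rw [← PowerSeries.coeff_zero_eq_constantCoeff_apply, PowerSeries.coeff_map,
    PowerSeries.coeff_zero_eq_constantCoeff_apply, hU, map_one]

/-- The series of the factors of the modular polynomial of level `p` on the diagonal. -/
def crossSeries {R : Type*} [CommRing R] (ζ : R) (γ : Option (ZMod p)) : PowerSeries R :=
  (toR R cubeSeries).expand p hp.out.ne_zero * heckeSeries ζ (toR R discSeries) γ
    - heckeSeries ζ (toR R cubeSeries) γ * (toR R discSeries).expand p hp.out.ne_zero

theorem map_crossSeries {R S : Type*} [CommRing R] [CommRing S] (ψ : R →+* S) (ζ : R)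
    (γ : Option (ZMod p)) : PowerSeries.map ψ (crossSeries ζ γ) = crossSeries (ψ ζ) γ := by
  simp only [crossSeries, map_sub, map_mul, PowerSeries.map_expand, map_heckeSeries, map_toR]

/-- The modular polynomial of level `p` on the diagonal, and its reduction. -/
theorem exists_modular_polynomial {k : Type*} [Field k] [CharP k p] (R : Subring ℂ)
    (hζ : rootUnity p ∈ R) (φ : R →+* k) :
    ∃ a : ℕ → R, (∀ τ : ℍ, ∏ γ, (E₄ τ ^ 3 * ModularForm.discriminant (heckePt p γ τ)
        - E₄ (heckePt p γ τ) ^ 3 * ModularForm.discriminant τ)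
        = ∑ i ∈ range (2 * (p + 1) + 1),
          (a i : ℂ) * (E₄ τ ^ 3) ^ i * ModularForm.discriminant τ ^ (2 * (p + 1) - i)) ∧
      ∀ z : k, ∑ i ∈ range (2 * (p + 1) + 1), φ (a i) * z ^ i = -(z ^ p - z) ^ 2 := by
  have hp0 := p_ne_zero_complex (p := p)
  have hp' : (0 : ℝ) < p := by exact_mod_cast hp.out.pos
  set ζ : R := ⟨rootUnity p, hζ⟩
  have hexp {P : PowerSeries ℂ} (hP : P ∈ convSubring) :=
    (expand_mem_convSubring hP hp.out.ne_zero).1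
  have hprod (τ : ℍ) : ((p : ℂ) ^ 12)⁻¹ * ∏ γ, (E₄ τ ^ 3 * heckeFun p ModularForm.discriminant γ τ
      - heckeFun p (fun τ ↦ E₄ τ ^ 3) γ τ * ModularForm.discriminant τ)
      = ∏ γ, (E₄ τ ^ 3 * ModularForm.discriminant (heckePt p γ τ)
        - E₄ (heckePt p γ τ) ^ 3 * ModularForm.discriminant τ) := by
    rw [Fintype.prod_option, Fintype.prod_option]
    simp only [heckeFun, one_mul]
    field_simp
  obtain ⟨a, ha, h⟩ := exists_coeffs_of_family R 2
    (fun γ τ ↦ E₄ τ ^ 3 * heckeFun p ModularForm.discriminant γ τ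
      - heckeFun p (fun τ ↦ E₄ τ ^ 3) γ τ * ModularForm.discriminant τ)
    (fun γ τ τ' hτ ↦ by
      rw [heckeFun_T isWeightTwelve_discriminant γ τ τ' hτ,
        heckeFun_T isWeightTwelve_E₄_pow_three γ τ τ' hτ,
        isWeightTwelve_discriminant 1 1 0 1 (by ring) τ τ' (by simpa using hτ),
        E₄_pow_three_apply_smul 1 1 0 1 (by ring) τ τ' (by simpa using hτ)]
      simp)
    (fun γ τ τ' hτ ↦ by
      rw [heckeFun_S isWeightTwelve_discriminant γ τ τ' hτ,
        heckeFun_S isWeightTwelve_E₄_pow_three γ τ τ' hτ,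
        isWeightTwelve_discriminant 0 (-1) 1 0 (by ring) τ τ' (by simpa using hτ),
        E₄_pow_three_apply_smul 0 (-1) 1 0 (by ring) τ τ' (by simpa using hτ)]
      simp only [Int.cast_one, one_mul, Int.cast_zero, add_zero]
      ring)
    ((p : ℂ) ^ 12)⁻¹ (crossSeries ζ)
    (fun γ ↦ by
      rw [map_crossSeries]
      exact sub_mem (mul_mem (hexp toC_cubeSeries_mem) (heckeSeries_mem toC_discSeries_mem γ))
        (mul_mem (heckeSeries_mem toC_cubeSeries_mem γ) (hexp toC_discSeries_mem)))
    (fun τ ↦ by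
      rw [hprod]
      refine prod_congr rfl fun γ _ ↦ ?_
      have hq := norm_qParam_lt hp' τ
      rw [map_crossSeries]
      change _ = evalSeries _ ((toC cubeSeries).expand p _ * heckeSeries (rootUnity p)
        (toC discSeries) γ - heckeSeries (rootUnity p) (toC cubeSeries) γ
          * (toC discSeries).expand p _)
      rw [evalSeries_sub hq
        (mul_mem (hexp toC_cubeSeries_mem) (heckeSeries_mem toC_discSeries_mem γ))
        (mul_mem (heckeSeries_mem toC_cubeSeries_mem γ) (hexp toC_discSeries_mem)),
        evalSeries_mul hq (hexp toC_cubeSeries_mem) (heckeSeries_mem toC_discSeries_mem γ),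
        evalSeries_mul hq (heckeSeries_mem toC_cubeSeries_mem γ) (hexp toC_discSeries_mem),
        evalSeries_expand toC_cubeSeries_mem (F := fun τ ↦ E₄ τ ^ 3) E₄_pow_three_eq_evalSeries,
        evalSeries_expand toC_discSeries_mem discriminant_eq_evalSeries,
        evalSeries_heckeSeries toC_cubeSeries_mem (F := fun τ ↦ E₄ τ ^ 3) E₄_pow_three_eq_evalSeries,
        evalSeries_heckeSeries toC_discSeries_mem discriminant_eq_evalSeries])
  refine ⟨a, fun τ ↦ by rw [← hprod, ha], fun z ↦ ?_⟩
  have h' := congrArg (PowerSeries.map φ) h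
  rw [map_prod, PowerSeries.map_expand, map_homSum, map_toR, map_toR, Fintype.prod_option] at h'
  have hφζ : φ ζ = 1 := map_rootUnity_eq_one hζ φ
  simp only [map_crossSeries, hφζ] at h'
  simp only [crossSeries, heckeSeries_one_none, heckeSeries_one_some,
    expand_toR_eq_pow, prod_const, card_univ, ZMod.card] at h'
  set x := toR k cubeSeries
  set y := toR k discSeries
  have hS : homSum (2 * (p + 1)) (fun i ↦ φ (a i)) x y = -(x * y ^ p - x ^ p * y) ^ 2 := by
    apply _root_.expand_injective hp.out.ne_zero
    have hxe : x.expand p hp.out.ne_zero = x ^ p := expand_toR_eq_pow _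
    have hye : y.expand p hp.out.ne_zero = y ^ p := expand_toR_eq_pow _
    rw [← h', map_neg, map_pow, map_sub, map_mul, map_mul, map_pow (PowerSeries.expand _ _),
      map_pow (PowerSeries.expand _ _), hxe, hye]
    have := charP_of_injective_algebraMap (algebraMap k (PowerSeries k)).injective p
    rw [sub_pow_char, mul_pow, mul_pow]
    ring
  have := sum_eq_of_homSum (2 * (p + 1)) (fun i ↦ φ (a i)) (x := x) (y := y)
    constantCoeff_toR_cubeSeries toR_discSeries_eq (-(X ^ p - X) ^ 2) (by
      rw [natDegree_neg, natDegree_pow]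
      have : (X ^ p - X : k[X]).natDegree ≤ p := by
        compute_degree
        exact max_le le_rfl hp.out.one_lt.le
      omega) (-(x * y ^ p - x ^ p * y) ^ 2) (fun j hj ↦ by
        rw [map_neg, map_pow, map_sub, map_mul, map_mul, map_pow, map_pow, hj]
        simp only [eval₂_neg, eval₂_pow, eval₂_sub, eval₂_X]
        ring) (by rw [hS, sub_self]; exact dvd_zero _) z
  rw [this]
  simp

/-- The series of the factors of the multiplier polynomial of level `p`. -/
def multSeries {R : Type*} [CommRing R] (ζ U : R) (γ : Option (ZMod p)) : PowerSeries R :=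
  PowerSeries.C U * (toR R discSeries).expand p hp.out.ne_zero
    - PowerSeries.C (match γ with | none => (p : R) ^ 12 | some _ => 1)
      * heckeSeries ζ (toR R discSeries) γ

theorem map_multSeries {R S : Type*} [CommRing R] [CommRing S] (ψ : R →+* S) (ζ U : R)
    (γ : Option (ZMod p)) :
    PowerSeries.map ψ (multSeries ζ U γ) = multSeries (ψ ζ) (ψ U) γ := by
  rcases γ with _ | b <;>
  simp only [multSeries, map_sub, map_mul, PowerSeries.map_expand, map_heckeSeries, map_toR,
    PowerSeries.map_C, map_pow, map_natCast, map_one]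

/-- The polynomial of multipliers of level `p`, and its reduction. -/
theorem exists_multiplier_polynomial {k : Type*} [Field k] [CharP k p] (R : Subring ℂ)
    (hζ : rootUnity p ∈ R) (φ : R →+* k) (U : R) (c : ℕ → k)
    (hc : PowerSeries.X ^ p ∣ ∑ i ∈ range p, PowerSeries.C (c i) * toR k cubeSeries ^ i
      * (toR k cubeSeries - 1728 * toR k discSeries) ^ (p - 1 - i) - 1) :
    ∃ a : ℕ → R, (∀ τ : ℍ, ∏ γ, ((U : ℂ) * ModularForm.discriminant τ
        - heckeFun p ModularForm.discriminant γ τ) = ∑ i ∈ range (p + 1 + 1),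
          (a i : ℂ) * (E₄ τ ^ 3) ^ i * ModularForm.discriminant τ ^ (p + 1 - i)) ∧
      ∀ z : k, ∑ i ∈ range (p + 1 + 1), φ (a i) * z ^ i
        = φ U ^ (p + 1) - φ U * ∑ i ∈ range p, c i * z ^ i * (z - 1728) ^ (p - 1 - i) := by
  have hp' : (0 : ℝ) < p := by exact_mod_cast hp.out.pos
  set ζ : R := ⟨rootUnity p, hζ⟩
  have hexp {P : PowerSeries ℂ} (hP : P ∈ convSubring) :=
    (expand_mem_convSubring hP hp.out.ne_zero).1
  obtain ⟨a, ha, h⟩ := exists_coeffs_of_family R 1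
    (fun γ τ ↦ (U : ℂ) * ModularForm.discriminant τ - heckeFun p ModularForm.discriminant γ τ)
    (fun γ τ τ' hτ ↦ by
      rw [heckeFun_T isWeightTwelve_discriminant γ τ τ' hτ,
        isWeightTwelve_discriminant 1 1 0 1 (by ring) τ τ' (by simpa using hτ)]
      simp)
    (fun γ τ τ' hτ ↦ by
      rw [heckeFun_S isWeightTwelve_discriminant γ τ τ' hτ,
        isWeightTwelve_discriminant 0 (-1) 1 0 (by ring) τ τ' (by simpa using hτ)]
      simp only [Int.cast_one, one_mul, Int.cast_zero, add_zero]
      ring)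
    1 (multSeries ζ U)
    (fun γ ↦ by
      rw [map_multSeries]
      exact sub_mem (mul_mem (C_mem_convSubring _) (hexp toC_discSeries_mem))
        (mul_mem (C_mem_convSubring _) (heckeSeries_mem toC_discSeries_mem γ)))
    (fun τ ↦ by
      rw [one_mul]
      refine prod_congr rfl fun γ _ ↦ ?_
      have hq := norm_qParam_lt hp' τ
      rw [map_multSeries]
      change _ = evalSeries _ (PowerSeries.C (U : ℂ) * (toC discSeries).expand p _
        - PowerSeries.C _ * heckeSeries (rootUnity p) (toC discSeries) γ)
      rw [evalSeries_sub hq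
        (mul_mem (C_mem_convSubring _) (hexp toC_discSeries_mem))
        (mul_mem (C_mem_convSubring _) (heckeSeries_mem toC_discSeries_mem γ)),
        evalSeries_mul hq (C_mem_convSubring _) (hexp toC_discSeries_mem),
        evalSeries_mul hq (C_mem_convSubring _) (heckeSeries_mem toC_discSeries_mem γ),
        evalSeries_expand toC_discSeries_mem discriminant_eq_evalSeries,
        evalSeries_heckeSeries toC_discSeries_mem discriminant_eq_evalSeries,
        evalSeries_C, evalSeries_C]
      rcases γ with _ | b <;> rfl)
  rw [one_mul] at h
  refine ⟨a, fun τ ↦ by simpa using ha τ, fun z ↦ ?_⟩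
  have h' := congrArg (PowerSeries.map φ) h
  rw [map_prod, PowerSeries.map_expand, map_homSum, map_toR, map_toR, Fintype.prod_option] at h'
  set x := toR k cubeSeries
  have hφζ : φ ζ = 1 := map_rootUnity_eq_one hζ φ
  simp only [map_multSeries, hφζ] at h'
  simp only [multSeries, heckeSeries_one_none, heckeSeries_one_some,
    expand_toR_eq_pow, prod_const, card_univ, ZMod.card, CharP.cast_eq_zero, map_zero, map_one,
    zero_pow (show 12 ≠ 0 by norm_num), zero_mul, sub_zero, one_mul] at h'
  set y := toR k discSeries
  set u := φ U
  have hS : homSum (p + 1) (fun i ↦ φ (a i)) x y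
      = PowerSeries.C u ^ (p + 1) * y ^ (p + 1) - PowerSeries.C u * y ^ 2 := by
    apply _root_.expand_injective hp.out.ne_zero
    have hye : y.expand p hp.out.ne_zero = y ^ p := expand_toR_eq_pow _
    rw [← h', map_sub, map_mul, map_mul, map_pow, map_pow (PowerSeries.expand _ _),
      map_pow (PowerSeries.expand _ _), hye, PowerSeries.expand_C]
    have := charP_of_injective_algebraMap (algebraMap k (PowerSeries k)).injective p
    rw [sub_pow_char, mul_pow]
    ring
  set G : k[X] := Polynomial.C (u ^ (p + 1)) - Polynomial.C u
    * ∑ i ∈ range p, Polynomial.C (c i) * X ^ i * (X - Polynomial.C 1728) ^ (p - 1 - i) with hG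
  have hdeg : G.natDegree ≤ p + 1 := by
    refine (natDegree_sub_le_of_le (m := p + 1) (n := p + 1) (by simp)
      ((natDegree_C_mul_le _ _).trans (natDegree_sum_le_of_forall_le _ _ fun i hi ↦ ?_))).trans
      (max_self _).le
    have hip := mem_range.1 hi
    have h1 : (Polynomial.C (c i) * X ^ i : k[X]).natDegree ≤ i := natDegree_C_mul_X_pow_le _ _
    have h2 : ((X - Polynomial.C 1728 : k[X]) ^ (p - 1 - i)).natDegree ≤ (p - 1 - i) * 1 :=
      natDegree_pow_le_of_le _ (natDegree_X_sub_C_le _)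
    exact (natDegree_mul_le_of_le h1 h2).trans (by omega)
  have := sum_eq_of_homSum (p + 1) (fun i ↦ φ (a i)) (x := x) (y := y)
    constantCoeff_toR_cubeSeries toR_discSeries_eq G hdeg
    (PowerSeries.C u ^ (p + 1) * y ^ (p + 1) - PowerSeries.C u * y ^ 2 *
      ∑ i ∈ range p, PowerSeries.C (c i) * x ^ i * (x - 1728 * y) ^ (p - 1 - i)) (fun j hj ↦ by
        set ι := algebraMap (PowerSeries k) (FractionRing (PowerSeries k))
        simp only [hG, map_sub, map_mul, map_pow, map_sum, hj, eval₂_sub, eval₂_mul, eval₂_pow,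
          eval₂_C, eval₂_X, eval₂_finsetSum, RingHom.comp_apply, map_ofNat, eval₂_ofNat]
        rw [mul_sub, mul_sum, mul_sum, mul_sum]
        congr 1
        · ring
        · refine sum_congr rfl fun i hi ↦ ?_
          obtain ⟨m, hm⟩ := Nat.exists_eq_add_of_lt (mem_range.1 hi)
          rw [show p - 1 - i = m by omega, ← sub_mul, mul_pow (j - 1728), show p + 1 = 2 + i + m by omega]
          ring) (by
      rw [hS]
      obtain ⟨v, hv, -⟩ := toR_discSeries_eq (k := k)
      obtain ⟨r, hr⟩ := hc
      refine ⟨PowerSeries.C u * v ^ 2 * r, ?_⟩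
      have hv' : y ^ 2 = PowerSeries.X ^ 2 * v ^ 2 := by rw [← mul_pow, ← hv]
      rw [show p + 1 + 1 = 2 + p by ring, pow_add]
      linear_combination (PowerSeries.C u * y ^ 2) * hr
        + PowerSeries.C u * PowerSeries.X ^ p * r * hv') z
  rw [this]
  simp [hG, eval_finsetSum]

theorem toC_eisSeries_two_mem : toC (eisSeries (-24) 1) ∈ convSubring ∧ ∀ τ : ℍ,
    E2 τ = evalSeries (Function.Periodic.qParam 1 (τ : ℂ)) (toC (eisSeries (-24) 1)) := by
  have key (τ : ℍ) : HasSum (fun m ↦ (toC (eisSeries (-24) 1)).coeff m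
      * Function.Periodic.qParam 1 (τ : ℂ) ^ m) (E2 τ) := by
    convert hasSum_qExpansion_E2 (z := τ) using 2 with m
    rw [PowerSeries.coeff_map, eisSeries, PowerSeries.coeff_mk, smul_eq_mul]
    congr 1
    · split_ifs <;> simp
    · simp [Function.Periodic.qParam]
  refine ⟨mem_convSubring_of_summable fun z hz h0 ↦ ?_, fun τ ↦ (key τ).tsum_eq.symm⟩
  obtain ⟨τ, rfl⟩ := exists_eq_qParam one_pos hz h0
  exact (key τ).summable

theorem E2_S (τ τ' : ℍ) (h : (τ' : ℂ) * τ = -1) :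
    E2 τ' = (τ : ℂ) ^ 2 * E2 τ + 12 / (2 * Real.pi * Complex.I) * τ := by
  have hτ := ne_zero τ
  have hπ : (Real.pi : ℂ) ≠ 0 := by exact_mod_cast Real.pi_ne_zero
  have hS : τ' = ModularGroup.S • τ := by
    ext
    rw [modular_S_smul, UpperHalfPlane.coe_mk]
    field_simp
    linear_combination h
  have h2 := congrFun (E2_slash_action ModularGroup.S) τ
  rw [ModularForm.SL_slash_apply, ← hS, ModularGroup.denom_S] at h2
  simp only [Pi.sub_apply, Pi.smul_apply, D2, ModularGroup.denom_S, riemannZeta_two,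
    smul_eq_mul] at h2
  simp [ModularGroup.S] at h2
  have h3 : E2 τ' = (E2 τ' * ((τ : ℂ) ^ 2)⁻¹) * (τ : ℂ) ^ 2 := by field_simp
  rw [h3, h2]
  field_simp
  ring_nf
  simp
  ring

theorem hasDerivAt_evalSeries_qParam {P : PowerSeries ℂ} (hP : P ∈ convSubring) (τ : ℍ) :
    HasDerivAt (fun z : ℂ ↦ evalSeries (Function.Periodic.qParam 1 z) P)
      (2 * Real.pi * Complex.I * evalSeries (Function.Periodic.qParam 1 (τ : ℂ)) (qDer ℂ P)) τ := by
  have hq := norm_qParam_lt one_pos τ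
  have h1 := (differentiableAt_evalSeries hP hq).hasDerivAt
  have h2 : HasDerivAt (Function.Periodic.qParam 1) (2 * Real.pi * Complex.I
      * Function.Periodic.qParam 1 (τ : ℂ)) (τ : ℂ) := by
    have := ((hasDerivAt_id (τ : ℂ)).const_mul (2 * Real.pi * Complex.I)).cexp
    have hq1 : Function.Periodic.qParam 1 = fun z ↦ Complex.exp (2 * Real.pi * Complex.I * z) := by
      ext z
      simp [Function.Periodic.qParam]
    rw [hq1]
    exact this.congr_deriv (by simp only [id, mul_one]; ring)
  rw [(qDer_mem_convSubring hP).2 _ hq]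
  exact (h1.comp (τ : ℂ) h2).congr_deriv (by ring)

theorem qDer_S {P : PowerSeries ℂ} (hP : P ∈ convSubring) {F : ℍ → ℂ}
    (hF : ∀ τ : ℍ, F τ = evalSeries (Function.Periodic.qParam 1 (τ : ℂ)) P) (k : ℕ) (c : ℂ)
    (h : ∀ τ τ' : ℍ, (τ' : ℂ) * τ = -1 → F τ' = (τ : ℂ) ^ k * F τ + c * τ)
    (τ τ' : ℍ) (hτ : (τ' : ℂ) * τ = -1) :
    2 * Real.pi * Complex.I * evalSeries (Function.Periodic.qParam 1 (τ' : ℂ)) (qDer ℂ P)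
      = (τ : ℂ) ^ 2 * (k * (τ : ℂ) ^ (k - 1) * F τ + (τ : ℂ) ^ k * (2 * Real.pi * Complex.I
        * evalSeries (Function.Periodic.qParam 1 (τ : ℂ)) (qDer ℂ P)) + c) := by
  have h0 := ne_zero τ
  set f : ℂ → ℂ := fun z ↦ evalSeries (Function.Periodic.qParam 1 z) P with hf
  have hτ' : (τ' : ℂ) = -(τ : ℂ)⁻¹ := by field_simp; linear_combination hτ
  have hev : (fun z : ℂ ↦ f (-z⁻¹)) =ᶠ[nhds (τ : ℂ)] fun z ↦ z ^ k * f z + c * z := by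
    filter_upwards [(isOpen_lt continuous_const Complex.continuous_im).mem_nhds τ.im_pos]
      with z (hz : 0 < z.im)
    have hz0 : z ≠ 0 := by rintro rfl; simp at hz
    have him : 0 < (-z⁻¹).im := by
      rw [Complex.neg_im, Complex.inv_im, neg_div, neg_neg]
      exact div_pos hz (Complex.normSq_pos.2 hz0)
    have := h ⟨z, hz⟩ ⟨-z⁻¹, him⟩ (by
      change -z⁻¹ * z = -1
      field_simp)
    rwa [hF, hF] at this
  have h1 : HasDerivAt (fun z : ℂ ↦ f (-z⁻¹)) _ (τ : ℂ) :=
    HasDerivAt.comp (τ : ℂ) (h₂ := f) (by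
      rw [← hτ']; exact hasDerivAt_evalSeries_qParam hP τ') (hasDerivAt_inv h0).neg
  have h2 := ((hasDerivAt_pow k (τ : ℂ)).mul (hasDerivAt_evalSeries_qParam hP τ)).add
    ((hasDerivAt_id (τ : ℂ)).const_mul c)
  have h3 := (h1.congr_of_eventuallyEq hev.symm).unique h2
  rw [mul_one, ← hF] at h3
  rw [← h3]
  field_simp

theorem eq_zero_of_weight_lt_twelve {k : ℕ} (hk : k < 12) {P : PowerSeries ℂ}
    (hP : P ∈ convSubring) (h0 : PowerSeries.constantCoeff P = 0)
    (hS : ∀ τ τ' : ℍ, (τ' : ℂ) * τ = -1 → evalSeries (Function.Periodic.qParam 1 (τ' : ℂ)) P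
      = (τ : ℂ) ^ k * evalSeries (Function.Periodic.qParam 1 (τ : ℂ)) P) : P = 0 := by
  obtain ⟨f, hf⟩ := exists_modularForm (k : ℤ) one_pos hP
    (F := fun τ ↦ evalSeries (Function.Periodic.qParam 1 (τ : ℂ)) P) (fun _ ↦ rfl)
    (fun τ τ' h ↦ by
      rw [h]
      have : Function.Periodic.qParam 1 ((τ : ℂ) + 1) = Function.Periodic.qParam 1 (τ : ℂ) := by
        simp [Function.Periodic.qParam, mul_add, Complex.exp_add]
      rw [this]) (fun τ τ' h ↦ by rw [hS τ τ' h, zpow_natCast])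
  have hq := qExpansion_eq_of_evalSeries f hP hf
  have hf0 : f = 0 := by
    refine ModularForm.sturm_bound_levelOne_nat ?_
    rw [hq, Nat.div_eq_of_lt hk]
    refine lt_of_lt_of_le zero_lt_one (PowerSeries.le_order _ _ fun i hi ↦ ?_)
    obtain rfl : i = 0 := by simpa using hi
    simpa using h0
  rw [← hq, hf0]
  exact qExpansion_zero ..

theorem modularForm_apply_S {k : ℕ} (f : ModularForm 𝒮ℒ k) (τ τ' : ℍ)
    (h : (τ' : ℂ) * τ = -1) : f τ' = (τ : ℂ) ^ k * f τ + 0 * τ := by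
  have := modularForm_apply_smul f 0 (-1) 1 0 (by norm_num) τ τ' (by simpa using h)
  simpa using this

theorem map_qDer {R S : Type*} [CommRing R] [CommRing S] (φ : R →+* S) (P : PowerSeries R) :
    PowerSeries.map φ (qDer R P) = qDer S (PowerSeries.map φ P) := by
  ext n
  simp [coeff_qDer]

theorem toC_injective : Function.Injective toC := fun P Q h ↦ by
  ext n
  have := congrArg (PowerSeries.coeff n) h
  simpa using this

theorem constantCoeff_toC_eisSeries (c : ℤ) (k : ℕ) :
    PowerSeries.constantCoeff (toC (eisSeries c k)) = 1 := by
  rw [← PowerSeries.coeff_zero_eq_constantCoeff_apply]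
  simp [eisSeries]

theorem constantCoeff_qDer {R : Type*} [CommRing R] (P : PowerSeries R) :
    PowerSeries.constantCoeff (qDer R P) = 0 := by
  rw [← PowerSeries.coeff_zero_eq_constantCoeff_apply, coeff_qDer]
  simp

theorem ramanujan_complex :
    PowerSeries.C 3 * qDer ℂ (toC (eisSeries 240 3)) - (toC (eisSeries (-24) 1)
      * toC (eisSeries 240 3) - toC (eisSeries (-504) 5)) = 0 ∧
    PowerSeries.C 2 * qDer ℂ (toC (eisSeries (-504) 5)) - (toC (eisSeries (-24) 1)
      * toC (eisSeries (-504) 5) - toC (eisSeries 240 3) * toC (eisSeries 240 3)) = 0 ∧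
    PowerSeries.C 12 * qDer ℂ (toC (eisSeries (-24) 1)) - (toC (eisSeries (-24) 1)
      * toC (eisSeries (-24) 1) - toC (eisSeries 240 3)) = 0 := by
  have m2 := toC_eisSeries_two_mem.1
  have m4 := toC_eisSeries_four_mem
  have m6 := toC_eisSeries_six_mem
  have d2 := (qDer_mem_convSubring m2).1
  have d4 := (qDer_mem_convSubring m4).1
  have d6 := (qDer_mem_convSubring m6).1
  have c2 := constantCoeff_toC_eisSeries (-24) 1
  have c4 := constantCoeff_toC_eisSeries 240 3
  have c6 := constantCoeff_toC_eisSeries (-504) 5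
  have S2 := qDer_S m2 toC_eisSeries_two_mem.2 2 _ E2_S
  have S4 := qDer_S m4 E₄_eq_evalSeries 4 0 (modularForm_apply_S (k := 4) E₄)
  have S6 := qDer_S m6 E₆_eq_evalSeries 6 0 (modularForm_apply_S (k := 6) E₆)
  have V2 := E2_S
  have V4 (τ τ' : ℍ) (h : (τ' : ℂ) * τ = -1) :
      evalSeries (Function.Periodic.qParam 1 (τ' : ℂ)) (toC (eisSeries 240 3))
        = (τ : ℂ) ^ 4 * evalSeries (Function.Periodic.qParam 1 (τ : ℂ)) (toC (eisSeries 240 3)) := by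
    rw [← E₄_eq_evalSeries, ← E₄_eq_evalSeries]
    exact (modularForm_apply_S (k := 4) E₄ τ τ' h).trans (by rw [zero_mul, add_zero])
  have V6 (τ τ' : ℍ) (h : (τ' : ℂ) * τ = -1) :
      evalSeries (Function.Periodic.qParam 1 (τ' : ℂ)) (toC (eisSeries (-504) 5))
        = (τ : ℂ) ^ 6 * evalSeries (Function.Periodic.qParam 1 (τ : ℂ)) (toC (eisSeries (-504) 5)) := by
    rw [← E₆_eq_evalSeries, ← E₆_eq_evalSeries]
    exact (modularForm_apply_S (k := 6) E₆ τ τ' h).trans (by rw [zero_mul, add_zero])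
  simp only [toC_eisSeries_two_mem.2] at V2 S2
  simp only [E₄_eq_evalSeries] at S4
  simp only [E₆_eq_evalSeries] at S6
  have hπ : (Real.pi : ℂ) ≠ 0 := by exact_mod_cast Real.pi_ne_zero
  have hI := Complex.I_ne_zero
  set w : ℂ := 2 * Real.pi * Complex.I with hw
  have hw0 : w ≠ 0 := by simp [hw, hπ]
  generalize toC (eisSeries 240 3) = e4 at *
  generalize toC (eisSeries (-504) 5) = e6 at *
  generalize toC (eisSeries (-24) 1) = e2 at *
  have key (k : ℕ) (hk : k < 12) (a : ℂ) (θ x y z : PowerSeries ℂ) (hθ : θ ∈ convSubring)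
      (hx : x ∈ convSubring) (hy : y ∈ convSubring) (hz : z ∈ convSubring)
      (cθ : PowerSeries.constantCoeff θ = 0) (cx : PowerSeries.constantCoeff x = 1)
      (cy : PowerSeries.constantCoeff y = 1) (cz : PowerSeries.constantCoeff z = 1)
      (h : ∀ τ τ' : ℍ, (τ' : ℂ) * τ = -1 →
        a * evalSeries (Function.Periodic.qParam 1 (τ' : ℂ)) θ
          - (evalSeries (Function.Periodic.qParam 1 (τ' : ℂ)) x
            * evalSeries (Function.Periodic.qParam 1 (τ' : ℂ)) y
            - evalSeries (Function.Periodic.qParam 1 (τ' : ℂ)) z)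
        = (τ : ℂ) ^ k * (a * evalSeries (Function.Periodic.qParam 1 (τ : ℂ)) θ
          - (evalSeries (Function.Periodic.qParam 1 (τ : ℂ)) x
            * evalSeries (Function.Periodic.qParam 1 (τ : ℂ)) y
            - evalSeries (Function.Periodic.qParam 1 (τ : ℂ)) z))) :
      PowerSeries.C a * θ - (x * y - z) = 0 := by
    have hC := C_mem_convSubring a
    refine eq_zero_of_weight_lt_twelve hk (sub_mem (mul_mem hC hθ) (sub_mem (mul_mem hx hy) hz))
      (by simp [cθ, cx, cy, cz]) fun τ τ' hτ ↦ ?_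
    have ev (τ : ℍ) := norm_qParam_lt one_pos τ
    simp only [evalSeries_sub (ev _) (mul_mem hC hθ) (sub_mem (mul_mem hx hy) hz),
      evalSeries_sub (ev _) (mul_mem hx hy) hz, evalSeries_mul (ev _) hC hθ,
      evalSeries_mul (ev _) hx hy, evalSeries_C]
    exact h τ τ' hτ
  refine ⟨key 6 (by norm_num) 3 _ _ _ _ d4 m2 m4 m6 (constantCoeff_qDer _) c2 c4 c6 ?_,
    key 8 (by norm_num) 2 _ e2 e6 (e4 * e4) d6 m2 m6 (mul_mem m4 m4) (constantCoeff_qDer _) c2 c6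
      (by simp [c4]) ?_,
    key 4 (by norm_num) 12 _ e2 e2 _ d2 m2 m2 m4 (constantCoeff_qDer _) c2 c2 c4 ?_⟩ <;>
  intro τ τ' h
  · have s4 := S4 τ τ' h
    rw [V2 τ τ' h, V4 τ τ' h, V6 τ τ' h]
    refine mul_left_cancel₀ hw0 ?_
    norm_num at s4
    field_simp
    linear_combination 3 * s4
  · have s6 := S6 τ τ' h
    have ev (τ : ℍ) := norm_qParam_lt one_pos τ
    rw [evalSeries_mul (ev _) m4 m4, evalSeries_mul (ev _) m4 m4,
      V2 τ τ' h, V4 τ τ' h, V6 τ τ' h]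
    refine mul_left_cancel₀ hw0 ?_
    norm_num at s6
    field_simp
    linear_combination 2 * s6
  · have s2 := S2 τ τ' h
    rw [V2 τ τ' h, V4 τ τ' h]
    refine mul_left_cancel₀ (pow_ne_zero 2 hw0) ?_
    norm_num at s2
    field_simp at s2 ⊢
    linear_combination 12 * s2

theorem exists_hasse_coeffs {k : Type*} [Field k] [CharP k p] (h5 : 5 ≤ p) :
    ∃ c : ℕ → k, (PowerSeries.X ^ p ∣ ∑ i ∈ range p, PowerSeries.C (c i) * toR k cubeSeries ^ i
      * (toR k cubeSeries - 1728 * toR k discSeries) ^ (p - 1 - i) - 1) ∧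
      ∀ x y : k, hasse p x y ^ 12 = ∑ i ∈ range p, c i * (x ^ 3) ^ i * (y ^ 2) ^ (p - 1 - i) := by
  have hodd : p % 2 = 1 := hp.out.eq_two_or_odd.resolve_left (by omega)
  obtain ⟨c, hc⟩ := exists_hasse_form (K := k) p hodd
  refine ⟨c, ?_, fun x y ↦ hc k x y⟩
  have descend (a : ℕ) (θ x y : PowerSeries ℤ)
      (h : PowerSeries.C (a : ℂ) * qDer ℂ (toC θ) - (toC x - toC y) = 0) :
      (a : PowerSeries k) * qDer k (toR k θ) = toR k x - toR k y := by
    have h1 : (a : PowerSeries ℤ) * qDer ℤ θ = x - y := toC_injective (by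
      rw [map_mul, map_natCast, map_qDer, map_sub, ← sub_eq_zero, ← h, map_natCast])
    have := congrArg (toR k) h1
    rwa [map_mul, map_natCast, map_qDer, map_sub] at this
  obtain ⟨h4, h6, h2⟩ := ramanujan_complex
  rw [← map_mul] at h4
  rw [← map_mul, ← map_mul] at h6
  rw [← map_mul] at h2
  have h4' := descend 3 _ _ _ (by exact_mod_cast h4)
  have h6' := descend 2 _ _ _ (by exact_mod_cast h6)
  have h2' := descend 12 _ _ _ (by exact_mod_cast h2)
  rw [map_mul] at h4' h2'
  rw [map_mul, map_mul] at h6'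
  obtain ⟨r, hr⟩ := exists_hasse_pow_eq (K := k) h5 (e2 := toR k (eisSeries (-24) 1))
    (e4 := toR k (eisSeries 240 3)) (e6 := toR k (eisSeries (-504) 5)) (by exact_mod_cast h4')
    (by rw [sq]; exact_mod_cast h6') (by rw [sq]; exact_mod_cast h2')
    (by rw [← PowerSeries.coeff_zero_eq_constantCoeff_apply]; simp [eisSeries])
    (by rw [← PowerSeries.coeff_zero_eq_constantCoeff_apply]; simp [eisSeries])
  rw [hc] at hr
  have hcube : toR k (eisSeries 240 3) ^ 3 = toR k cubeSeries := (map_pow ..).symm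
  have hdisc : toR k (eisSeries (-504) 5) ^ 2 = toR k cubeSeries - 1728 * toR k discSeries := by
    have := congrArg (toR k) discSeries_spec
    rw [map_mul, map_sub, map_ofNat, map_pow _ (eisSeries (-504) 5)] at this
    rw [this]
    ring
  rw [hcube, hdisc] at hr
  exact ⟨r, sub_eq_iff_eq_add'.2 hr⟩

namespace PeriodPair

theorem weierstrassPExcept_zero_eventuallyEq (L M : PeriodPair) (h₂ : L.g₂ = M.g₂)
    (h₃ : L.g₃ = M.g₃) : ∀ᶠ z in nhds (0 : ℂ), L.weierstrassPExcept 0 z - M.weierstrassPExcept 0 z = 0 := by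
  have hn (L : PeriodPair) : ∀ᶠ z in nhds (0 : ℂ), z ∈ ((L.lattice : Set ℂ) \ {0})ᶜ :=
    L.compl_lattice_sdiff_singleton_mem_nhds 0
  have hder (L : PeriodPair) : ∀ᶠ z in nhds (0 : ℂ),
      HasDerivAt (L.weierstrassPExcept 0) (L.derivWeierstrassPExcept 0 z) z := by
    filter_upwards [hn L] with z hz
    rw [← L.eqOn_deriv_weierstrassPExcept_derivWeierstrassPExcept 0 hz]
    exact ((L.analyticOnNhd_weierstrassPExcept 0) z hz).differentiableAt.hasDerivAt
  by_contra hD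
  have hA : AnalyticAt ℂ (fun z ↦ L.weierstrassPExcept 0 z - M.weierstrassPExcept 0 z) 0 :=
    (L.analyticAt_weierstrassPExcept 0).sub (M.analyticAt_weierstrassPExcept 0)
  obtain ⟨n, g, hg, hg0, hDg⟩ := hA.exists_eventuallyEq_pow_smul_nonzero_iff.2 hD
  have hlim : ∀ᶠ z in nhdsWithin (0 : ℂ) {0}ᶜ, (n * g z + z * deriv g z)
      * (z ^ 3 * (L.derivWeierstrassPExcept 0 z + M.derivWeierstrassPExcept 0 z) - 4)
      = g z * (4 * ((z ^ 2 * L.weierstrassPExcept 0 z + 1) ^ 2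
        + (z ^ 2 * L.weierstrassPExcept 0 z + 1) * (z ^ 2 * M.weierstrassPExcept 0 z + 1)
        + (z ^ 2 * M.weierstrassPExcept 0 z + 1) ^ 2) - L.g₂ * z ^ 4) := by
    filter_upwards [(hn L).filter_mono nhdsWithin_le_nhds, (hn M).filter_mono nhdsWithin_le_nhds,
      (hder L).filter_mono nhdsWithin_le_nhds, (hder M).filter_mono nhdsWithin_le_nhds,
      hDg.eventually_nhds.filter_mono nhdsWithin_le_nhds,
      hg.eventually_analyticAt.filter_mono nhdsWithin_le_nhds, self_mem_nhdsWithin]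
      with z hzL hzM hdL hdM hz hgz (hz0 : z ≠ 0)
    have hL : z ∉ L.lattice := fun h ↦ hzL ⟨h, hz0⟩
    have hM : z ∉ M.lattice := fun h ↦ hzM ⟨h, hz0⟩
    have e1 := L.derivWeierstrassP_sq z hL
    have e2 := M.derivWeierstrassP_sq z hM
    have l1 := L.weierstrassPExcept_add 0 z
    have l2 := M.weierstrassPExcept_add 0 z
    have l3 := L.derivWeierstrassPExcept_sub 0 z
    have l4 := M.derivWeierstrassPExcept_sub 0 z
    simp only [ZeroMemClass.coe_zero, sub_zero] at l1 l2 l3 l4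
    rw [← l1, ← l3] at e1
    rw [← l2, ← l4, ← h₂, ← h₃] at e2
    have hd1 := (hdL.sub hdM).congr_of_eventuallyEq
      (f₁ := fun z ↦ (z - 0) ^ n • g z) (hz.mono fun y hy ↦ hy.symm)
    have hd2 := (((hasDerivAt_id z).sub_const 0).pow n).smul hgz.differentiableAt.hasDerivAt
    have hd := hd1.unique hd2
    have hv := hz.self_of_nhds
    simp only [id, sub_zero, smul_eq_mul, mul_one, Pi.pow_apply] at hd hv
    have hzn : z * (z ^ (n - 1) * n) = n * z ^ n := by
      rcases n with _ | n
      · simp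
      · rw [Nat.add_sub_cancel, pow_succ]; ring
    generalize L.weierstrassPExcept 0 z = a at *
    generalize M.weierstrassPExcept 0 z = b at *
    generalize L.derivWeierstrassPExcept 0 z = a' at *
    generalize M.derivWeierstrassPExcept 0 z = b' at *
    refine mul_left_cancel₀ (pow_ne_zero n hz0) ?_
    have h1 : z * (a' - b') * (z ^ 3 * (a' + b') - 4)
        = (a - b) * (4 * ((z ^ 2 * a + 1) ^ 2 + (z ^ 2 * a + 1) * (z ^ 2 * b + 1)
          + (z ^ 2 * b + 1) ^ 2) - L.g₂ * z ^ 4) := by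
      have r1 : z * (a' - b') * (z ^ 3 * (a' + b') - 4)
          = z ^ 4 * ((a' - 2 / z ^ 3) ^ 2 - (b' - 2 / z ^ 3) ^ 2) := by
        field_simp
        ring
      rw [r1, e1, e2]
      field_simp
      ring
    have h2 : z ^ n * (n * g z + z * deriv g z) = z * (a' - b') := by
      linear_combination (-z) * hd - hzn * g z
    rw [← mul_assoc, h2, h1, hv]
    ring
  have hc : ∀ L : PeriodPair, ContinuousAt (L.weierstrassPExcept 0) 0 ∧
      ContinuousAt (L.derivWeierstrassPExcept 0) 0 := fun L ↦
    ⟨(L.analyticAt_weierstrassPExcept 0).continuousAt,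
      (L.analyticAt_derivWeierstrassPExcept 0).continuousAt⟩
  obtain ⟨cL, cL'⟩ := hc L
  obtain ⟨cM, cM'⟩ := hc M
  have cg := hg.continuousAt
  have cg' := hg.deriv.continuousAt
  have hid : ContinuousAt (fun z : ℂ ↦ z) 0 := continuousAt_id
  have := (ContinuousAt.eventuallyEq_nhds_iff_eventuallyEq_nhdsNE (by fun_prop)
    (by fun_prop)).1 hlim
  have h0 := this.self_of_nhds
  simp at h0
  have h4 : ((n : ℂ) + 3) * g 0 = 0 := by linear_combination (-1 / 4 : ℂ) * h0
  rcases mul_eq_zero.1 h4 with h | h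
  · have : ((n + 3 : ℕ) : ℂ) = 0 := by exact_mod_cast h
    exact absurd (Nat.cast_eq_zero.1 this) (by omega)
  · exact hg0 h

theorem lattice_le_of_g_eq (L M : PeriodPair) (h₂ : L.g₂ = M.g₂) (h₃ : L.g₃ = M.g₃) :
    L.lattice ≤ M.lattice := by
  intro l hl
  by_contra hM
  set U : Set ℂ := (L.lattice ∪ M.lattice : Set ℂ)ᶜ with hU
  have hcount : (L.lattice ∪ M.lattice : Set ℂ).Countable := by
    have h (L : PeriodPair) : (L.lattice : Set ℂ).Countable :=
      Set.countable_coe_iff.1 (Countable.of_equiv _ L.latticeEquivProd.symm.toEquiv)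
    exact (h L).union (h M)
  have hconn : IsPreconnected U :=
    (hcount.isConnected_compl_of_one_lt_rank (by simp)).isPreconnected
  have hLU : AnalyticOnNhd ℂ L.weierstrassP U :=
    L.analyticOnNhd_weierstrassP.mono fun z hz h ↦ hz (Or.inl h)
  have hMU : AnalyticOnNhd ℂ M.weierstrassP U :=
    M.analyticOnNhd_weierstrassP.mono fun z hz h ↦ hz (Or.inr h)
  have hP (x : ℂ) (L : PeriodPair) : ∀ᶠ z in nhdsWithin x {x}ᶜ, z ∉ L.lattice := by
    filter_upwards [nhdsWithin_le_nhds (L.compl_lattice_sdiff_singleton_mem_nhds x),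
      self_mem_nhdsWithin] with z hz h0 h
    exact hz ⟨h, h0⟩
  have hpunct (x : ℂ) : ∀ᶠ z in nhdsWithin x {x}ᶜ, z ∈ U := by
    filter_upwards [hP x L, hP x M] with z h1 h2 h
    exact h.elim h1 h2
  have h0 : ∀ᶠ z in nhdsWithin (0 : ℂ) {0}ᶜ, L.weierstrassP z = M.weierstrassP z := by
    filter_upwards [(L.weierstrassPExcept_zero_eventuallyEq M h₂ h₃).filter_mono
      nhdsWithin_le_nhds] with z hz
    have l1 := L.weierstrassPExcept_add 0 z
    have l2 := M.weierstrassPExcept_add 0 z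
    simp only [ZeroMemClass.coe_zero] at l1 l2
    rw [← l1, ← l2, sub_eq_zero.1 hz]
  obtain ⟨z₀, hz₀, hz₀U⟩ :=
    ((eventually_nhdsNE_eventually_nhds_iff.2 h0).and (hpunct 0)).exists
  have hEq := hLU.eqOn_of_preconnected_of_eventuallyEq hMU hconn hz₀U hz₀
  have hord := meromorphicOrderAt_congr (x := l) ((hpunct l).mono fun z hz ↦ hEq hz)
  rw [L.order_weierstrassP l hl] at hord
  have := (M.analyticOnNhd_weierstrassP l hM).meromorphicOrderAt_nonneg
  rw [← hord] at this
  exact absurd this (by decide)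

end PeriodPair

/-- The period pair `(l * τ, l)`. -/
def scaledPair (l : ℂ) (hl : l ≠ 0) (τ : ℍ) : PeriodPair where
  ω₁ := l * τ
  ω₂ := l
  indep := by
    rw [LinearIndependent.pair_iff]
    intro s t h
    have h1 : (s : ℂ) * τ + t = 0 := by
      refine mul_left_cancel₀ hl ?_
      simp only [Complex.real_smul] at h
      linear_combination h
    have h2 := congrArg Complex.im h1
    have h3 := congrArg Complex.re h1
    simp only [Complex.add_im, Complex.im_ofReal_mul, Complex.ofReal_im, add_zero,
      Complex.zero_im, mul_eq_zero] at h2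
    have hs : s = 0 := h2.resolve_right τ.im_pos.ne'
    exact ⟨hs, by simpa [hs] using h3⟩

theorem G_scaledPair (l : ℂ) (hl : l ≠ 0) (τ : ℍ) {k : ℕ} (hk : 3 ≤ k) :
    (scaledPair l hl τ).G k = (l ^ k)⁻¹ * (2 * riemannZeta k * ModularForm.E hk τ) := by
  have hE : ModularForm.E hk τ = (1 / 2 : ℂ) * eisensteinSeries (N := 1) 0 k τ := rfl
  rw [hE, show (2 : ℂ) * riemannZeta k * (1 / 2 * eisensteinSeries (N := 1) 0 k τ)
    = riemannZeta k * eisensteinSeries (N := 1) 0 k τ by ring,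
    ← tsum_eisSummand_eq_riemannZeta_mul_eisensteinSeries hk τ, ← tsum_mul_left, PeriodPair.G,
    ← (scaledPair l hl τ).latticeEquivProd.symm.toEquiv.tsum_eq,
    ← (finTwoArrowEquiv ℤ).tsum_eq]
  congr 1
  ext v
  have := (scaledPair l hl τ).latticeEquiv_symm_apply (finTwoArrowEquiv ℤ v)
  rw [eisSummand, zpow_neg, zpow_natCast, ← mul_inv, ← mul_pow]
  congr 2
  refine this.trans ?_
  simp [scaledPair]
  ring

theorem int_mul_add_eq_zero (τ : ℍ) {m n : ℤ} (h : (m : ℂ) * τ + n = 0) : m = 0 ∧ n = 0 := by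
  have h1 := congrArg Complex.im h
  simp only [Complex.add_im, Complex.mul_im, Complex.intCast_re, Complex.intCast_im, zero_mul,
    add_zero, Complex.zero_im, mul_eq_zero, Int.cast_eq_zero] at h1
  have hm : m = 0 := h1.resolve_right τ.im_pos.ne'
  exact ⟨hm, by simpa [hm] using h⟩

/-- Points of the upper half plane with the same `j`-invariant are equivalent under `SL(2, ℤ)`. -/
theorem exists_smul_of_j_eq (τ τ' : ℍ)
    (h : E₄ τ ^ 3 * ModularForm.discriminant τ' = E₄ τ' ^ 3 * ModularForm.discriminant τ) :
    ∃ a b c d : ℤ, a * d - b * c = 1 ∧ (τ' : ℂ) * (c * τ + d) = a * τ + b := by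
  have hD := ModularForm.discriminant_eq_E₄_cube_sub_E₆_sq τ
  have hD' := ModularForm.discriminant_eq_E₄_cube_sub_E₆_sq τ'
  have h0 := ModularForm.discriminant_ne_zero τ
  have h0' := ModularForm.discriminant_ne_zero τ'
  rw [hD] at h0
  rw [hD'] at h0'
  rw [hD, hD'] at h
  have hroot (n : ℕ) (hn : n ≠ 0) (c : ℂ) : ∃ l, l ^ n = c :=
    (IsAlgClosed.exists_pow_nat_eq c (Nat.pos_of_ne_zero hn)).imp fun _ h ↦ h
  obtain ⟨l, hl, h4, h6⟩ : ∃ l : ℂ, l ≠ 0 ∧ l ^ 4 * E₄ τ = E₄ τ' ∧ l ^ 6 * E₆ τ = E₆ τ' := by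
    generalize E₄ τ = x at *
    generalize E₄ τ' = x' at *
    generalize E₆ τ = y at *
    generalize E₆ τ' = y' at *
    have hxy : x ^ 3 * y' ^ 2 = x' ^ 3 * y ^ 2 := by linear_combination -1728 * h
    have hne : x ^ 3 - y ^ 2 ≠ 0 := fun e ↦ h0 (by rw [e]; simp)
    have hne' : x' ^ 3 - y' ^ 2 ≠ 0 := fun e ↦ h0' (by rw [e]; simp)
    by_cases hx : x = 0
    · have hy : y ≠ 0 := by rintro rfl; simp [hx] at hne
      have hx' : x' = 0 := by simpa [hx, hy] using hxy
      have hy' : y' ≠ 0 := by rintro rfl; simp [hx'] at hne'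
      obtain ⟨l, hl⟩ := hroot 6 (by norm_num) (y' / y)
      have : l ≠ 0 := by
        rintro rfl
        simp [hy, hy', eq_comm] at hl
      exact ⟨l, this, by simp [hx, hx'], by rw [hl]; field_simp⟩
    by_cases hy : y = 0
    · have hy' : y' = 0 := by simpa [hx, hy] using hxy
      have hx' : x' ≠ 0 := by rintro rfl; simp [hy'] at hne'
      obtain ⟨l, hl⟩ := hroot 4 (by norm_num) (x' / x)
      have : l ≠ 0 := by
        rintro rfl
        simp [hx, hx', eq_comm] at hl
      exact ⟨l, this, by rw [hl]; field_simp, by simp [hy, hy']⟩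
    have hx' : x' ≠ 0 := by
      rintro rfl
      have : y' = 0 := by simpa [hx] using hxy
      simp [this] at hne'
    have hy' : y' ≠ 0 := by
      rintro rfl
      simp [hx', hy] at hxy
    obtain ⟨l, hl⟩ := hroot 2 (by norm_num) (y' * x / (x' * y))
    have : l ≠ 0 := by
      rintro rfl
      simp [hx, hx', hy, hy', eq_comm] at hl
    have e4 : l ^ 4 = x' / x := by
      rw [show l ^ 4 = (l ^ 2) ^ 2 by ring, hl]
      field_simp
      linear_combination hxy
    refine ⟨l, this, by rw [e4]; field_simp, ?_⟩
    rw [show l ^ 6 = l ^ 4 * l ^ 2 by ring, hl, e4]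
    field_simp
  have hl' := inv_ne_zero hl
  have e4 : (scaledPair l⁻¹ hl' τ).G 4 = (scaledPair 1 one_ne_zero τ').G 4 := by
    rw [G_scaledPair _ _ _ (by norm_num : 3 ≤ 4), G_scaledPair _ _ _ (by norm_num : 3 ≤ 4), ← h4]
    field_simp
  have e6 : (scaledPair l⁻¹ hl' τ).G 6 = (scaledPair 1 one_ne_zero τ').G 6 := by
    rw [G_scaledPair _ _ _ (by norm_num : 3 ≤ 6), G_scaledPair _ _ _ (by norm_num : 3 ≤ 6), ← h6]
    field_simp
  have g2 : (scaledPair l⁻¹ hl' τ).g₂ = (scaledPair 1 one_ne_zero τ').g₂ := by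
    rw [PeriodPair.g₂, PeriodPair.g₂, e4]
  have g3 : (scaledPair l⁻¹ hl' τ).g₃ = (scaledPair 1 one_ne_zero τ').g₃ := by
    rw [PeriodPair.g₃, PeriodPair.g₃, e6]
  have hle := PeriodPair.lattice_le_of_g_eq _ _ g2 g3
  have hle' := PeriodPair.lattice_le_of_g_eq _ _ g2.symm g3.symm
  obtain ⟨a, b, hab⟩ := PeriodPair.mem_lattice.1 (hle' (scaledPair 1 one_ne_zero τ').ω₁_mem_lattice)
  obtain ⟨c, d, hcd⟩ := PeriodPair.mem_lattice.1 (hle' (scaledPair 1 one_ne_zero τ').ω₂_mem_lattice)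
  obtain ⟨a', b', hab'⟩ := PeriodPair.mem_lattice.1 (hle (scaledPair l⁻¹ hl' τ).ω₁_mem_lattice)
  obtain ⟨c', d', hcd'⟩ := PeriodPair.mem_lattice.1 (hle (scaledPair l⁻¹ hl' τ).ω₂_mem_lattice)
  simp only [scaledPair, one_mul, mul_one] at hab hcd hab' hcd'
  have hmul : (τ' : ℂ) * (c * τ + d) = a * τ + b := by
    rw [← hab]
    linear_combination (a * τ + b) * hcd
  refine ⟨a, b, c, d, ?_, hmul⟩
  have k1 := int_mul_add_eq_zero τ (m := c' * a + d' * c) (n := c' * b + d' * d - 1) (by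
    push_cast
    refine mul_left_cancel₀ hl' ?_
    linear_combination hcd' + c' * hab + d' * hcd)
  have k2 := int_mul_add_eq_zero τ (m := a' * a + b' * c - 1) (n := a' * b + b' * d) (by
    push_cast
    refine mul_left_cancel₀ hl' ?_
    linear_combination hab' + a' * hab + b' * hcd)
  have hdet : (a * d - b * c) * (a' * d' - b' * c') = 1 := by
    linear_combination (d * d' + c' * b) * k2.1 - (a' * b + b' * d) * k1.1 + k1.2
  have hpos : 0 < a * d - b * c := by
    have hne : (c : ℂ) * τ + d ≠ 0 := by
      intro h0
      rw [← mul_right_inj' hl'] at h0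
      exact one_ne_zero (α := ℂ) (by linear_combination h0 - hcd)
    have him : (τ' : ℂ).im * Complex.normSq (c * τ + d) = ((a * d - b * c : ℤ) : ℝ) * τ.im := by
      rw [← Complex.im_mul_ofReal, ← Complex.mul_conj, ← mul_assoc, hmul]
      simp
      ring
    have := mul_pos τ'.im_pos (Complex.normSq_pos.2 hne)
    change 0 < (τ' : ℂ).im * _ at this
    rw [him] at this
    exact_mod_cast (pos_iff_pos_of_mul_pos this).2 τ.im_pos
  exact Int.eq_one_of_dvd_one hpos.le ⟨_, hdet.symm⟩

theorem evalSeries_zero (P : PowerSeries ℂ) : evalSeries 0 P = PowerSeries.constantCoeff P := by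
  rw [evalSeries, tsum_eq_single 0 fun m hm ↦ by simp [hm]]
  simp

/-- The `j`-invariant is surjective. -/
theorem exists_j_eq (c : ℂ) : ∃ τ : ℍ, E₄ τ ^ 3 = c * ModularForm.discriminant τ := by
  by_contra! hne
  set P := toC cubeSeries - PowerSeries.C c * toC discSeries with hPdef
  have hCD : PowerSeries.C c * toC discSeries ∈ convSubring :=
    mul_mem (C_mem_convSubring c) toC_discSeries_mem
  have hP : P ∈ convSubring := sub_mem toC_cubeSeries_mem hCD
  set G : ℍ → ℂ := fun τ ↦ E₄ τ ^ 3 - c * ModularForm.discriminant τ with hGdef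
  have hG0 (τ : ℍ) : G τ ≠ 0 := sub_ne_zero.2 (hne τ)
  have hG (τ : ℍ) : G τ = evalSeries (Function.Periodic.qParam 1 (τ : ℂ)) P := by
    have hq := norm_qParam_lt one_pos τ
    rw [hGdef, hPdef, evalSeries_sub hq toC_cubeSeries_mem hCD,
      evalSeries_mul hq (C_mem_convSubring c) toC_discSeries_mem, evalSeries_C,
      ← E₄_pow_three_eq_evalSeries, ← discriminant_eq_evalSeries]
  have hGsmul (a b c d : ℤ) (hdet : a * d - b * c = 1) (τ τ' : ℍ)
      (h : (τ' : ℂ) * (c * τ + d) = a * τ + b) : G τ' = ((c : ℂ) * τ + d) ^ 12 * G τ := by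
    simp only [hGdef]
    rw [E₄_pow_three_apply_smul a b c d hdet τ τ' h, discriminant_apply_smul a b c d hdet τ τ' h]
    ring
  have hP0 : evalSeries 0 P = 1 := by
    obtain ⟨u, hu, -⟩ := toR_discSeries_eq (k := ℂ)
    have h1 := constantCoeff_toR_cubeSeries (k := ℂ)
    rw [evalSeries_zero, hPdef, map_sub, map_mul]
    rw [show toC discSeries = _ from hu, show PowerSeries.constantCoeff (toC cubeSeries) = 1 from h1]
    simp
  have hlim : Filter.Tendsto G atImInfty (nhds 1) := by
    have h1 := (differentiableAt_evalSeries hP (z := 0) (by simp)).continuousAt.tendsto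
    rw [hP0] at h1
    refine (h1.comp (qParam_tendsto_atImInfty one_pos)).congr fun τ ↦ (hG τ).symm
  have hlim' : Filter.Tendsto (fun τ ↦ (G τ)⁻¹) atImInfty (nhds 1) := by
    simpa using hlim.inv₀ one_ne_zero
  obtain ⟨f, hf⟩ := exists_modularForm_of_isBounded (-12) (F := fun τ ↦ (G τ)⁻¹)
    (by
      intro z hz
      have h1 : DifferentiableAt ℂ (fun w ↦ evalSeries (Function.Periodic.qParam 1 w) P) z :=
        (differentiableAt_evalSeries hP (norm_qParam_lt one_pos ⟨z, hz⟩)).comp z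
          (Function.Periodic.differentiable_qParam).differentiableAt
      have h2 := h1.inv (by simpa [← hG ⟨z, hz⟩] using hG0 ⟨z, hz⟩)
      refine h2.differentiableWithinAt.congr (fun w hw ↦ ?_) ?_
      · simp [ofComplex_apply_of_im_pos hw, hG]
      · simp [ofComplex_apply_of_im_pos hz, hG])
    (hlim'.isBigO_one ℝ)
    (fun τ τ' h ↦ by
      rw [hGsmul 1 1 0 1 (by norm_num) τ τ' (by push_cast; linear_combination h)]
      simp)
    (fun τ τ' h ↦ by
      rw [hGsmul 0 (-1) 1 0 (by norm_num) τ τ' (by push_cast; linear_combination h)]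
      simp only [Int.cast_one, one_mul, Int.cast_zero, add_zero, mul_inv, zpow_neg]
      norm_cast)
  have hf0 : ⇑f = 0 := ModularFormClass.levelOne_neg_weight_eq_zero (by norm_num) f
  have := hf UpperHalfPlane.I
  rw [hf0] at this
  exact inv_ne_zero (hG0 _) this.symm

/-- Each value of the `j`-invariant is attained in the fundamental domain. -/
theorem exists_j_eq_mem_fd (c : ℂ) : ∃ τ : ℍ, E₄ τ ^ 3 = c * ModularForm.discriminant τ ∧
    1 ≤ Complex.normSq τ ∧ |(τ : ℂ).re| ≤ 1 / 2 := by
  obtain ⟨τ, hτ⟩ := exists_j_eq c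
  obtain ⟨g, hg1, hg2⟩ := ModularGroup.exists_smul_mem_fd τ
  refine ⟨g • τ, ?_, hg1, hg2⟩
  have hdet : g 0 0 * g 1 1 - g 0 1 * g 1 0 = 1 := by
    rw [← Matrix.det_fin_two, g.det_coe]
  have hne : (g 1 0 : ℂ) * τ + g 1 1 ≠ 0 := by
    rw [← ModularGroup.denom_apply]
    exact denom_ne_zero g τ
  have h : ((g • τ : ℍ) : ℂ) * (g 1 0 * τ + g 1 1) = g 0 0 * τ + g 0 1 := by
    rw [UpperHalfPlane.coe_specialLinearGroup_apply, ← eq_div_iff (by simpa using hne)]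
    simp
  rw [E₄_pow_three_apply_smul _ _ _ _ hdet τ _ h, discriminant_apply_smul _ _ _ _ hdet τ _ h, hτ]
  ring

/-- A form of Hensel's lemma without uniqueness over an algebraically closed valued field. -/
theorem ValuationSubring.exists_root_of_eval_mem_maximalIdeal {K : Type*} [Field K] [IsAlgClosed K]
    (O : ValuationSubring K) (P : O[X]) (x₀ x₁ : O)
    (h₀ : P.eval x₀ ∈ IsLocalRing.maximalIdeal O) (h₁ : IsUnit (P.eval x₁)) :
    ∃ r : O, P.eval r = 0 ∧ r - x₀ ∈ IsLocalRing.maximalIdeal O := by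
  by_contra! hcon
  rw [ValuationSubring.valuation_lt_one_iff] at h₀
  rw [ValuationSubring.valuation_eq_one_iff] at h₁
  set Q := P.map O.subtype with hQ
  have heval (x : O) : ((P.eval x : O) : K) = Q.leadingCoeff * (Q.roots.map fun r ↦ (x : K) - r).prod := by
    rw [← (IsAlgClosed.splits Q).eval_eq_prod_roots, hQ]
    exact (Polynomial.eval_map_apply (f := O.subtype) x).symm
  have hQ0 : Q ≠ 0 := by
    intro h
    have := heval x₁
    rw [h] at this
    rw [this] at h₁
    simp at h₁
  have hle : O.valuation (P.eval x₁ : O) ≤ O.valuation (P.eval x₀ : O) := by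
    rw [heval, heval, map_mul, map_mul, map_multiset_prod, map_multiset_prod, Multiset.map_map,
      Multiset.map_map]
    refine mul_le_mul_right (Multiset.prod_map_le_prod_map₀ _ _ (fun r _ ↦ zero_le) ?_) _
    intro r hr
    simp only [Function.comp_apply]
    by_cases hrO : r ∈ O
    · have hx₁ : O.valuation ((x₁ : K) - r) ≤ 1 := by
        rw [ValuationSubring.valuation_le_one_iff]
        exact sub_mem x₁.2 hrO
      refine hx₁.trans ?_
      have hroot : P.eval (⟨r, hrO⟩ : O) = 0 := by
        have h := heval ⟨r, hrO⟩
        rw [← (IsAlgClosed.splits Q).eval_eq_prod_roots] at h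
        exact Subtype.ext (h.trans (isRoot_of_mem_roots hr))
      have h := hcon _ hroot
      rw [ValuationSubring.valuation_lt_one_iff, not_lt] at h
      rwa [Valuation.map_sub_swap]
    · have hr1 : 1 < O.valuation r := by
        rwa [← not_le, ValuationSubring.valuation_le_one_iff]
      rw [Valuation.map_sub_eq_of_lt_right _ ((O.valuation_le_one x₁).trans_lt hr1),
        Valuation.map_sub_eq_of_lt_right _ ((O.valuation_le_one x₀).trans_lt hr1)]
  rw [h₁] at hle
  exact hle.not_gt h₀

theorem ValuationSubring.mem_of_isIntegral_int {K : Type*} [Field K] (O : ValuationSubring K) {x : K}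
    (h : IsIntegral ℤ x) : x ∈ O := by
  have h' : IsIntegral O x := h.tower_top
  obtain ⟨y, rfl⟩ := IsIntegrallyClosed.isIntegral_iff.1 h'
  exact y.2

variable (p) in
/-- There is a valuation ring of `ℂ` above the prime `p`. -/
theorem exists_valuationSubring_residue_charP :
    ∃ O : ValuationSubring ℂ, CharP (IsLocalRing.ResidueField O) p := by
  have hI : Ideal.span {(p : (⊥ : Subring ℂ))} ≠ ⊤ := by
    rw [Ne, Ideal.span_singleton_eq_top, isUnit_iff_exists_inv]
    rintro ⟨⟨x, hx⟩, h⟩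
    obtain ⟨n, rfl⟩ := Subring.mem_bot.1 hx
    have h1 : ((p * n : ℤ) : ℂ) = 1 := by
      have := congrArg Subtype.val h
      push_cast
      exact this
    have hdvd : (p : ℤ) ∣ 1 := ⟨n, by exact_mod_cast h1.symm⟩
    exact hp.out.one_lt.ne' (Nat.dvd_one.1 (by exact_mod_cast hdvd))
  obtain ⟨O, -, hO⟩ := Ideal.image_subset_nonunits_valuationSubring _ hI
  refine ⟨O, (CharP.charP_iff_prime_eq_zero hp.out).2 ?_⟩
  have h1 : (p : ℂ) ∈ O.nonunits := hO ⟨_, Ideal.mem_span_singleton_self _, by simp⟩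
  obtain ⟨y, hy, hyp⟩ := O.image_maximalIdeal.ge h1
  have : y = (p : O) := Subtype.ext hyp
  rw [this] at hy
  rw [← map_natCast (IsLocalRing.residue O), IsLocalRing.residue_eq_zero_iff]
  exact hy

/-- Every integral matrix of determinant `p` is equivalent to a Hecke representative. -/
theorem exists_heckeFun_mul_eq {F : ℍ → ℂ} (hF : IsWeightTwelve F) (a b c d : ℤ)
    (hdet : a * d - b * c = p) (τ τ' : ℍ) (h : (τ' : ℂ) * (c * τ + d) = a * τ + b) :
    ∃ γ, heckeFun p F γ τ * ((c : ℂ) * τ + d) ^ 12 = (p : ℂ) ^ 12 * F τ' := by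
  have hp0 := p_ne_zero_complex (p := p)
  have hdet' : (a : ZMod p) * d = b * c := by
    have := congrArg (Int.cast : ℤ → ZMod p) hdet
    push_cast at this
    rw [CharP.cast_eq_zero] at this
    linear_combination this
  by_cases hac : (a : ZMod p) = 0 ∧ (c : ZMod p) = 0
  · obtain ⟨a', rfl⟩ := (ZMod.intCast_zmod_eq_zero_iff_dvd a p).1 hac.1
    obtain ⟨c', rfl⟩ := (ZMod.intCast_zmod_eq_zero_iff_dvd c p).1 hac.2
    refine ⟨none, ?_⟩
    have hdet1 : a' * d - b * c' = 1 := by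
      have hp1 : (p : ℤ) ≠ 0 := by exact_mod_cast hp.out.ne_zero
      refine mul_left_cancel₀ hp1 ?_
      linear_combination hdet
    rw [hF a' b c' d hdet1 (heckePt p none τ) τ' (by
      rw [coe_heckePt_none]; push_cast at h; linear_combination h)]
    simp only [heckeFun, coe_heckePt_none]
    push_cast
    ring
  · obtain ⟨t, htb, htd⟩ : ∃ t : ZMod p, (b : ZMod p) = t * a ∧ (d : ZMod p) = t * c := by
      by_cases ha : (a : ZMod p) = 0
      · have hc : (c : ZMod p) ≠ 0 := fun hc ↦ hac ⟨ha, hc⟩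
        refine ⟨d / c, ?_, by field_simp⟩
        rw [ha, zero_mul] at hdet'
        rw [ha, mul_zero]
        exact (mul_eq_zero.1 hdet'.symm).resolve_right hc
      · refine ⟨b / a, by field_simp, ?_⟩
        field_simp
        linear_combination hdet'
    have hval : ((t.val : ℤ) : ZMod p) = t := by simp
    obtain ⟨b', hb'⟩ : (p : ℤ) ∣ b - t.val * a := by
      rw [← ZMod.intCast_zmod_eq_zero_iff_dvd, Int.cast_sub, Int.cast_mul, hval, htb, sub_self]
    obtain ⟨d', hd'⟩ : (p : ℤ) ∣ d - t.val * c := by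
      rw [← ZMod.intCast_zmod_eq_zero_iff_dvd, Int.cast_sub, Int.cast_mul, hval, htd, sub_self]
    obtain rfl : b = p * b' + t.val * a := by linear_combination hb'
    obtain rfl : d = p * d' + t.val * c := by linear_combination hd'
    refine ⟨some t, ?_⟩
    have hdet1 : a * d' - b' * c = 1 := by
      have hp1 : (p : ℤ) ≠ 0 := by exact_mod_cast hp.out.ne_zero
      refine mul_left_cancel₀ hp1 ?_
      linear_combination hdet
    push_cast at h
    rw [hF a b' c d' hdet1 (heckePt p (some t) τ) τ' (by
      rw [coe_heckePt_some]
      field_simp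
      linear_combination h)]
    simp only [heckeFun, coe_heckePt_some]
    push_cast
    field_simp
    ring

/-- A vanishing factor of the modular polynomial of level `p` yields complex multiplication by an
element of norm `p`. -/
theorem exists_fixed_of_factor_eq_zero (γ : Option (ZMod p)) (τ : ℍ)
    (h : E₄ τ ^ 3 * ModularForm.discriminant (heckePt p γ τ)
      = E₄ (heckePt p γ τ) ^ 3 * ModularForm.discriminant τ) :
    ∃ a b c d : ℤ, a * d - b * c = p ∧ (τ : ℂ) * (c * τ + d) = a * τ + b := by
  have hp0 := p_ne_zero_complex (p := p)
  obtain ⟨a, b, c, d, hdet, hτ⟩ := exists_smul_of_j_eq (heckePt p γ τ) τ h.symm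
  rcases γ with _ | t
  · rw [coe_heckePt_none] at hτ
    exact ⟨a * p, b, c * p, d, by linear_combination (p : ℤ) * hdet, by
      push_cast; linear_combination hτ⟩
  · rw [coe_heckePt_some] at hτ
    field_simp at hτ
    exact ⟨a, a * t.val + b * p, c, c * t.val + d * p, by linear_combination (p : ℤ) * hdet, by
      push_cast; linear_combination hτ⟩

theorem re_im_of_fixed {a b c d : ℤ} {τ : ℍ} (h : (τ : ℂ) * (c * τ + d) = a * τ + b) :
    2 * c * (τ : ℂ).re = a - d ∧ c * Complex.normSq τ = -b := by
  have hre := congrArg Complex.re h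
  have him := congrArg Complex.im h
  simp only [Complex.mul_re, Complex.mul_im, Complex.add_re, Complex.add_im, Complex.intCast_re,
    Complex.intCast_im, zero_mul, add_zero, sub_zero] at hre him
  have h1 : 2 * c * (τ : ℂ).re = a - d := by
    refine mul_right_cancel₀ τ.im_pos.ne' ?_
    change _ * (τ : ℂ).im = _ * (τ : ℂ).im
    linear_combination him
  refine ⟨h1, ?_⟩
  rw [Complex.normSq_apply]
  linear_combination (τ : ℂ).re * h1 - hre

theorem eq_of_fixed {a b c d : ℤ} (hc : c ≠ 0) {τ τ' : ℍ}
    (h : (τ : ℂ) * (c * τ + d) = a * τ + b) (h' : (τ' : ℂ) * (c * τ' + d) = a * τ' + b) :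
    τ = τ' := by
  obtain ⟨h1, h2⟩ := re_im_of_fixed h
  obtain ⟨h1', h2'⟩ := re_im_of_fixed h'
  have hc' : (c : ℝ) ≠ 0 := by exact_mod_cast hc
  have hre : (τ : ℂ).re = (τ' : ℂ).re :=
    mul_left_cancel₀ hc' (by linear_combination (h1 - h1') / 2)
  have hn : Complex.normSq τ = Complex.normSq τ' := mul_left_cancel₀ hc' (by rw [h2, h2'])
  rw [Complex.normSq_apply, Complex.normSq_apply, hre] at hn
  have him : (τ : ℂ).im = (τ' : ℂ).im := by
    have hpos : 0 < (τ : ℂ).im := τ.im_pos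
    have hpos' : 0 < (τ' : ℂ).im := τ'.im_pos
    nlinarith
  exact UpperHalfPlane.ext (Complex.ext hre him)

theorem isReducedQuad_of_fixed {a b c d : ℤ} (hdet : a * d - b * c = p) {τ : ℍ}
    (h : (τ : ℂ) * (c * τ + d) = a * τ + b) (hn : 1 ≤ Complex.normSq τ)
    (hre : |(τ : ℂ).re| ≤ 1 / 2) : IsReducedQuad p (a + d) (a, b, c, d) := by
  obtain ⟨h1, h2⟩ := re_im_of_fixed h
  refine ⟨hdet, rfl, ?_, ?_, ?_⟩
  · rintro rfl
    simp only [Int.cast_zero, mul_zero, zero_mul] at h1 h2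
    have had : a = d := by exact_mod_cast sub_eq_zero.1 h1.symm
    rw [had, mul_zero, sub_zero] at hdet
    have hprime : Prime (p : ℤ) := Nat.prime_iff_prime_int.1 hp.out
    exact hprime.irreducible.not_isSquare ⟨d, hdet.symm⟩
  · have : |(d - a : ℝ)| ≤ |(c : ℝ)| := by
      rw [abs_sub_comm, ← h1, abs_mul, abs_mul, abs_two]
      nlinarith [abs_nonneg (c : ℝ)]
    exact_mod_cast this
  · have : (c : ℝ) ^ 2 ≤ -(b * c) := by
      rw [show -(b * c : ℝ) = c ^ 2 * Complex.normSq τ by linear_combination -c * h2]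
      exact le_mul_of_one_le_right (sq_nonneg _) hn
    exact_mod_cast this

theorem sum_hasse_coeffs_eq_frobTrace {k : Type*} [Field k] [CharP k p] (h5 : 5 ≤ p) {c : ℕ → k}
    (hc : ∀ x y : k, hasse p x y ^ 12 = ∑ i ∈ range p, c i * (x ^ 3) ^ i * (y ^ 2) ^ (p - 1 - i))
    (j : ZMod p) (h0 : j ≠ 0) (h1 : j ≠ 1728) :
    ∑ i ∈ range p, c i * ZMod.castHom dvd_rfl k j ^ i
      * (ZMod.castHom dvd_rfl k j - 1728) ^ (p - 1 - i) =
    ZMod.castHom dvd_rfl k (((frobTrace p ((fJ.map (Int.castRingHom (ZMod p))).eval j)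
      ((gJ.map (Int.castRingHom (ZMod p))).eval j) : ℤ) : ZMod p) ^ 12) := by
  have hH := coeff_cubic_pow_eq_frobTrace (by omega : 3 ≤ p)
    ((fJ.map (Int.castRingHom (ZMod p))).eval j) ((gJ.map (Int.castRingHom (ZMod p))).eval j)
  have hcub : (X ^ 3 + C ((fJ.map (Int.castRingHom (ZMod p))).eval j) * X
      + C ((gJ.map (Int.castRingHom (ZMod p))).eval j) : (ZMod p)[X])
      = cubic (j * (j - 1728)) (j * (j - 1728) ^ 2) := by
    have hf : (fJ.map (Int.castRingHom (ZMod p))).eval j = -3 * (j * (j - 1728)) := by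
      simp [fJ]; ring
    have hg : (gJ.map (Int.castRingHom (ZMod p))).eval j = 2 * (j * (j - 1728) ^ 2) := by
      simp [gJ]; ring
    rw [hf, hg, cubic, C_mul (a := -3), C_mul (a := 2), C_neg, map_ofNat C 3, map_ofNat C 2]
    ring
  rw [hcub] at hH
  rw [← hH, map_pow]
  change _ = (ZMod.castHom dvd_rfl k (hasse p _ _)) ^ 12
  rw [hasse_map, hc, map_mul, map_mul, map_pow, map_sub, map_ofNat]
  have hD : (ZMod.castHom dvd_rfl k j ^ 2 * (ZMod.castHom dvd_rfl k j - 1728) ^ 3) ^ (p - 1) = 1 := by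
    have h : (j ^ 2 * (j - 1728) ^ 3) ^ (p - 1) = 1 :=
      ZMod.pow_card_sub_one_eq_one (mul_ne_zero (pow_ne_zero _ h0)
        (pow_ne_zero _ (sub_ne_zero.2 h1)))
    have := congrArg (ZMod.castHom dvd_rfl k) h
    rwa [map_pow, map_mul, map_pow, map_pow, map_sub, map_ofNat, map_one] at this
  generalize ZMod.castHom dvd_rfl k j = t at *
  refine sum_congr rfl fun i hi ↦ ?_
  have hpi : p - 1 = i + (p - 1 - i) := by have := mem_range.1 hi; omega
  rw [← mul_one (c i * t ^ i * (t - 1728) ^ (p - 1 - i)), ← hD]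
  conv_lhs => rw [hpi]
  rw [Nat.add_sub_cancel_left, pow_add,
    show (t * (t - 1728)) ^ 3 = t * (t ^ 2 * (t - 1728) ^ 3) by ring,
    show (t * (t - 1728) ^ 2) ^ 2 = (t - 1728) * (t ^ 2 * (t - 1728) ^ 3) by ring,
    mul_pow t, mul_pow (t - 1728)]
  ring

variable (p) in
theorem isIntegral_rootUnity : IsIntegral ℤ (rootUnity p) :=
  .of_pow hp.out.pos (by rw [rootUnity_pow]; exact isIntegral_one)

/-- Every element of the prime field lifts to the `j`-invariant of a point in the fundamental
domain with complex multiplication by an element of norm `p`. -/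
theorem exists_fixed_of_residue (O : ValuationSubring ℂ) [CharP (IsLocalRing.ResidueField O) p]
    (z : IsLocalRing.ResidueField O) (hz : z ^ p = z) :
    ∃ (J : O) (τ : ℍ), IsLocalRing.residue O J = z ∧
      E₄ τ ^ 3 = J * ModularForm.discriminant τ ∧ 1 ≤ Complex.normSq τ ∧ |(τ : ℂ).re| ≤ 1 / 2 ∧
      ∃ a b c d : ℤ, a * d - b * c = p ∧ (τ : ℂ) * (c * τ + d) = a * τ + b := by
  obtain ⟨a, ha, hφ⟩ := exists_modular_polynomial O.toSubring
    (O.mem_of_isIntegral_int (isIntegral_rootUnity p)) (IsLocalRing.residue O)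
  set P : O[X] := ∑ i ∈ range (2 * (p + 1) + 1), C (a i : O) * X ^ i with hP
  have heval (x : O) : P.eval x = ∑ i ∈ range (2 * (p + 1) + 1), (a i : O) * x ^ i := by
    simp [hP, eval_finsetSum]
  have hres (x : O) : IsLocalRing.residue O (P.eval x)
      = -(IsLocalRing.residue O x ^ p - IsLocalRing.residue O x) ^ 2 := by
    rw [heval, ← hφ, map_sum]
    simp only [map_mul, map_pow]
  obtain ⟨x₀, rfl⟩ := IsLocalRing.residue_surjective z
  obtain ⟨x₁, hx₁⟩ : ∃ x₁ : O, x₁ ^ p - x₁ = 1 := by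
    have hdeg : ((X + C 1 : ℤ[X])).degree < (p : ℕ) := by
      rw [degree_X_add_C]; exact_mod_cast hp.out.one_lt
    have hmon := monic_X_pow_sub (R := ℤ) hdeg
    obtain ⟨x, hx⟩ := IsAlgClosed.exists_eval₂_eq_zero_of_injective (Int.castRingHom ℂ)
      Int.cast_injective (X ^ p - (X + C 1 : ℤ[X])) (by
        rw [degree_sub_eq_left_of_degree_lt (by rwa [degree_X_pow]), degree_X_pow]
        exact_mod_cast hp.out.ne_zero)
    refine ⟨⟨x, O.mem_of_isIntegral_int ⟨_, hmon, hx⟩⟩, Subtype.ext ?_⟩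
    simp at hx
    push_cast
    linear_combination hx
  obtain ⟨J, hJ, hJx⟩ := O.exists_root_of_eval_mem_maximalIdeal P x₀ x₁
    (by rw [← IsLocalRing.residue_eq_zero_iff, hres, hz]; simp)
    (by
      rw [← IsLocalRing.residue_ne_zero_iff_isUnit, hres, ← map_pow, ← map_sub, hx₁]
      simp)
  obtain ⟨τ, hτ, h1, h2⟩ := exists_j_eq_mem_fd (J : ℂ)
  refine ⟨J, τ, ?_, hτ, h1, h2, ?_⟩
  · rwa [← sub_eq_zero, ← map_sub, IsLocalRing.residue_eq_zero_iff]
  · have hprod := ha τ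
    have hsum : ∑ i ∈ range (2 * (p + 1) + 1), (a i : ℂ) * (E₄ τ ^ 3) ^ i
        * ModularForm.discriminant τ ^ (2 * (p + 1) - i)
        = ModularForm.discriminant τ ^ (2 * (p + 1)) * (P.eval J : O) := by
      rw [heval]
      push_cast
      rw [mul_sum]
      refine sum_congr rfl fun i hi ↦ ?_
      rw [hτ, ← pow_mul_pow_sub (ModularForm.discriminant τ) (mem_range_succ_iff.1 hi)]
      ring
    rw [hsum, hJ, ZeroMemClass.coe_zero, mul_zero, Finset.prod_eq_zero_iff] at hprod
    obtain ⟨γ, -, hγ⟩ := hprod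
    exact exists_fixed_of_factor_eq_zero γ τ (sub_eq_zero.1 hγ)

/-- Kronecker-type congruence for the multiplier of a complex multiplication of norm `p`. -/
theorem multiplier_pow_eq (O : ValuationSubring ℂ) [CharP (IsLocalRing.ResidueField O) p]
    {e : ℕ → IsLocalRing.ResidueField O}
    (he : PowerSeries.X ^ p ∣ ∑ i ∈ range p, PowerSeries.C (e i)
      * toR (IsLocalRing.ResidueField O) cubeSeries ^ i
      * (toR (IsLocalRing.ResidueField O) cubeSeries
        - 1728 * toR (IsLocalRing.ResidueField O) discSeries) ^ (p - 1 - i) - 1)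
    {J : O} {τ : ℍ} (hJ : E₄ τ ^ 3 = J * ModularForm.discriminant τ)
    (a b c d : ℤ) (hdet : a * d - b * c = p) (hτ : (τ : ℂ) * (c * τ + d) = a * τ + b)
    (β : O) (hβ : (β : ℂ) * (c * τ + d) = p) :
    (IsLocalRing.residue O β ^ 12) ^ (p + 1) = IsLocalRing.residue O β ^ 12 *
      ∑ i ∈ range p, e i * IsLocalRing.residue O J ^ i
        * (IsLocalRing.residue O J - 1728) ^ (p - 1 - i) := by
  obtain ⟨u, hu, hφ⟩ := exists_multiplier_polynomial O.toSubring
    (O.mem_of_isIntegral_int (isIntegral_rootUnity p)) (IsLocalRing.residue O) (β ^ 12) e he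
  have hφ' := hφ (IsLocalRing.residue O J)
  obtain ⟨γ, hγ⟩ := exists_heckeFun_mul_eq discriminant_apply_smul a b c d hdet τ τ hτ
  have hne : (c : ℂ) * τ + d ≠ 0 := right_ne_zero_of_mul (hβ.trans_ne p_ne_zero_complex)
  have hprod := hu τ
  rw [Finset.prod_eq_zero (mem_univ γ) (by
    rw [sub_eq_zero]
    refine mul_right_cancel₀ (pow_ne_zero 12 hne) ?_
    rw [hγ, ← hβ]
    change ((β ^ 12 : O) : ℂ) * _ * _ = _
    push_cast
    ring)] at hprod
  have hsum : ∑ i ∈ range (p + 1 + 1), (u i : O) * J ^ i = 0 := by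
    refine Subtype.ext ?_
    refine mul_left_cancel₀ (pow_ne_zero (p + 1) (ModularForm.discriminant_ne_zero τ)) ?_
    rw [ZeroMemClass.coe_zero, mul_zero, hprod]
    push_cast
    rw [mul_sum]
    refine sum_congr rfl fun i hi ↦ ?_
    rw [hJ, ← pow_mul_pow_sub (ModularForm.discriminant τ) (mem_range_succ_iff.1 hi)]
    ring
  have h0 := congrArg (IsLocalRing.residue O) hsum
  rw [map_sum, map_zero] at h0
  simp only [map_mul, map_pow] at h0
  rw [h0] at hφ'
  have := (sub_eq_zero.1 hφ'.symm)
  simpa only [map_pow] using this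

theorem deuringLift (p : ℕ) (hp : p.Prime) (h5 : 5 ≤ p) : DeuringLift p := by
  have : Fact p.Prime := ⟨hp⟩
  obtain ⟨O, hO⟩ := exists_valuationSubring_residue_charP p
  set k := IsLocalRing.ResidueField O
  set ι := ZMod.castHom dvd_rfl k with hι
  obtain ⟨e, he, hc⟩ := exists_hasse_coeffs (k := k) h5
  let Rel (q : ℤ × ℤ × ℤ × ℤ) (j : ZMod p) : Prop :=
    ∃ (J : O) (τ : ℍ), IsLocalRing.residue O J = ι j ∧ E₄ τ ^ 3 = J * ModularForm.discriminant τ ∧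
      (τ : ℂ) * (q.2.2.1 * τ + q.2.2.2) = q.1 * τ + q.2.1
  have hRel {q : ℤ × ℤ × ℤ × ℤ} (hq : q.2.2.1 ≠ 0) {j j' : ZMod p} (h : Rel q j) (h' : Rel q j') :
      j = j' := by
    obtain ⟨J, τ, h1, h2, h3⟩ := h
    obtain ⟨J', τ', h1', h2', h3'⟩ := h'
    obtain rfl := eq_of_fixed hq h3 h3'
    have hJ : J = J' := Subtype.ext (mul_right_cancel₀ (ModularForm.discriminant_ne_zero τ)
      (h2.symm.trans h2'))
    exact ι.injective (by rw [← h1, ← h1', hJ])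
  refine ⟨fun q ↦ if h : ∃ j, Rel q j then h.choose else 0, fun j h0 h1728 ↦ ?_⟩
  obtain ⟨J, τ, hJ, hτJ, hn, hre, a, b, c, d, hdet, hτ⟩ := exists_fixed_of_residue O (ι j)
    (by rw [← map_pow, ZMod.pow_card])
  have hred := isReducedQuad_of_fixed hdet hτ hn hre
  have hj : Rel (a, b, c, d) j := ⟨J, τ, hJ, hτJ, hτ⟩
  refine ⟨(a, b, c, d), hred, ?_, ?_⟩
  · have hex : ∃ j, Rel (a, b, c, d) j := ⟨j, hj⟩
    simp only [dif_pos hex]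
    exact hRel hred.ne_zero hex.choose_spec hj
  simp only
  rw [or_iff_not_imp_left]
  intro htr
  have hdetC : (a : ℂ) * d - b * c = p := by exact_mod_cast hdet
  have hβ : ((a + d : ℤ) - (c * τ + d) : ℂ) * (c * τ + d) = p := by
    push_cast
    linear_combination hdetC - c * hτ
  have hmem (x : ℂ) (hx : ((a + d : ℤ) - x) * x = p) : x ∈ O := by
    refine O.mem_of_isIntegral_int ⟨X ^ 2 - (C (a + d) * X - C (p : ℤ)), ?_, ?_⟩
    · refine monic_X_pow_sub ((degree_sub_le _ _).trans_lt (max_lt ?_ ?_))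
      · exact (degree_C_mul_X_le _).trans_lt (by norm_num)
      · exact degree_C_le.trans_lt (by norm_num)
    · rw [eval₂_sub, eval₂_X_pow, eval₂_sub, eval₂_mul, eval₂_C, eval₂_C, eval₂_X]
      simp only [eq_intCast, Int.cast_natCast]
      linear_combination -hx
  set β : O := ⟨c * τ + d, hmem _ hβ⟩ with hβdef
  set β' : O := ⟨(a + d : ℤ) - (c * τ + d), hmem _ (by linear_combination hβ)⟩ with hβdef'
  have hsum : β + β' = ((a + d : ℤ) : O) := Subtype.ext (by simp [hβdef, hβdef']; ring)
  have hmul : β' * β = (p : O) := Subtype.ext (by simpa [hβdef, hβdef'] using hβ)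
  have hsum' := congrArg (IsLocalRing.residue O) hsum
  have hmul' := congrArg (IsLocalRing.residue O) hmul
  rw [map_add, map_intCast] at hsum'
  rw [map_mul, map_natCast, CharP.cast_eq_zero, mul_eq_zero] at hmul'
  have hH := sum_hasse_coeffs_eq_frobTrace h5 hc j h0 h1728
  have m1 := multiplier_pow_eq O he hτJ a b c d hdet hτ β' hβ
  have m2 := multiplier_pow_eq O he hτJ d (-b) (-c) a (by linear_combination hdet)
    (by push_cast; linear_combination -hτ) β (by
      simp only [hβdef]
      push_cast at hβ ⊢
      linear_combination hβ)
  rw [← hι] at hH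
  rw [hJ, hH] at m1 m2
  have hcast : ((a + d : ℤ) : k) = ι ((a + d : ℤ) : ZMod p) := by simp
  have hfin (x : k) (hx : x = ((a + d : ℤ) : k)) {y : ZMod p}
      (hxy : (x ^ 12) ^ (p + 1) = x ^ 12 * ι y) : ((a + d : ℤ) : ZMod p) ^ 12 = y := by
    refine ι.injective (mul_left_cancel₀ (a := ι ((a + d : ℤ) : ZMod p) ^ 12) ?_ ?_)
    · exact pow_ne_zero _ (by rwa [Ne, map_eq_zero])
    · rw [← hcast, ← hx, ← hxy, hx, hcast, ← map_pow, ← map_pow, pow_succ (_ ^ 12) p, ZMod.pow_card,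
        map_mul]
  rcases hmul' with h | h
  · exact hfin _ (by rw [← hsum', h, add_zero]) m2
  · exact hfin _ (by rw [← hsum', h, zero_add]) m1

end

/-- Theorem 1.2 (Lang–Trotter on average for the `j(Z) = Z` family). -/
theorem LT_average_FT_jfamily (ε : ℝ) (hε : 0 < ε) :
    ∃ C : ℝ, 0 < C ∧ ∀ T x : ℝ, 1 ≤ T → 2 ≤ x → ∀ a : ℕ → ℤ,
      (∑ t ∈ (FT T).filter fun t => aeval t (Dpoly fJ gJ) ≠ 0, (piSeq fJ gJ a t x : ℝ)) ≤
        C * (T * x ^ (5 / 4 + ε) + T ^ 2 * x ^ (3 / 4 + ε)) :=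
  average_of_residueBound (residueBound_of_deuringLift deuringLift) ε hε
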